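/- There exists a polynomial Q₃(t) of degree 2 with real coefficients such that for every ε > 0 one has Σ_{n ≤ x} d₃(n + a(n)) = x·Q₃(log x) + O_ε(x^{3/4 + ε}) as x → ∞, where d₃(m) is the number of ordered triples (a,b,c) of positive integers with abc = m and the implied constant depends only on ε. -/

import Mathlib

/-- `abelianCount n` is the number of isomorphism classes of abelian groups of order `n`:
the multiplicative function with `abelianCount (p^α) = P(α)`, the number of partitions of `α`. -/
def abelianCount (n : ℕ) : ℕ :=
  n.factorization.prod fun _ α => Fintype.card (Nat.Partition α)

/-- `d₃ m` is the number of ordered triples of positive integers with product `m`. -/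
noncomputable def d3 (m : ℕ) : ℕ :=
  Nat.card {t : ℕ × ℕ × ℕ // 0 < t.1 ∧ 0 < t.2.1 ∧ 0 < t.2.2 ∧ t.1 * t.2.1 * t.2.2 = m}

lemma geom_sum_le_inv_one_sub {z : ℝ} (hz0 : 0 ≤ z) (hz1 : z < 1) (n : ℕ) :
    ∑ i ∈ Finset.range n, z ^ i ≤ (1 - z)⁻¹ := by
  rw [← one_div, le_div_iff₀ (by linarith), geom_sum_mul_neg]
  linarith [pow_nonneg hz0 n]

open Finset in
lemma card_partition_mul_pow_le (n : ℕ) {z : ℝ} (hz0 : 0 < z) (hz1 : z < 1) :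
    (Fintype.card (Nat.Partition n) : ℝ) * z ^ n ≤ Real.exp (z / (1 - z) ^ 2) := by
  classical
  have h1z : 0 < 1 - z := by linarith
  set Φ : Nat.Partition n → (Fin n → ℕ) := fun p i => p.parts.count (i.1 + 1) with hΦ
  have hcount0 : ∀ (p : Nat.Partition n) (i : ℕ), i ∉ Finset.image (fun j : Fin n => j.1 + 1) univ →
      p.parts.count i = 0 := by
    intro p i hi
    rw [Multiset.count_eq_zero]
    intro hmem
    apply hi
    have h1 := p.parts_pos hmem
    have h2 : i ≤ n := by
      have := Multiset.le_sum_of_mem hmem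
      rwa [p.parts_sum] at this
    rw [Finset.mem_image]
    exact ⟨⟨i - 1, by omega⟩, Finset.mem_univ _, by simp; omega⟩
  have hinj : Function.Injective Φ := by
    intro p q hpq
    apply Nat.Partition.ext
    ext i
    by_cases hi : i ∈ Finset.image (fun j : Fin n => j.1 + 1) univ
    · obtain ⟨j, -, rfl⟩ := Finset.mem_image.1 hi
      exact congrFun hpq j
    · rw [hcount0 p i hi, hcount0 q i hi]
  have hsum : ∀ p : Nat.Partition n, ∑ i : Fin n, (i.1 + 1) * Φ p i = n := by
    intro p
    have h1 : p.parts.sum = ∑ i ∈ Finset.image (fun j : Fin n => j.1 + 1) univ,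
        p.parts.count i • i := by
      apply Finset.sum_multiset_count_of_subset
      intro i hi
      by_contra hni
      exact (Multiset.count_eq_zero.1 (hcount0 p i hni)) (Multiset.mem_toFinset.1 hi)
    rw [p.parts_sum, Finset.sum_image (by
      intro a _ b _ hab
      exact Fin.ext (by simpa using hab))] at h1
    conv_rhs => rw [h1]
    exact Finset.sum_congr rfl fun i _ => by simp [hΦ, mul_comm]
  have hle : ∀ (p : Nat.Partition n) (i : Fin n), Φ p i ∈ range (n + 1) := by
    intro p i
    rw [Finset.mem_range]
    have h1 : (i.1 + 1) * Φ p i ≤ n := by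
      conv_rhs => rw [← hsum p]
      exact Finset.single_le_sum (f := fun i : Fin n => (i.1 + 1) * Φ p i)
        (fun _ _ => Nat.zero_le _) (Finset.mem_univ i)
    nlinarith [Nat.zero_le (i.1 * Φ p i)]
  calc (Fintype.card (Nat.Partition n) : ℝ) * z ^ n
      = ∑ p : Nat.Partition n, ∏ i : Fin n, z ^ ((i.1 + 1) * Φ p i) := by
        simp_rw [Finset.prod_pow_eq_pow_sum, hsum]
        simp
    _ = ∑ f ∈ Finset.image Φ univ, ∏ i : Fin n, z ^ ((i.1 + 1) * f i) := by
        rw [Finset.sum_image (fun a _ b _ h => hinj h)]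
    _ ≤ ∑ f ∈ Fintype.piFinset (fun _ : Fin n => range (n + 1)),
          ∏ i : Fin n, z ^ ((i.1 + 1) * f i) := by
        apply Finset.sum_le_sum_of_subset_of_nonneg
        · intro f hf
          obtain ⟨p, -, rfl⟩ := Finset.mem_image.1 hf
          exact Fintype.mem_piFinset.2 (hle p)
        · intros; positivity
    _ = ∏ i : Fin n, ∑ c ∈ range (n + 1), z ^ ((i.1 + 1) * c) := by
        rw [Finset.prod_univ_sum]
    _ ≤ ∏ i : Fin n, Real.exp (z ^ (i.1 + 1) / (1 - z)) := by
        apply Finset.prod_le_prod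
        · intros; positivity
        intro i _
        have hzi : z ^ (i.1 + 1) ≤ z := by
          simpa using pow_le_pow_of_le_one hz0.le hz1.le (Nat.le_add_left 1 i.1)
        have hzi0 : 0 < z ^ (i.1 + 1) := by positivity
        have h1 : ∑ c ∈ range (n + 1), z ^ ((i.1 + 1) * c) ≤ (1 - z ^ (i.1 + 1))⁻¹ := by
          simp_rw [pow_mul]
          exact geom_sum_le_inv_one_sub hzi0.le (by linarith) _
        refine h1.trans ?_
        have h2 : (1 - z ^ (i.1 + 1))⁻¹ = 1 + z ^ (i.1 + 1) / (1 - z ^ (i.1 + 1)) := by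
          have : 1 - z ^ (i.1 + 1) ≠ 0 := by linarith
          field_simp
          ring
        rw [h2]
        have h3 : z ^ (i.1 + 1) / (1 - z ^ (i.1 + 1)) ≤ z ^ (i.1 + 1) / (1 - z) := by
          gcongr
        have := Real.add_one_le_exp (z ^ (i.1 + 1) / (1 - z))
        linarith
    _ = Real.exp (∑ i : Fin n, z ^ (i.1 + 1) / (1 - z)) := by rw [Real.exp_sum]
    _ ≤ Real.exp (z / (1 - z) ^ 2) := by
        apply Real.exp_le_exp.2
        rw [Fin.sum_univ_eq_sum_range (fun i => z ^ (i + 1) / (1 - z)), ← Finset.sum_div]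
        simp_rw [pow_succ]
        rw [← Finset.sum_mul]
        have := geom_sum_le_inv_one_sub hz0.le hz1 n
        calc (∑ i ∈ range n, z ^ i) * z / (1 - z) ≤ (1 - z)⁻¹ * z / (1 - z) := by gcongr
          _ = z / (1 - z) ^ 2 := by field_simp

lemma prod_factorization_le (F : ℕ → ℝ) (h0 : ∀ α, 0 ≤ F α) {B : ℝ} (hB : ∀ α, F α ≤ B ^ α)
    (hsub : ∀ δ : ℝ, 0 < δ → ∃ C : ℝ, ∀ α : ℕ, F α ≤ C * Real.exp (δ * α)) {ε : ℝ} (hε : 0 < ε) :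
    ∃ C : ℝ, 0 < C ∧ ∀ n : ℕ, n ≠ 0 → n.factorization.prod (fun _ α => F α) ≤ C * (n : ℝ) ^ ε := by
  obtain ⟨C₀, hC₀⟩ := hsub (ε * Real.log 2) (by positivity)
  set C₁ := max C₀ 1 with hC₁
  have hC₁1 : 1 ≤ C₁ := le_max_right _ _
  have hlim := (tendsto_rpow_atTop hε).comp tendsto_natCast_atTop_atTop
  obtain ⟨p₀, hp₀⟩ := Filter.eventually_atTop.1 (hlim.eventually_ge_atTop B)
  have hB0 : 0 ≤ B := by simpa using (h0 1).trans (hB 1)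
  refine ⟨C₁ ^ p₀, by positivity, fun n hn => ?_⟩
  have hn' : (n : ℝ) = ∏ p ∈ n.primeFactors, (p : ℝ) ^ n.factorization p := by
    conv_lhs => rw [← Nat.prod_factorization_pow_eq_self hn]
    rw [Finsupp.prod, Nat.support_factorization]
    push_cast
    rfl
  have key : ∀ p ∈ n.primeFactors, F (n.factorization p) ≤
      (if p < p₀ then C₁ else 1) * ((p : ℝ) ^ n.factorization p) ^ ε := by
    intro p hp
    have hp2 : (2 : ℝ) ≤ p := by exact_mod_cast (Nat.prime_of_mem_primeFactors hp).two_le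
    have hpow : ((p : ℝ) ^ n.factorization p) ^ ε = ((p : ℝ) ^ ε) ^ n.factorization p := by
      rw [← Real.rpow_natCast, ← Real.rpow_natCast, ← Real.rpow_mul (by positivity),
        ← Real.rpow_mul (by positivity), mul_comm]
    split_ifs with h
    · calc F (n.factorization p) ≤ C₀ * Real.exp (ε * Real.log 2 * (n.factorization p : ℕ)) := hC₀ _
        _ ≤ C₁ * Real.exp (ε * Real.log 2 * (n.factorization p : ℕ)) := by
            gcongr; exact le_max_left _ _
        _ ≤ C₁ * ((p : ℝ) ^ n.factorization p) ^ ε := by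
            gcongr
            rw [hpow, Real.exp_mul, Real.rpow_natCast]
            gcongr
            rw [mul_comm, Real.exp_mul, Real.exp_log (by norm_num)]
            gcongr
    · rw [one_mul, hpow]
      exact (hB _).trans (pow_le_pow_left₀ hB0 (hp₀ p (not_lt.1 h)) _)
  rw [Finsupp.prod, Nat.support_factorization]
  calc ∏ p ∈ n.primeFactors, F (n.factorization p)
      ≤ ∏ p ∈ n.primeFactors, ((if p < p₀ then C₁ else 1) * ((p : ℝ) ^ n.factorization p) ^ ε) :=
        Finset.prod_le_prod (fun _ _ => h0 _) key
    _ = (∏ p ∈ n.primeFactors, (if p < p₀ then C₁ else 1)) * (n : ℝ) ^ ε := by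
        rw [Finset.prod_mul_distrib, Real.finsetProd_rpow _ _ (fun _ _ => by positivity), ← hn']
    _ ≤ C₁ ^ p₀ * (n : ℝ) ^ ε := by
        gcongr
        rw [← Finset.prod_filter, Finset.prod_const]
        apply pow_le_pow_right₀ hC₁1
        calc _ ≤ (Finset.range p₀).card := Finset.card_le_card fun p hp => by
                simpa using (Finset.mem_filter.1 hp).2
          _ = p₀ := Finset.card_range _

lemma exists_abelianCount_le {ε : ℝ} (hε : 0 < ε) :
    ∃ C : ℝ, 0 < C ∧ ∀ n : ℕ, n ≠ 0 → (abelianCount n : ℝ) ≤ C * (n : ℝ) ^ ε := by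
  have hgen : ∀ δ : ℝ, 0 < δ → ∃ C : ℝ, 0 < C ∧ ∀ α : ℕ,
      (Fintype.card (Nat.Partition α) : ℝ) ≤ C * Real.exp (δ * α) := by
    intro δ hδ
    refine ⟨Real.exp (Real.exp (-δ) / (1 - Real.exp (-δ)) ^ 2), Real.exp_pos _, fun α => ?_⟩
    have h := card_partition_mul_pow_le α (Real.exp_pos (-δ)) (by simpa using hδ)
    have h2 : Real.exp (-δ) ^ α * Real.exp (δ * α) = 1 := by
      rw [← Real.exp_nat_mul, ← Real.exp_add]
      simp; ring
    calc (Fintype.card (Nat.Partition α) : ℝ)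
        = (Fintype.card (Nat.Partition α) : ℝ) * (Real.exp (-δ) ^ α * Real.exp (δ * α)) := by
          rw [h2, mul_one]
      _ = (Fintype.card (Nat.Partition α) : ℝ) * Real.exp (-δ) ^ α * Real.exp (δ * α) := by ring
      _ ≤ _ := by gcongr
  obtain ⟨C₁, hC₁, h₁⟩ := hgen 1 one_pos
  obtain ⟨C, hC, h⟩ := prod_factorization_le (fun α => (Fintype.card (Nat.Partition α) : ℝ))
    (fun _ => by positivity) (B := max C₁ 1 * Real.exp 1) (fun α => by
      rcases Nat.eq_zero_or_pos α with rfl | hα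
      · simp
      · rw [mul_pow, ← Real.exp_nat_mul, mul_one]
        refine (h₁ α).trans ?_
        rw [one_mul]
        gcongr
        exact (le_max_left _ _).trans (le_self_pow₀ (le_max_right _ _) hα.ne'))
    (fun δ hδ => (hgen δ hδ).imp fun _ h => h.2) hε
  refine ⟨C, hC, fun n hn => ?_⟩
  refine le_trans (le_of_eq ?_) (h n hn)
  simp [abelianCount, Finsupp.prod]

lemma exists_card_divisors_le {ε : ℝ} (hε : 0 < ε) :
    ∃ C : ℝ, 0 < C ∧ ∀ n : ℕ, (n.divisors.card : ℝ) ≤ C * (n : ℝ) ^ ε := by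
  obtain ⟨C, hC, h⟩ := prod_factorization_le (fun α => (α + 1 : ℝ))
    (fun _ => by positivity) (B := 2) (fun α => by
      exact_mod_cast Nat.lt_two_pow_self (n := α))
    (fun δ hδ => ⟨max (1 / δ) 1, fun α => by
      have h1 : (1 : ℝ) ≤ max (1 / δ) 1 := le_max_right _ _
      have h2 : 1 ≤ max (1 / δ) 1 * δ := by
        have : 1 / δ * δ ≤ max (1 / δ) 1 * δ := by gcongr; exact le_max_left _ _
        rwa [one_div_mul_cancel hδ.ne'] at this
      have h3 := Real.add_one_le_exp (δ * α)
      nlinarith [mul_le_mul_of_nonneg_right h2 (Nat.cast_nonneg (α := ℝ) α)]⟩) hε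
  refine ⟨C, hC, fun n => ?_⟩
  rcases eq_or_ne n 0 with rfl | hn
  · simp; positivity
  refine le_trans (le_of_eq ?_) (h n hn)
  rw [Nat.card_divisors hn, Finsupp.prod, Nat.support_factorization]
  push_cast
  rfl

open Finset in
lemma sum_Icc_div_eq_sum_ite {R : Type*} [AddCommMonoid R] {X N a : ℕ} (hX : X ≤ N) (ha : 1 ≤ a)
    (g : ℕ → R) :
    ∑ b ∈ Icc 1 (X / a), g b = ∑ b ∈ Icc 1 N, if a * b ≤ X then g b else 0 := by
  rw [← Finset.sum_filter]
  apply Finset.sum_congr _ fun _ _ => rfl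
  ext b
  simp only [mem_Icc, mem_filter, Nat.le_div_iff_mul_le (Nat.lt_of_lt_of_le Nat.zero_lt_one ha)]
  constructor
  · rintro ⟨h1, h2⟩
    exact ⟨⟨h1, by nlinarith⟩, by linarith⟩
  · rintro ⟨⟨h1, _⟩, h2⟩
    exact ⟨h1, by linarith⟩

open Finset in
lemma sum_Icc_sum_divisors {R : Type*} [AddCommMonoid R] (N : ℕ) (G : ℕ → ℕ → R) :
    ∑ n ∈ Icc 1 N, ∑ c ∈ n.divisors, G c (n / c) = ∑ c ∈ Icc 1 N, ∑ l ∈ Icc 1 (N / c), G c l := by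
  rw [Finset.sum_sigma', Finset.sum_sigma']
  refine Finset.sum_bij' (fun p _ => ⟨p.2, p.1 / p.2⟩) (fun p _ => ⟨p.1 * p.2, p.1⟩) ?_ ?_ ?_ ?_ ?_
  · rintro ⟨n, c⟩ h
    simp only [mem_sigma, mem_Icc, Nat.mem_divisors] at h ⊢
    obtain ⟨⟨h1, h2⟩, ⟨l, rfl⟩, h3⟩ := h
    have hc : 0 < c := Nat.pos_of_ne_zero fun h => by simp [h] at h1
    have hl : 0 < l := Nat.pos_of_ne_zero fun h => by simp [h] at h1
    rw [Nat.mul_div_cancel_left _ hc, Nat.le_div_iff_mul_le hc]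
    exact ⟨⟨hc, by nlinarith⟩, hl, by linarith⟩
  · rintro ⟨c, l⟩ h
    simp only [mem_sigma, mem_Icc, Nat.mem_divisors] at h ⊢
    obtain ⟨⟨h1, h2⟩, h3, h4⟩ := h
    rw [Nat.le_div_iff_mul_le h1] at h4
    exact ⟨⟨Nat.mul_pos h1 h3, by linarith⟩, dvd_mul_right _ _, (Nat.mul_pos h1 h3).ne'⟩
  · rintro ⟨n, c⟩ h
    simp only [mem_sigma, mem_Icc, Nat.mem_divisors] at h ⊢
    rw [Nat.mul_div_cancel' h.2.1]
  · rintro ⟨c, l⟩ h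
    simp only [mem_sigma, mem_Icc] at h ⊢
    rw [Nat.mul_div_cancel_left _ h.1.1]
  · rintro ⟨n, c⟩ h
    rfl

lemma d3_eq_sum {m : ℕ} (hm : m ≠ 0) :
    d3 m = ∑ c ∈ m.divisors, (m / c).divisors.card := by
  classical
  have : d3 m = (m.divisors.sigma fun c => (m / c).divisors).card := by
    rw [d3, ← Nat.card_eq_finsetCard]
    symm
    refine Nat.card_congr ⟨fun p => ⟨(p.1.1, p.1.2, m / p.1.1 / p.1.2), ?_⟩,
      fun t => ⟨⟨t.1.1, t.1.2.1⟩, ?_⟩, ?_, ?_⟩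
    · obtain ⟨⟨c, a⟩, h⟩ := p
      simp only [Finset.mem_sigma, Nat.mem_divisors] at h
      obtain ⟨⟨⟨l, rfl⟩, h1⟩, h2, h3⟩ := h
      have hc : 0 < c := Nat.pos_of_ne_zero fun h => by simp [h] at h1
      rw [Nat.mul_div_cancel_left _ hc] at h2 h3
      obtain ⟨b, rfl⟩ := h2
      have ha : 0 < a := Nat.pos_of_ne_zero fun h => by simp [h] at h1
      have hb : 0 < b := Nat.pos_of_ne_zero fun h => by simp [h] at h1
      simp only [Nat.mul_div_cancel_left _ hc, Nat.mul_div_cancel_left _ ha]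
      exact ⟨hc, ha, hb, by ring⟩
    · obtain ⟨⟨a, b, c⟩, h1, h2, h3, h4⟩ := t
      simp only at h1 h2 h3 h4
      simp only [Finset.mem_sigma, Nat.mem_divisors]
      subst h4
      rw [mul_assoc, Nat.mul_div_cancel_left _ h1]
      refine ⟨⟨dvd_mul_right _ _, ?_⟩, dvd_mul_right _ _, ?_⟩ <;> positivity
    · rintro ⟨⟨c, a⟩, h⟩
      rfl
    · rintro ⟨⟨a, b, c⟩, h1, h2, h3, h4⟩
      simp only at h1 h2 h3 h4
      subst h4
      simp [mul_assoc, Nat.mul_div_cancel_left _ h1, Nat.mul_div_cancel_left _ h2]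
  rw [this, Finset.card_sigma]

open Finset in
lemma sum_d3_mul (N : ℕ) (F : ℕ → ℝ) :
    ∑ m ∈ Icc 1 N, (d3 m : ℝ) * F m =
      ∑ c ∈ Icc 1 N, ∑ l ∈ Icc 1 (N / c), (l.divisors.card : ℝ) * F (c * l) := by
  rw [← sum_Icc_sum_divisors N (fun c l => (l.divisors.card : ℝ) * F (c * l))]
  refine Finset.sum_congr rfl fun m hm => ?_
  rw [d3_eq_sum (by have := (mem_Icc.1 hm).1; omega)]
  push_cast
  rw [Finset.sum_mul]
  refine Finset.sum_congr rfl fun c hc => ?_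
  rw [Nat.mul_div_cancel' (Nat.dvd_of_mem_divisors hc)]

open Finset in
lemma sum_card_divisors_mul (X : ℕ) (G : ℕ → ℝ) :
    ∑ l ∈ Icc 1 X, (l.divisors.card : ℝ) * G l =
      ∑ a ∈ Icc 1 X, ∑ b ∈ Icc 1 (X / a), G (a * b) := by
  rw [← sum_Icc_sum_divisors X (fun a b => G (a * b))]
  refine Finset.sum_congr rfl fun m hm => ?_
  rw [← nsmul_eq_mul, ← Finset.sum_const]
  refine Finset.sum_congr rfl fun c hc => ?_
  rw [Nat.mul_div_cancel' (Nat.dvd_of_mem_divisors hc)]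

lemma exists_d3_le {ε : ℝ} (hε : 0 < ε) :
    ∃ C : ℝ, 0 < C ∧ ∀ m : ℕ, 1 ≤ m → (d3 m : ℝ) ≤ C * (m : ℝ) ^ ε := by
  obtain ⟨C, hC, h⟩ := exists_card_divisors_le (half_pos hε)
  refine ⟨C ^ 2, by positivity, fun m hm => ?_⟩
  rw [d3_eq_sum (by omega)]
  push_cast
  calc ∑ c ∈ m.divisors, ((m / c).divisors.card : ℝ)
      ≤ ∑ c ∈ m.divisors, (m.divisors.card : ℝ) := by
        refine Finset.sum_le_sum fun c hc => ?_
        exact_mod_cast Finset.card_le_card (Nat.divisors_subset_of_dvd (by omega)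
          (Nat.div_dvd_of_dvd (Nat.dvd_of_mem_divisors hc)))
    _ = (m.divisors.card : ℝ) ^ 2 := by simp [sq]
    _ ≤ (C * (m : ℝ) ^ (ε / 2)) ^ 2 := by gcongr; exact h m
    _ = C ^ 2 * (m : ℝ) ^ ε := by
        rw [mul_pow, ← Real.rpow_natCast ((m : ℝ) ^ (ε / 2)), ← Real.rpow_mul (by positivity)]
        congr 2
        push_cast; ring

open Finset in
lemma sum_hyperbola {R : Type*} [AddCommMonoid R] (X : ℕ) (K : ℕ → ℕ → R) :
    ∑ a ∈ Icc 1 X, ∑ b ∈ Icc 1 (X / a), K a b =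
      ∑ b ∈ Icc 1 X.sqrt, ∑ a ∈ Icc 1 (X / b), K a b +
      ∑ a ∈ Icc 1 X.sqrt, ∑ b ∈ Ioc X.sqrt (X / a), K a b := by
  have hs : X.sqrt ≤ X := Nat.sqrt_le_self X
  have h1 : ∑ b ∈ Icc 1 X.sqrt, ∑ a ∈ Icc 1 (X / b), K a b =
      ∑ b ∈ Icc 1 X, ∑ a ∈ Icc 1 X, if b ≤ X.sqrt ∧ a * b ≤ X then K a b else 0 := by
    rw [← Finset.sum_subset (Icc_subset_Icc le_rfl hs)]
    · refine Finset.sum_congr rfl fun b hb => ?_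
      rw [sum_Icc_div_eq_sum_ite le_rfl (mem_Icc.1 hb).1]
      refine Finset.sum_congr rfl fun a _ => ?_
      simp [(mem_Icc.1 hb).2, mul_comm]
    · intro b hb hb'
      refine Finset.sum_eq_zero fun a _ => if_neg ?_
      rintro ⟨h, -⟩
      exact hb' (mem_Icc.2 ⟨(mem_Icc.1 hb).1, h⟩)
  have h2 : ∑ a ∈ Icc 1 X.sqrt, ∑ b ∈ Ioc X.sqrt (X / a), K a b =
      ∑ a ∈ Icc 1 X, ∑ b ∈ Icc 1 X, if X.sqrt < b ∧ a * b ≤ X then K a b else 0 := by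
    rw [← Finset.sum_subset (Icc_subset_Icc le_rfl hs)]
    · refine Finset.sum_congr rfl fun a ha => ?_
      rw [← Finset.sum_filter]
      refine Finset.sum_congr ?_ fun _ _ => rfl
      ext b
      have ha1 := (mem_Icc.1 ha).1
      simp only [mem_Ioc, mem_filter, mem_Icc, Nat.le_div_iff_mul_le ha1]
      constructor
      · rintro ⟨h1, h2⟩
        exact ⟨⟨by omega, by nlinarith⟩, h1, by linarith⟩
      · rintro ⟨_, h1, h2⟩
        exact ⟨h1, by linarith⟩
    · intro a ha ha'
      refine Finset.sum_eq_zero fun b _ => if_neg ?_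
      rintro ⟨h, h'⟩
      have h3 : X.sqrt < a := by
        by_contra hcon
        exact ha' (mem_Icc.2 ⟨(mem_Icc.1 ha).1, not_lt.1 hcon⟩)
      have := Nat.lt_succ_sqrt X
      have : X.sqrt.succ * X.sqrt.succ ≤ a * b := Nat.mul_le_mul h3 h
      omega
  rw [h1, h2, Finset.sum_comm, ← Finset.sum_add_distrib]
  refine Finset.sum_congr rfl fun a ha => ?_
  rw [← Finset.sum_add_distrib, sum_Icc_div_eq_sum_ite le_rfl (mem_Icc.1 ha).1]
  refine Finset.sum_congr rfl fun b _ => ?_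
  rcases le_or_gt b X.sqrt with h | h
  · simp [h, not_lt.2 h]
  · simp [h, not_le.2 h]

open Finset in
/-- In a triple with product at most `N`, at most one member exceeds `√N`; so one may always
arrange that the outermost variable is at most `√N`. -/
lemma sum_d3_mul_eq_sum_sqrt (N : ℕ) (F : ℕ → ℝ) :
    ∑ m ∈ Icc 1 N, (d3 m : ℝ) * F m =
      ∑ c ∈ Icc 1 N.sqrt, ∑ a ∈ Icc 1 (N / c), ∑ b ∈ Icc 1 (N / c / a),
        (if N.sqrt < b then 2 else 1) * F (c * (a * b)) := by
  have hs : N.sqrt ≤ N := Nat.sqrt_le_self N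
  have key : ∀ (c : ℕ), 1 ≤ c → ∀ W : ℕ → ℝ,
      ∑ a ∈ Icc 1 (N / c), ∑ b ∈ Icc 1 (N / c / a), W b * F (c * (a * b)) =
      ∑ a ∈ Icc 1 N, ∑ b ∈ Icc 1 N, if c * a * b ≤ N then W b * F (c * a * b) else 0 := by
    intro c hc W
    have : ∀ a ∈ Icc 1 N, (∑ b ∈ Icc 1 N, if c * a * b ≤ N then W b * F (c * a * b) else 0) =
        if c * a ≤ N then ∑ b ∈ Icc 1 (N / c / a), W b * F (c * (a * b)) else 0 := by
      intro a ha
      have ha1 := (mem_Icc.1 ha).1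
      split_ifs with h
      · rw [Nat.div_div_eq_div_mul, sum_Icc_div_eq_sum_ite le_rfl (Nat.mul_pos hc ha1)]
        simp_rw [mul_assoc]
      · refine Finset.sum_eq_zero fun b hb => if_neg ?_
        have hb1 := (mem_Icc.1 hb).1
        intro h'
        exact h ((Nat.le_mul_of_pos_right _ hb1).trans h')
    rw [Finset.sum_congr rfl this, ← sum_Icc_div_eq_sum_ite le_rfl hc]
  have hL : ∑ m ∈ Icc 1 N, (d3 m : ℝ) * F m =
      ∑ c ∈ Icc 1 N, ∑ a ∈ Icc 1 N, ∑ b ∈ Icc 1 N, if c * a * b ≤ N then F (c * a * b) else 0 := by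
    rw [sum_d3_mul]
    refine Finset.sum_congr rfl fun c hc => ?_
    rw [sum_card_divisors_mul (N / c) (fun l => F (c * l))]
    have := key c (mem_Icc.1 hc).1 (fun _ => 1)
    simpa using this
  have hR : ∑ c ∈ Icc 1 N.sqrt, ∑ a ∈ Icc 1 (N / c), ∑ b ∈ Icc 1 (N / c / a),
        (if N.sqrt < b then 2 else 1) * F (c * (a * b)) =
      ∑ c ∈ Icc 1 N, ∑ a ∈ Icc 1 N, ∑ b ∈ Icc 1 N,
        ((if c ≤ N.sqrt ∧ c * a * b ≤ N then F (c * a * b) else 0) +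
         (if N.sqrt < b ∧ c * a * b ≤ N then F (c * a * b) else 0)) := by
    rw [← Finset.sum_subset (Icc_subset_Icc le_rfl hs)]
    · refine Finset.sum_congr rfl fun c hc => ?_
      rw [key c (mem_Icc.1 hc).1 (fun b => if N.sqrt < b then 2 else 1)]
      refine Finset.sum_congr rfl fun a _ => Finset.sum_congr rfl fun b _ => ?_
      by_cases h1 : c * a * b ≤ N <;> by_cases h2 : N.sqrt < b <;>
        simp [h1, h2, (mem_Icc.1 hc).2]
      ring
    · intro c hc hc'
      have h3 : N.sqrt < c := by
        by_contra hcon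
        exact hc' (mem_Icc.2 ⟨(mem_Icc.1 hc).1, not_lt.1 hcon⟩)
      refine Finset.sum_eq_zero fun a ha => Finset.sum_eq_zero fun b _ => ?_
      rw [if_neg (by omega), if_neg, add_zero]
      rintro ⟨h4, h5⟩
      have := Nat.lt_succ_sqrt N
      have h6 : N.sqrt.succ * N.sqrt.succ ≤ c * b := Nat.mul_le_mul h3 h4
      have := (mem_Icc.1 ha).1
      nlinarith
  have hswap : ∑ c ∈ Icc 1 N, ∑ a ∈ Icc 1 N, ∑ b ∈ Icc 1 N,
      (if N.sqrt < b ∧ c * a * b ≤ N then F (c * a * b) else 0) =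
      ∑ c ∈ Icc 1 N, ∑ a ∈ Icc 1 N, ∑ b ∈ Icc 1 N,
      (if N.sqrt < c ∧ c * a * b ≤ N then F (c * a * b) else 0) := by
    have hg : ∀ f : ℕ → ℕ → ℕ → ℝ, ∑ c ∈ Icc 1 N, ∑ a ∈ Icc 1 N, ∑ b ∈ Icc 1 N, f c a b =
        ∑ c ∈ Icc 1 N, ∑ a ∈ Icc 1 N, ∑ b ∈ Icc 1 N, f b a c := by
      intro f
      rw [Finset.sum_comm, Finset.sum_comm (f := fun c a => ∑ b ∈ Icc 1 N, f b a c)]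
      exact Finset.sum_congr rfl fun a _ => Finset.sum_comm
    rw [hg]
    refine Finset.sum_congr rfl fun c _ => Finset.sum_congr rfl fun a _ =>
      Finset.sum_congr rfl fun b _ => ?_
    rw [show b * a * c = c * a * b by ring]
  rw [hL, hR]
  simp_rw [Finset.sum_add_distrib]
  rw [hswap]
  simp_rw [← Finset.sum_add_distrib]
  refine Finset.sum_congr rfl fun c _ => Finset.sum_congr rfl fun a _ =>
      Finset.sum_congr rfl fun b _ => ?_
  rcases le_or_gt c N.sqrt with h | h
  · simp [h, not_lt.2 h]
  · simp [h, not_le.2 h]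

open Finset in
lemma sum_comp_le_of_card_fiber_le {α β : Type*} [DecidableEq β] {S : Finset α} {T : Finset β}
    (φ : α → β) (F : β → ℝ) (k : ℝ) (hφ : ∀ x ∈ S, φ x ∈ T) (hF : ∀ y ∈ T, 0 ≤ F y)
    (hk : ∀ y ∈ T, (#{x ∈ S | φ x = y} : ℝ) ≤ k) :
    ∑ x ∈ S, F (φ x) ≤ k * ∑ y ∈ T, F y := by
  rw [← Finset.sum_fiberwise_of_maps_to hφ, Finset.mul_sum]
  refine Finset.sum_le_sum fun y hy => ?_
  rw [Finset.sum_congr rfl (g := fun _ => F y) (fun x hx => by rw [(mem_filter.1 hx).2]),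
    Finset.sum_const, nsmul_eq_mul]
  exact mul_le_mul_of_nonneg_right (hk y hy) (hF y hy)

open Finset in
lemma card_zmod_mul_eq_le {d : ℕ} [NeZero d] (b b' : ℕ) (r r' : ZMod d) :
    #{h : ZMod d | h * b = r ∧ h * b' = r'} ≤ (b.gcd b').gcd d := by
  classical
  have hg0 : 0 < (b.gcd b').gcd d := Nat.gcd_pos_of_pos_right _ (NeZero.pos d)
  set g := (b.gcd b').gcd d with hg
  rcases ({h : ZMod d | h * b = r ∧ h * b' = r'} : Finset (ZMod d)).eq_empty_or_nonempty with h | h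
  · rw [h]; simp
  obtain ⟨h0, hh0⟩ := h
  simp only [mem_filter, mem_univ, true_and] at hh0
  refine le_trans ?_ (IsAddCyclic.card_nsmul_eq_zero_le (α := ZMod d) hg0)
  refine Finset.card_le_card_of_injOn (fun h => h - h0) ?_ ?_
  · intro h hh
    simp only [coe_filter, mem_univ, true_and, Set.mem_ofPred_eq] at hh ⊢
    have h1 : (h - h0) * b = 0 := by rw [sub_mul, hh.1, hh0.1, sub_self]
    have h2 : (h - h0) * b' = 0 := by rw [sub_mul, hh.2, hh0.2, sub_self]
    have e1 := congrArg (Int.cast : ℤ → ZMod d) (Nat.gcd_eq_gcd_ab b b')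
    have e2 := congrArg (Int.cast : ℤ → ZMod d) (Nat.gcd_eq_gcd_ab (b.gcd b') d)
    push_cast at e1 e2
    rw [e1] at e2
    rw [nsmul_eq_mul, hg, e2, ZMod.natCast_self]
    linear_combination ((b.gcd b').gcdA d : ZMod d) * (b.gcdA b' : ZMod d) * h1 +
      ((b.gcd b').gcdA d : ZMod d) * (b.gcdB b' : ZMod d) * h2
  · intro x _ y _ hxy
    simpa using hxy

/-- If `b`, `b'` and the modulus `g * d'` are multiples of `g`, the least absolute residues of
`h b` and `h b'` are multiples of `g` as well, and are proportional to `b, b'` modulo `d'`. -/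
lemma exists_valMinAbs_mul_eq {d g d' β β' : ℕ} (hd : d = g * d') (h : ZMod d) :
    ∃ i i' : ℤ, (h * ((g * β : ℕ) : ZMod d)).valMinAbs = g * i ∧
      (h * ((g * β' : ℕ) : ZMod d)).valMinAbs = g * i' ∧ (d' : ℤ) ∣ i * β' - i' * β := by
  have key : ∀ γ : ℕ, ∃ k : ℤ, (h * ((g * γ : ℕ) : ZMod d)).valMinAbs =
      g * (h.valMinAbs * γ + d' * k) := by
    intro γ
    have h1 : (((h * ((g * γ : ℕ) : ZMod d)).valMinAbs : ℤ) : ZMod d) =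
        ((h.valMinAbs * (g * γ : ℕ) : ℤ) : ZMod d) := by
      rw [ZMod.coe_valMinAbs]
      push_cast
      simp
    rw [ZMod.intCast_eq_intCast_iff_dvd_sub] at h1
    obtain ⟨k, hk⟩ := h1
    refine ⟨-k, ?_⟩
    have : (d : ℤ) = g * d' := by exact_mod_cast hd
    rw [this] at hk
    push_cast at hk ⊢
    linear_combination -hk
  obtain ⟨k, hk⟩ := key β
  obtain ⟨k', hk'⟩ := key β'
  exact ⟨_, _, hk, hk', ⟨k * β' - k' * β, by ring⟩⟩

/-- The nonzero integers of absolute value at most `M`. -/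
noncomputable def nonzeroIcc (M : ℕ) : Finset ℤ := {n ∈ Finset.Icc (-(M : ℤ)) M | n ≠ 0}

lemma mem_nonzeroIcc {M : ℕ} {n : ℤ} : n ∈ nonzeroIcc M ↔ n.natAbs ∈ Finset.Icc 1 M := by
  simp only [nonzeroIcc, Finset.mem_filter, Finset.mem_Icc]
  omega

open Finset in
lemma sum_nonzeroIcc_inv_le (M : ℕ) :
    ∑ n ∈ nonzeroIcc M, (1 / (n.natAbs : ℝ)) ≤ 2 * ∑ n ∈ Icc 1 M, (1 / (n : ℝ)) := by
  refine sum_comp_le_of_card_fiber_le (fun n : ℤ => n.natAbs) (fun n => 1 / (n : ℝ)) 2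
    (fun n hn => mem_nonzeroIcc.1 hn) (fun _ _ => by positivity) fun m hm => ?_
  have : ({x ∈ nonzeroIcc M | x.natAbs = m} : Finset ℤ) ⊆ {(m : ℤ), -(m : ℤ)} := by
    intro x hx
    have := (mem_filter.1 hx).2
    simp only [mem_insert, mem_singleton]
    omega
  exact_mod_cast (card_le_card this).trans card_le_two

open Finset in
lemma sum_nonzeroIcc_offDiag_le (M : ℕ) {q : ℕ} (hq : 0 < q) :
    ∑ p ∈ nonzeroIcc M ×ˢ nonzeroIcc M with p.1 ≠ p.2 ∧ (q : ℤ) ∣ p.1 - p.2,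
      (1 / ((p.1.natAbs : ℝ) * p.2.natAbs)) ≤ 8 * (∑ n ∈ Icc 1 (2 * M), (1 / (n : ℝ))) ^ 2 / q := by
  set H : ℝ := ∑ n ∈ Icc 1 (2 * M), (1 / (n : ℝ)) with hH
  set S := {p ∈ nonzeroIcc M ×ˢ nonzeroIcc M | p.1 ≠ p.2 ∧ (q : ℤ) ∣ p.1 - p.2} with hS
  have hH0 : 0 ≤ H := Finset.sum_nonneg fun _ _ => by positivity
  have hA : ∑ n ∈ nonzeroIcc M, (1 / (n.natAbs : ℝ)) ≤ 2 * H :=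
    (sum_nonzeroIcc_inv_le M).trans (mul_le_mul_of_nonneg_left
      (Finset.sum_le_sum_of_subset_of_nonneg (Icc_subset_Icc le_rfl (by omega))
        fun _ _ _ => by positivity) zero_le_two)
  have hB := sum_nonzeroIcc_inv_le (2 * M)
  have hAB : ∑ p ∈ nonzeroIcc M ×ˢ nonzeroIcc (2 * M),
      (1 / (p.1.natAbs : ℝ)) * (1 / (p.2.natAbs : ℝ)) ≤ 2 * H * (2 * H) := by
    rw [Finset.sum_product]; dsimp only; rw [← Finset.sum_mul_sum]
    exact mul_le_mul hA hB (Finset.sum_nonneg fun _ _ => by positivity) (by positivity)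
  have hmem : ∀ p ∈ S, ∃ t : ℤ, p.1 - p.2 = q * t ∧ t ≠ 0 ∧ p.1.natAbs ∈ Icc 1 M ∧
      p.2.natAbs ∈ Icc 1 M := by
    intro p hp
    obtain ⟨h1, h2, t, ht⟩ := mem_filter.1 hp
    rw [mem_product] at h1
    refine ⟨t, ht, ?_, mem_nonzeroIcc.1 h1.1, mem_nonzeroIcc.1 h1.2⟩
    rintro rfl
    apply h2
    linarith
  have hq' : (0 : ℤ) < q := by exact_mod_cast hq
  have hdiv : ∀ p ∈ S, (p.1 - p.2) / (q : ℤ) ∈ nonzeroIcc (2 * M) := by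
    intro p hp
    obtain ⟨t, ht, ht0, h1, h2⟩ := hmem p hp
    rw [ht, Int.mul_ediv_cancel_left _ hq'.ne', mem_nonzeroIcc]
    rw [mem_Icc] at h1 h2 ⊢
    have e1 : (p.1 - p.2).natAbs ≤ 2 * M := by omega
    rw [ht, Int.natAbs_mul, Int.natAbs_natCast] at e1
    have e2 : t.natAbs ≤ q * t.natAbs := Nat.le_mul_of_pos_left _ hq
    omega
  have hfib : ∀ (π : ℤ × ℤ → ℤ), (π = Prod.fst ∨ π = Prod.snd) →
      ∑ p ∈ S, (1 / ((π p).natAbs : ℝ)) * (1 / (((p.1 - p.2) / (q : ℤ)).natAbs : ℝ)) ≤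
        1 * ∑ p ∈ nonzeroIcc M ×ˢ nonzeroIcc (2 * M),
          (1 / (p.1.natAbs : ℝ)) * (1 / (p.2.natAbs : ℝ)) := by
    intro π hπ
    refine sum_comp_le_of_card_fiber_le (fun p : ℤ × ℤ => (π p, (p.1 - p.2) / (q : ℤ)))
      (fun p => (1 / (p.1.natAbs : ℝ)) * (1 / (p.2.natAbs : ℝ))) 1 ?_ (fun _ _ => by positivity) ?_
    · intro p hp
      rw [mem_product]
      refine ⟨?_, hdiv p hp⟩
      have := mem_product.1 (mem_filter.1 hp).1
      rcases hπ with rfl | rfl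
      exacts [this.1, this.2]
    · intro y _
      rw [← Nat.cast_one, Nat.cast_le, card_le_one]
      intro p hp p' hp'
      obtain ⟨hp, hy⟩ := mem_filter.1 hp
      obtain ⟨hp', hy'⟩ := mem_filter.1 hp'
      have he := hy.trans hy'.symm
      obtain ⟨t, ht, -⟩ := hmem p hp
      obtain ⟨t', ht', -⟩ := hmem p' hp'
      rw [ht, ht', Int.mul_ediv_cancel_left _ hq'.ne', Int.mul_ediv_cancel_left _ hq'.ne',
        Prod.mk.injEq] at he
      rw [← he.2] at ht'
      ext
      · rcases hπ with rfl | rfl <;> linarith [he.1]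
      · rcases hπ with rfl | rfl <;> linarith [he.1]
  have hterm : ∀ p ∈ S, (1 / ((p.1.natAbs : ℝ) * p.2.natAbs)) ≤
      (1 / (q : ℝ)) * ((1 / (p.1.natAbs : ℝ)) * (1 / (((p.1 - p.2) / (q : ℤ)).natAbs : ℝ)) +
        (1 / (p.2.natAbs : ℝ)) * (1 / (((p.1 - p.2) / (q : ℤ)).natAbs : ℝ))) := by
    intro p hp
    obtain ⟨t, ht, ht0, h1, h2⟩ := hmem p hp
    rw [ht, Int.mul_ediv_cancel_left _ hq'.ne']
    have e1 : (p.1 - p.2).natAbs ≤ p.1.natAbs + p.2.natAbs := by omega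
    rw [ht, Int.natAbs_mul, Int.natAbs_natCast] at e1
    have e2 : (q : ℝ) * t.natAbs ≤ p.1.natAbs + p.2.natAbs := by exact_mod_cast e1
    have a1 : (0 : ℝ) < p.1.natAbs := by exact_mod_cast (mem_Icc.1 h1).1
    have a2 : (0 : ℝ) < p.2.natAbs := by exact_mod_cast (mem_Icc.1 h2).1
    have a3 : (0 : ℝ) < t.natAbs := by
      have : 0 < t.natAbs := by omega
      exact_mod_cast this
    have a4 : (0 : ℝ) < q := by exact_mod_cast hq
    have : (1 / (q : ℝ)) * ((1 / (p.1.natAbs : ℝ)) * (1 / (t.natAbs : ℝ)) +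
        (1 / (p.2.natAbs : ℝ)) * (1 / (t.natAbs : ℝ))) =
        (1 / ((p.1.natAbs : ℝ) * p.2.natAbs)) * ((p.1.natAbs + p.2.natAbs) / (q * t.natAbs)) := by
      field_simp
      ring
    rw [this]
    refine le_mul_of_one_le_right (by positivity) ?_
    rwa [one_le_div (by positivity)]
  refine (Finset.sum_le_sum hterm).trans ?_
  rw [← Finset.mul_sum, Finset.sum_add_distrib]
  have f1 := hfib Prod.fst (Or.inl rfl)
  have f2 := hfib Prod.snd (Or.inr rfl)
  rw [show 8 * H ^ 2 / q = 1 / (q : ℝ) * (8 * H ^ 2) by ring]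
  refine mul_le_mul_of_nonneg_left ?_ (by positivity)
  linarith

open Finset in
lemma sum_sq_sum_weights_le {d : ℕ} [NeZero d] {s X : ℕ} (hs : s ^ 2 ≤ X) (W : ℕ → ZMod d → ℝ)
    (hW : ∀ b r, 0 ≤ W b r) (hW1 : ∀ b r, W b r * b ≤ X)
    (hW2 : ∀ b r, W b r * |(r.valMinAbs : ℝ)| ≤ d) {T : ℝ} (hT0 : 0 ≤ T)
    (hT : ∀ n ∈ Icc 1 (X * d), (n.divisors.card : ℝ) ≤ T) :
    ∑ h : ZMod d, (∑ b ∈ Icc 1 s, if h * b = 0 then 0 else W b (h * b)) ^ 2 ≤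
      d.divisors.card * (10 * T ^ 2 * X * d * (∑ n ∈ Icc 1 (2 * (X * d)), (1 / (n : ℝ))) ^ 2) := by
  set H : ℝ := ∑ n ∈ Icc 1 (2 * (X * d)), (1 / (n : ℝ)) with hH
  have hd0 : 0 < d := NeZero.pos d
  rcases Nat.eq_zero_or_pos s with rfl | hs0
  · simp
    positivity
  have hX0 : 0 < X := lt_of_lt_of_le (by positivity) hs
  have hsX : s ≤ X := le_trans (Nat.le_self_pow two_ne_zero s) hs
  have hH1 : 1 ≤ H := by
    have := Finset.single_le_sum (f := fun n : ℕ => 1 / (n : ℝ)) (s := Icc 1 (2 * (X * d)))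
      (fun _ _ => by positivity) (a := 1) (mem_Icc.2 ⟨le_rfl, by nlinarith [Nat.mul_pos hX0 hd0]⟩)
    simpa [hH] using this
  set S : Finset (ZMod d × ℕ × ℕ) :=
    {x ∈ univ ×ˢ (Icc 1 s ×ˢ Icc 1 s) | x.1 * x.2.1 ≠ 0 ∧ x.1 * x.2.2 ≠ 0} with hS
  have hexp : ∑ h : ZMod d, (∑ b ∈ Icc 1 s, if h * b = 0 then 0 else W b (h * b)) ^ 2 =
      ∑ x ∈ S, W x.2.1 (x.1 * x.2.1) * W x.2.2 (x.1 * x.2.2) := by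
    rw [hS, Finset.sum_filter, Finset.sum_product]
    refine Finset.sum_congr rfl fun h _ => ?_
    rw [sq, Finset.sum_mul_sum, Finset.sum_product]
    refine Finset.sum_congr rfl fun b _ => Finset.sum_congr rfl fun b' _ => ?_
    by_cases h1 : h * b = 0 <;> by_cases h2 : h * b' = 0 <;> simp [h1, h2]
  have hmaps : ∀ x ∈ S, (x.2.1.gcd x.2.2).gcd d ∈ d.divisors := fun x _ =>
    Nat.mem_divisors.2 ⟨Nat.gcd_dvd_right _ _, hd0.ne'⟩
  rw [hexp, ← Finset.sum_fiberwise_of_maps_to hmaps, ← nsmul_eq_mul, ← Finset.sum_const]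
  refine Finset.sum_le_sum fun g hg => ?_
  obtain ⟨⟨d', hd'⟩, -⟩ := Nat.mem_divisors.1 hg
  have hg0 : 0 < g := Nat.pos_of_ne_zero fun h => by simp [h] at hd'; omega
  have hd'0 : 0 < d' := Nat.pos_of_ne_zero fun h => by simp [h] at hd'; omega
  set M := X * d with hM
  set P := {p ∈ nonzeroIcc M ×ˢ nonzeroIcc M | (d' : ℤ) ∣ p.1 - p.2} with hP
  set T₁ : Finset ((ℤ × ℤ) × ℕ × ℕ) :=
    {y ∈ P ×ˢ (Icc 1 s ×ˢ Icc 1 s) | y.2.2 ∣ y.1.1.natAbs ∧ y.2.1 ∣ y.1.2.natAbs} with hT₁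
  let G : ℤ × ℤ → ℝ := fun p => if p.1 = p.2 then (X * d / g : ℝ) * (1 / (p.1.natAbs : ℝ)) else
    (X * d ^ 2 / g ^ 2 : ℝ) * (1 / ((p.1.natAbs : ℝ) * p.2.natAbs))
  have hG0 : ∀ p, 0 ≤ G p := by
    intro p
    simp only [G]
    split_ifs <;> positivity
  let φ : ZMod d × ℕ × ℕ → (ℤ × ℤ) × ℕ × ℕ := fun x =>
    (((x.1 * x.2.1).valMinAbs / g * (x.2.2 / g : ℕ), (x.1 * x.2.2).valMinAbs / g * (x.2.1 / g : ℕ)),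
      (x.2.1 / g, x.2.2 / g))
  have hg0' : (0 : ℤ) < g := by exact_mod_cast hg0
  have hpt : ∀ x ∈ S.filter (fun x => (x.2.1.gcd x.2.2).gcd d = g), ∃ (h : ZMod d) (β β' : ℕ)
      (i i' : ℤ), x = (h, g * β, g * β') ∧ φ x = ((i * β', i' * β), (β, β')) ∧
      (h * ((g * β : ℕ) : ZMod d)).valMinAbs = g * i ∧
      (h * ((g * β' : ℕ) : ZMod d)).valMinAbs = g * i' ∧ i ≠ 0 ∧ i' ≠ 0 ∧ 1 ≤ β ∧ 1 ≤ β' ∧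
      g * β ≤ s ∧ g * β' ≤ s ∧ (d' : ℤ) ∣ i * β' - i' * β := by
    rintro ⟨h, b, b'⟩ hx
    obtain ⟨hx, hxg⟩ := mem_filter.1 hx
    obtain ⟨hx, hne⟩ := mem_filter.1 hx
    simp only [mem_product, mem_univ, true_and, mem_Icc] at hx hne hxg
    obtain ⟨β, rfl⟩ : g ∣ b := hxg ▸ (Nat.gcd_dvd_left _ _).trans (Nat.gcd_dvd_left _ _)
    obtain ⟨β', rfl⟩ : g ∣ b' := hxg ▸ (Nat.gcd_dvd_left _ _).trans (Nat.gcd_dvd_right _ _)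
    obtain ⟨i, i', hi, hi', hdv⟩ := exists_valMinAbs_mul_eq (β := β) (β' := β') hd' h
    refine ⟨h, β, β', i, i', rfl, ?_, hi, hi', ?_, ?_, ?_, ?_, hx.1.2, hx.2.2, hdv⟩
    · simp only [φ, hi, hi', Int.mul_ediv_cancel_left _ hg0'.ne', Nat.mul_div_cancel_left _ hg0]
    · rintro rfl
      rw [mul_zero, ZMod.valMinAbs_eq_zero] at hi
      exact hne.1 hi
    · rintro rfl
      rw [mul_zero, ZMod.valMinAbs_eq_zero] at hi'
      exact hne.2 hi'
    · exact Nat.pos_of_mul_pos_left (a := g) (by omega)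
    · exact Nat.pos_of_mul_pos_left (a := g) (by omega)
  have hTsum : ∑ y ∈ T₁, G y.1 ≤ T ^ 2 * ∑ p ∈ P, G p := by
    refine sum_comp_le_of_card_fiber_le (fun y : (ℤ × ℤ) × ℕ × ℕ => y.1) G (T ^ 2)
      (fun y hy => (mem_product.1 (mem_filter.1 hy).1).1) (fun p _ => hG0 p) fun p hp => ?_
    have hp1 := mem_nonzeroIcc.1 (mem_product.1 (mem_filter.1 hp).1).1
    have hp2 := mem_nonzeroIcc.1 (mem_product.1 (mem_filter.1 hp).1).2
    have : #{y ∈ T₁ | y.1 = p} ≤ #(p.2.natAbs.divisors ×ˢ p.1.natAbs.divisors) := by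
      refine Finset.card_le_card_of_injOn (fun y => y.2) ?_ ?_
      · intro y hy
        obtain ⟨hyT, rfl⟩ := mem_filter.1 (mem_coe.1 hy)
        have h12 := (mem_filter.1 hyT).2
        have a1 := (mem_Icc.1 hp1).1
        have a2 := (mem_Icc.1 hp2).1
        exact mem_coe.2 (mem_product.2 ⟨Nat.mem_divisors.2 ⟨h12.2, by omega⟩,
          Nat.mem_divisors.2 ⟨h12.1, by omega⟩⟩)
      · intro y hy y' hy' he
        obtain ⟨-, h1⟩ := mem_filter.1 (mem_coe.1 hy)
        obtain ⟨-, h2⟩ := mem_filter.1 (mem_coe.1 hy')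
        exact Prod.ext (h1.trans h2.symm) he
    calc (#{y ∈ T₁ | y.1 = p} : ℝ) ≤ (#(p.2.natAbs.divisors ×ˢ p.1.natAbs.divisors) : ℝ) := by
          exact_mod_cast this
      _ = (p.2.natAbs.divisors.card : ℝ) * p.1.natAbs.divisors.card := by
          rw [card_product]; push_cast; ring
      _ ≤ T * T := by
          gcongr
          exacts [hT _ hp2, hT _ hp1]
      _ = T ^ 2 := by ring
  have hPsum : ∑ p ∈ P, G p ≤ X * d / g * (2 * H) + X * d ^ 2 / g ^ 2 * (8 * H ^ 2 / d') := by
    rw [← Finset.sum_filter_add_sum_filter_not P (fun p => p.1 = p.2)]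
    refine add_le_add ?_ ?_
    · have e1 : ∑ p ∈ P with p.1 = p.2, G p =
          X * d / g * ∑ p ∈ P with p.1 = p.2, (1 / (p.1.natAbs : ℝ)) := by
        rw [Finset.mul_sum]
        refine Finset.sum_congr rfl fun p hp => ?_
        simp only [G, if_pos (mem_filter.1 hp).2]
      rw [e1]
      refine mul_le_mul_of_nonneg_left ?_ (by positivity)
      have e2 : ∑ p ∈ P with p.1 = p.2, (1 / (p.1.natAbs : ℝ)) ≤
          1 * ∑ n ∈ nonzeroIcc M, (1 / (n.natAbs : ℝ)) := by
        refine sum_comp_le_of_card_fiber_le (fun p : ℤ × ℤ => p.1) (fun n => 1 / (n.natAbs : ℝ)) 1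
          (fun p hp => (mem_product.1 (mem_filter.1 (mem_filter.1 hp).1).1).1)
          (fun _ _ => by positivity) fun n _ => ?_
        rw [← Nat.cast_one, Nat.cast_le, card_le_one]
        intro p hp p' hp'
        obtain ⟨hp, h1⟩ := mem_filter.1 hp
        obtain ⟨hp', h2⟩ := mem_filter.1 hp'
        have h3 := (mem_filter.1 hp).2
        have h4 := (mem_filter.1 hp').2
        exact Prod.ext (h1.trans h2.symm) (by rw [← h3, ← h4, h1, h2])
      rw [one_mul] at e2
      refine e2.trans ((sum_nonzeroIcc_inv_le M).trans (mul_le_mul_of_nonneg_left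
        (Finset.sum_le_sum_of_subset_of_nonneg (Icc_subset_Icc le_rfl (by omega))
          fun _ _ _ => by positivity) zero_le_two))
    · have e1 : ∑ p ∈ P with ¬ p.1 = p.2, G p = X * d ^ 2 / g ^ 2 *
          ∑ p ∈ P with ¬ p.1 = p.2, (1 / ((p.1.natAbs : ℝ) * p.2.natAbs)) := by
        rw [Finset.mul_sum]
        refine Finset.sum_congr rfl fun p hp => ?_
        simp only [G, if_neg (mem_filter.1 hp).2]
      rw [e1]
      refine mul_le_mul_of_nonneg_left ?_ (by positivity)
      have := sum_nonzeroIcc_offDiag_le M hd'0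
      rw [hP, Finset.filter_filter]
      simpa only [and_comm] using this
  have hgle : ∀ y ∈ T₁, (#{x ∈ S.filter (fun x => (x.2.1.gcd x.2.2).gcd d = g) | φ x = y} : ℝ) ≤
      g := by
    rintro ⟨⟨n, n'⟩, β, β'⟩ hy
    rcases ({x ∈ S.filter (fun x => (x.2.1.gcd x.2.2).gcd d = g) | φ x = ((n, n'), (β, β'))} :
      Finset _).eq_empty_or_nonempty with he | ⟨x0, hx0⟩
    · rw [he]; simp
    obtain ⟨hx0, hy0⟩ := mem_filter.1 hx0
    obtain ⟨h0, β0, β0', i0, i0', rfl, hφ0, hi0, hi0', -, -, hβ, hβ', -⟩ := hpt x0 hx0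
    have hgcd := (mem_filter.1 hx0).2
    simp only at hgcd
    rw [← hgcd, Nat.cast_le]
    refine le_trans ?_ (card_zmod_mul_eq_le (d := d) (g * β0) (g * β0')
      (h0 * ((g * β0 : ℕ) : ZMod d)) (h0 * ((g * β0' : ℕ) : ZMod d)))
    rw [hφ0] at hy0
    have hy1 : ∀ x ∈ {x ∈ S.filter (fun x => (x.2.1.gcd x.2.2).gcd d = g) |
        φ x = ((n, n'), (β, β'))}, x.2 = (g * β0, g * β0') ∧
        x.1 * ((g * β0 : ℕ) : ZMod d) = h0 * ((g * β0 : ℕ) : ZMod d) ∧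
        x.1 * ((g * β0' : ℕ) : ZMod d) = h0 * ((g * β0' : ℕ) : ZMod d) := by
      intro x hx
      obtain ⟨hx, hyx⟩ := mem_filter.1 hx
      obtain ⟨h1, β1, β1', i1, i1', rfl, hφ1, hi1, hi1', -, -, -⟩ := hpt x hx
      rw [hφ1, ← hy0] at hyx
      simp only [Prod.mk.injEq] at hyx
      obtain ⟨⟨k1, k2⟩, rfl, rfl⟩ := hyx
      have z1 : (β1 : ℤ) ≠ 0 := by omega
      have z2 : (β1' : ℤ) ≠ 0 := by omega
      refine ⟨rfl, ?_, ?_⟩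
      · rw [← ZMod.valMinAbs_inj, hi1, hi0, mul_right_cancel₀ z2 k1]
      · rw [← ZMod.valMinAbs_inj, hi1', hi0', mul_right_cancel₀ z1 k2]
    rw [hgcd]
    refine Finset.card_le_card_of_injOn (fun x => x.1) ?_ ?_
    · intro x hx
      simp only [coe_filter, mem_univ, true_and, Set.mem_ofPred_eq]
      exact (hy1 x (mem_coe.1 hx)).2
    · intro x hx x' hx' he
      exact Prod.ext he ((hy1 x (mem_coe.1 hx)).1.trans (hy1 x' (mem_coe.1 hx')).1.symm)
  have hgR : (0 : ℝ) < g := by exact_mod_cast hg0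
  calc ∑ x ∈ S with (x.2.1.gcd x.2.2).gcd d = g, W x.2.1 (x.1 * x.2.1) * W x.2.2 (x.1 * x.2.2)
      ≤ ∑ x ∈ S with (x.2.1.gcd x.2.2).gcd d = g, G (φ x).1 := by
        refine Finset.sum_le_sum fun x hx => ?_
        obtain ⟨h, β, β', i, i', rfl, hφx, hi, hi', hi0, hi0', hβ, hβ', hβs, hβs', hdv⟩ := hpt x hx
        rw [hφx]
        have u0 := hW (g * β) (h * ((g * β : ℕ) : ZMod d))
        have u1 := hW1 (g * β) (h * ((g * β : ℕ) : ZMod d))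
        have u2 := hW2 (g * β) (h * ((g * β : ℕ) : ZMod d))
        have v0 := hW (g * β') (h * ((g * β' : ℕ) : ZMod d))
        have v2 := hW2 (g * β') (h * ((g * β' : ℕ) : ZMod d))
        set w := W (g * β) (h * ((g * β : ℕ) : ZMod d))
        set w' := W (g * β') (h * ((g * β' : ℕ) : ZMod d))
        rw [hi] at u2
        rw [hi'] at v2
        push_cast [abs_mul] at u1 u2 v2
        rw [abs_of_pos hgR] at u2 v2
        have b1 : (1 : ℝ) ≤ β := by exact_mod_cast hβ
        have b2 : (1 : ℝ) ≤ β' := by exact_mod_cast hβ'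
        have c1 : (0 : ℝ) < |(i : ℝ)| := abs_pos.2 (by exact_mod_cast hi0)
        have c2 : (0 : ℝ) < |(i' : ℝ)| := abs_pos.2 (by exact_mod_cast hi0')
        have g1 : (1 : ℝ) ≤ g := by exact_mod_cast hg0
        simp only [G]
        have na : ∀ (k : ℤ) (γ : ℕ), ((k * γ : ℤ).natAbs : ℝ) = |(k : ℝ)| * γ := by
          intro k γ
          rw [Nat.cast_natAbs]
          push_cast [abs_mul]
          simp
        split_ifs with heq
        · rw [heq, na, div_mul_div_comm, mul_one, le_div_iff₀ (by positivity)]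
          have : w * (g * β) * (w' * (g * |(i' : ℝ)|)) ≤ X * d :=
            mul_le_mul u1 v2 (by positivity) (by positivity)
          calc w * w' * (g * (|(i' : ℝ)| * β)) ≤ w * w' * (g * (|(i' : ℝ)| * β)) * g :=
                le_mul_of_one_le_right (by positivity) g1
            _ = w * (g * β) * (w' * (g * |(i' : ℝ)|)) := by ring
            _ ≤ _ := this
        · rw [na, na, div_mul_div_comm, mul_one, le_div_iff₀ (by positivity)]
          have e1 : w * (g * |(i : ℝ)|) * (w' * (g * |(i' : ℝ)|)) ≤ d * d :=
            mul_le_mul u2 v2 (by positivity) (by positivity)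
          have e2 : (β' * β : ℝ) ≤ X := by
            have : β' * β ≤ X := by
              have q1 : β' ≤ s := (Nat.le_mul_of_pos_left _ hg0).trans hβs'
              have q2 : β ≤ s := (Nat.le_mul_of_pos_left _ hg0).trans hβs
              calc β' * β ≤ s * s := Nat.mul_le_mul q1 q2
                _ = s ^ 2 := by ring
                _ ≤ X := hs
            exact_mod_cast this
          calc w * w' * (g ^ 2 * (|(i : ℝ)| * β' * (|(i' : ℝ)| * β))) =
                w * (g * |(i : ℝ)|) * (w' * (g * |(i' : ℝ)|)) * (β' * β) := by ring
            _ ≤ d * d * X := mul_le_mul e1 e2 (by positivity) (by positivity)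
            _ = X * d ^ 2 := by ring
    _ ≤ g * ∑ y ∈ T₁, G y.1 := by
        refine sum_comp_le_of_card_fiber_le φ (fun y => G y.1) g ?_ (fun y _ => hG0 _) hgle
        intro x hx
        obtain ⟨h, β, β', i, i', rfl, hφx, hi, hi', hi0, hi0', hβ, hβ', hβs, hβs', hdv⟩ := hpt x hx
        have q1 : β' ≤ s := (Nat.le_mul_of_pos_left _ hg0).trans hβs'
        have q2 : β ≤ s := (Nat.le_mul_of_pos_left _ hg0).trans hβs
        have hile : ∀ (r : ZMod d) (k : ℤ), r.valMinAbs = g * k → k.natAbs ≤ d := by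
          intro r k hk
          have := ZMod.natAbs_valMinAbs_le r
          rw [hk, Int.natAbs_mul, Int.natAbs_natCast] at this
          have := Nat.le_mul_of_pos_left k.natAbs hg0
          omega
        have m1 : ∀ (k : ℤ) (γ : ℕ), k.natAbs ≤ d → k ≠ 0 → 1 ≤ γ → γ ≤ s →
            k * γ ∈ nonzeroIcc M := by
          intro k γ h1 h2 h3 h4
          rw [mem_nonzeroIcc, Int.natAbs_mul, Int.natAbs_natCast, mem_Icc]
          refine ⟨Nat.mul_pos (Int.natAbs_pos.2 h2) h3, ?_⟩
          rw [hM, mul_comm X d]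
          exact Nat.mul_le_mul h1 (h4.trans hsX)
        rw [hφx]
        simp only [hT₁, hP, mem_filter, mem_product, mem_Icc, Int.natAbs_mul, Int.natAbs_natCast]
        exact ⟨⟨⟨⟨m1 _ _ (hile _ _ hi) hi0 hβ' q1, m1 _ _ (hile _ _ hi') hi0' hβ q2⟩, hdv⟩,
          ⟨hβ, q2⟩, hβ', q1⟩, dvd_mul_left _ _, dvd_mul_left _ _⟩
    _ ≤ g * (T ^ 2 * (X * d / g * (2 * H) + X * d ^ 2 / g ^ 2 * (8 * H ^ 2 / d'))) := by
        gcongr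
        exact hTsum.trans (mul_le_mul_of_nonneg_left hPsum (by positivity))
    _ = T ^ 2 * X * d * (2 * H + 8 * H ^ 2) := by
        have : (d : ℝ) = g * d' := by exact_mod_cast hd'
        have hd'R : (0 : ℝ) < d' := by exact_mod_cast hd'0
        rw [this]
        field_simp
    _ ≤ T ^ 2 * X * d * (10 * H ^ 2) := by
        gcongr
        nlinarith
    _ = 10 * T ^ 2 * X * d * H ^ 2 := by ring

lemma sum_Icc_inv_le_one_add_log (n : ℕ) :
    ∑ k ∈ Finset.Icc 1 n, (1 / (k : ℝ)) ≤ 1 + Real.log n := by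
  have := harmonic_le_one_add_log n
  rw [harmonic_eq_sum_Icc] at this
  push_cast at this
  simpa using this

lemma exists_sum_Icc_inv_le {ε : ℝ} (hε : 0 < ε) : ∃ C : ℝ, 0 < C ∧ ∀ n : ℕ, 1 ≤ n →
    ∑ k ∈ Finset.Icc 1 n, (1 / (k : ℝ)) ≤ C * (n : ℝ) ^ ε := by
  refine ⟨1 + 1 / ε, by positivity, fun n hn => (sum_Icc_inv_le_one_add_log n).trans ?_⟩
  have h1 : (1 : ℝ) ≤ (n : ℝ) ^ ε := Real.one_le_rpow (by exact_mod_cast hn) hε.le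
  have h2 := Real.log_le_rpow_div (Nat.cast_nonneg n : (0 : ℝ) ≤ n) hε
  calc 1 + Real.log n ≤ (n : ℝ) ^ ε + (n : ℝ) ^ ε / ε := add_le_add h1 h2
    _ = (1 + 1 / ε) * (n : ℝ) ^ ε := by ring

open Finset in
lemma sum_norm_sq_fourier {d : ℕ} [NeZero d] (f : ZMod d → ℝ) :
    ∑ h : ZMod d, ‖∑ r, (f r : ℂ) * ZMod.stdAddChar (h * r)‖ ^ 2 = d * ∑ r, f r ^ 2 := by
  have key : ∑ h : ZMod d, ((‖∑ r, (f r : ℂ) * ZMod.stdAddChar (h * r)‖ : ℂ)) ^ 2 =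
      d * ∑ r, (f r : ℂ) ^ 2 := by
    have e1 : ∀ h : ZMod d, ((‖∑ r, (f r : ℂ) * ZMod.stdAddChar (h * r)‖ : ℂ)) ^ 2 =
        ∑ r, ∑ r', (f r : ℂ) * f r' * ZMod.stdAddChar (h * (r' - r)) := by
      intro h
      rw [← Complex.conj_mul', map_sum, Finset.sum_mul_sum]
      refine Finset.sum_congr rfl fun r _ => Finset.sum_congr rfl fun r' _ => ?_
      rw [map_mul, Complex.conj_ofReal, ← AddChar.map_neg_eq_conj, mul_sub, sub_eq_add_neg,
        AddChar.map_add_eq_mul]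
      ring
    simp_rw [e1]
    rw [Finset.sum_comm, Finset.mul_sum]
    refine Finset.sum_congr rfl fun r _ => ?_
    rw [Finset.sum_comm]
    simp_rw [← Finset.mul_sum, AddChar.sum_mulShift _ (ZMod.isPrimitive_stdAddChar d), sub_eq_zero,
      ZMod.card]
    simp
    ring
  exact_mod_cast key

open Finset in
lemma norm_sum_Ioc_stdAddChar_mul_le {d : ℕ} [NeZero d] {r : ZMod d} (hr : r ≠ 0) (lo hi : ℕ) :
    ‖∑ a ∈ Ioc lo hi, (ZMod.stdAddChar (r * (a : ZMod d)) : ℂ)‖ * |(r.valMinAbs : ℝ)| ≤ d := by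
  have hd : (0 : ℝ) < d := by exact_mod_cast NeZero.pos d
  rcases lt_or_ge hi lo with h | h
  · rw [Ioc_eq_empty (by omega)]
    simp
  set z : ℂ := ZMod.stdAddChar r with hz
  have hz1 : z ≠ 1 := by
    rw [hz, ← AddChar.map_zero_eq_one (ZMod.stdAddChar (N := d))]
    exact fun h => hr (ZMod.injective_stdAddChar h)
  have hnorm : ‖z‖ = 1 := AddChar.norm_apply _ _
  have hsum : ∑ a ∈ Ioc lo hi, (ZMod.stdAddChar (r * (a : ZMod d)) : ℂ) =
      (z ^ (hi + 1) - z ^ (lo + 1)) / (z - 1) := by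
    rw [← geom_sum_Ico hz1 (by omega), Ico_add_one_add_one_eq_Ioc]
    refine Finset.sum_congr rfl fun a _ => ?_
    rw [hz, ← AddChar.map_nsmul_eq_pow, nsmul_eq_mul, mul_comm]
  set j := r.valMinAbs with hj
  have hjd : |(j : ℝ)| * 2 ≤ d := by
    have h1 := ZMod.valMinAbs_mem_Ioc r
    have h2 : |j * 2| ≤ d := abs_le.2 ⟨h1.1.le, h1.2⟩
    rw [abs_mul] at h2
    exact_mod_cast h2
  have hz2 : ‖z - 1‖ = 2 * |Real.sin (Real.pi * j / d)| := by
    rw [hz, ← ZMod.coe_valMinAbs r, ZMod.stdAddChar_coe, ← hj]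
    have := Complex.norm_exp_I_mul_ofReal_sub_one (2 * Real.pi * j / d)
    rw [norm_mul, Real.norm_eq_abs, Real.norm_eq_abs, abs_two] at this
    rw [show 2 * Real.pi * j / d / 2 = Real.pi * j / d by ring] at this
    rw [← this]
    congr 3
    push_cast
    ring
  have hz3 : 4 * |(j : ℝ)| / d ≤ ‖z - 1‖ := by
    have h1 : |Real.pi * j / d| ≤ Real.pi / 2 := by
      rw [abs_div, abs_mul, abs_of_pos Real.pi_pos, abs_of_pos hd, div_le_div_iff₀ hd two_pos]
      nlinarith [Real.pi_pos]
    have h2 := Real.mul_abs_le_abs_sin h1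
    rw [abs_div, abs_mul, abs_of_pos Real.pi_pos, abs_of_pos hd] at h2
    rw [hz2]
    have : 2 / Real.pi * (Real.pi * |(j : ℝ)| / d) = 2 * |(j : ℝ)| / d := by
      field_simp
    rw [this] at h2
    calc 4 * |(j : ℝ)| / d = 2 * (2 * |(j : ℝ)| / d) := by ring
      _ ≤ _ := by linarith
  have hz4 : 0 < ‖z - 1‖ := norm_pos_iff.2 (sub_ne_zero.2 hz1)
  have hz5 : ‖z ^ (hi + 1) - z ^ (lo + 1)‖ ≤ 2 := by
    refine (norm_sub_le _ _).trans ?_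
    rw [norm_pow, norm_pow, hnorm]
    norm_num
  rw [hsum, norm_div, div_mul_eq_mul_div, div_le_iff₀ hz4]
  have : |(j : ℝ)| * 4 ≤ d * ‖z - 1‖ := by
    rw [div_le_iff₀ hd] at hz3
    linarith
  nlinarith [abs_nonneg (j : ℝ)]

open Finset in
/-- The number of pairs `(a, b)` with `b ≤ s`, `a ∈ (lo b, hi b]` and `a b ≡ r (mod d)`, minus
its expected value. -/
noncomputable def progressionError (d : ℕ) [NeZero d] (s : ℕ) (lo hi : ℕ → ℕ) (r : ZMod d) : ℝ :=
  ∑ b ∈ Icc 1 s, ((#{a ∈ Ioc (lo b) (hi b) | ((a : ℕ) : ZMod d) * b = r} : ℝ) -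
    (#(Ioc (lo b) (hi b)) : ℝ) / d * #{t : ZMod d | t * b = r})

open Finset in
lemma sum_progressionError_mul (d : ℕ) [NeZero d] (s : ℕ) (lo hi : ℕ → ℕ) (h : ZMod d) :
    ∑ r, (progressionError d s lo hi r : ℂ) * ZMod.stdAddChar (h * r) =
      ∑ b ∈ Icc 1 s, if h * b = 0 then 0 else
        ∑ a ∈ Ioc (lo b) (hi b), (ZMod.stdAddChar (h * (b : ZMod d) * (a : ZMod d)) : ℂ) := by
  have hd : (d : ℂ) ≠ 0 := by exact_mod_cast (NeZero.ne d)
  simp only [progressionError]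
  push_cast
  simp_rw [Finset.sum_mul]
  rw [Finset.sum_comm]
  refine Finset.sum_congr rfl fun b _ => ?_
  simp_rw [sub_mul]
  rw [Finset.sum_sub_distrib]
  have e1 : ∑ r : ZMod d, (#{a ∈ Ioc (lo b) (hi b) | ((a : ℕ) : ZMod d) * b = r} : ℂ) *
      ZMod.stdAddChar (h * r) = ∑ a ∈ Ioc (lo b) (hi b), (ZMod.stdAddChar (h * (b : ZMod d) * (a : ZMod d)) : ℂ) := by
    simp_rw [Finset.card_filter]
    push_cast
    simp_rw [Finset.sum_mul]
    rw [Finset.sum_comm]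
    refine Finset.sum_congr rfl fun a _ => ?_
    simp only [ite_mul, one_mul, zero_mul, Finset.sum_ite_eq, mem_univ, if_true]
    congr 1
    ring
  have e2 : ∑ r : ZMod d, ((#(Ioc (lo b) (hi b)) : ℂ) / d * #{t : ZMod d | t * b = r}) *
      ZMod.stdAddChar (h * r) = if h * b = 0 then (#(Ioc (lo b) (hi b)) : ℂ) else 0 := by
    have : ∑ r : ZMod d, (#{t : ZMod d | t * b = r} : ℂ) * ZMod.stdAddChar (h * r) =
        if h * b = 0 then (d : ℂ) else 0 := by
      simp_rw [Finset.card_filter]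
      push_cast
      simp_rw [Finset.sum_mul]
      rw [Finset.sum_comm]
      have := AddChar.sum_mulShift (h * b) (ZMod.isPrimitive_stdAddChar d)
      rw [ZMod.card] at this
      push_cast at this
      rw [← this]
      refine Finset.sum_congr rfl fun t _ => ?_
      simp only [ite_mul, one_mul, zero_mul, Finset.sum_ite_eq, mem_univ, if_true]
      congr 1
      ring
    simp_rw [mul_assoc]
    rw [← Finset.mul_sum, this]
    split_ifs <;> field_simp
    simp
  rw [e1, e2]
  split_ifs with h0
  · simp [h0]
  · simp

open Finset in
lemma exists_sum_sq_progressionError_le {ε : ℝ} (hε : 0 < ε) : ∃ C : ℝ, 0 < C ∧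
    ∀ (d : ℕ) [NeZero d] (s X : ℕ) (lo hi : ℕ → ℕ), 1 ≤ X → s ^ 2 ≤ X →
      (∀ b ∈ Icc 1 s, hi b * b ≤ X) →
      ∑ r, progressionError d s lo hi r ^ 2 ≤ C * X * ((X : ℝ) * d) ^ ε := by
  obtain ⟨C₁, hC₁, h₁⟩ := exists_card_divisors_le (ε := ε / 5) (by positivity)
  obtain ⟨C₂, hC₂, h₂⟩ := exists_sum_Icc_inv_le (ε := ε / 5) (by positivity)
  refine ⟨C₁ * (10 * C₁ ^ 2 * (C₂ * 2 ^ (ε / 5)) ^ 2), by positivity, ?_⟩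
  intro d _ s X lo hi hX hs hhi
  have hd0 : 0 < d := NeZero.pos d
  have hdR : (0 : ℝ) < d := by exact_mod_cast hd0
  have hXR : (1 : ℝ) ≤ X := by exact_mod_cast hX
  set Z : ℝ := ((X : ℝ) * d) ^ (ε / 5) with hZ
  let W : ℕ → ZMod d → ℝ := fun b r => if b ∈ Icc 1 s ∧ r ≠ 0 then
    ‖∑ a ∈ Ioc (lo b) (hi b), (ZMod.stdAddChar (r * (a : ZMod d)) : ℂ)‖ else 0
  have key := sum_sq_sum_weights_le (d := d) hs W ?_ ?_ ?_ (T := C₁ * Z) (by positivity) ?_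
  · have e1 := sum_norm_sq_fourier (progressionError d s lo hi)
    have e2 : ∑ h : ZMod d, ‖∑ r, (progressionError d s lo hi r : ℂ) *
        ZMod.stdAddChar (h * r)‖ ^ 2 ≤
        ∑ h : ZMod d, (∑ b ∈ Icc 1 s, if h * b = 0 then 0 else W b (h * b)) ^ 2 := by
      refine Finset.sum_le_sum fun h _ => ?_
      rw [sum_progressionError_mul]
      gcongr
      refine norm_sum_le_of_le _ fun b hb => ?_
      split_ifs with h0
      · simp
      · simp only [W, if_pos (And.intro hb h0)]
        exact le_rfl
    rw [e1] at e2
    have e3 := e2.trans key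
    have hH : ∑ n ∈ Icc 1 (2 * (X * d)), (1 / (n : ℝ)) ≤ C₂ * 2 ^ (ε / 5) * Z := by
      refine (h₂ (2 * (X * d)) (by nlinarith)).trans (le_of_eq ?_)
      push_cast
      rw [Real.mul_rpow (by positivity) (by positivity), hZ]
      ring
    have hH0 : 0 ≤ ∑ n ∈ Icc 1 (2 * (X * d)), (1 / (n : ℝ)) :=
      Finset.sum_nonneg fun _ _ => by positivity
    have hτ : (d.divisors.card : ℝ) ≤ C₁ * Z := by
      refine (h₁ d).trans ?_
      rw [hZ]
      gcongr
      nlinarith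
    have e4 : (d : ℝ) * ∑ r, progressionError d s lo hi r ^ 2 ≤
        d * (C₁ * (10 * C₁ ^ 2 * (C₂ * 2 ^ (ε / 5)) ^ 2) * X * Z ^ 5) := by
      calc _ ≤ _ := e3
        _ ≤ (C₁ * Z) * (10 * (C₁ * Z) ^ 2 * X * d * (C₂ * 2 ^ (ε / 5) * Z) ^ 2) := by
            gcongr
        _ = _ := by ring
    have e5 : Z ^ 5 = ((X : ℝ) * d) ^ ε := by
      rw [hZ, ← Real.rpow_natCast, ← Real.rpow_mul (by positivity)]
      congr 1
      push_cast
      ring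
    rw [e5] at e4
    exact le_of_mul_le_mul_left e4 hdR
  · intro b r
    simp only [W]
    split_ifs <;> positivity
  · intro b r
    simp only [W]
    split_ifs with h
    · have h3 : ‖∑ a ∈ Ioc (lo b) (hi b), (ZMod.stdAddChar (r * (a : ZMod d)) : ℂ)‖ ≤ hi b := by
        refine (norm_sum_le_of_le _ (fun a _ => (AddChar.norm_apply _ _).le)).trans ?_
        simp
      have h4 : (hi b : ℝ) * b ≤ X := by exact_mod_cast hhi b h.1
      exact (mul_le_mul_of_nonneg_right h3 (by positivity)).trans h4
    · simp
  · intro b r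
    simp only [W]
    split_ifs with h
    · exact norm_sum_Ioc_stdAddChar_mul_le h.2 _ _
    · simp
  · intro n hn
    refine (h₁ n).trans ?_
    rw [hZ]
    gcongr
    exact_mod_cast (mem_Icc.1 hn).2

open Finset in
lemma card_Ioc_filter_zmod_le (d : ℕ) [NeZero d] (A B : ℕ) (hAB : A ≤ B) (κ : ZMod d) :
    (#{m ∈ Ioc A B | ((m : ℕ) : ZMod d) = κ} : ℝ) ≤ ((B : ℝ) - A) / d + 1 := by
  have hd : (0 : ℝ) < d := by exact_mod_cast NeZero.pos d
  have h1 := Nat.Ioc_filter_modEq_card A B (NeZero.pos d) κ.val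
  have h2 : {m ∈ Ioc A B | ((m : ℕ) : ZMod d) = κ} = {m ∈ Ioc A B | m ≡ κ.val [MOD d]} := by
    refine Finset.filter_congr fun m _ => ?_
    rw [← ZMod.natCast_eq_natCast_iff, ZMod.natCast_zmod_val]
  rw [h2]
  have h3 : ((#{m ∈ Ioc A B | m ≡ κ.val [MOD d]} : ℤ) : ℝ) ≤ ((B : ℝ) - A) / d + 1 := by
    rw [h1]
    push_cast
    refine max_le ?_ ?_
    · have a1 := Int.floor_le (((B : ℚ) - κ.val) / d)
      have a2 := Int.lt_floor_add_one (((A : ℚ) - κ.val) / d)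
      have a1' : ((⌊((B : ℚ) - κ.val) / d⌋ : ℤ) : ℝ) ≤ ((B : ℝ) - κ.val) / d := by
        exact_mod_cast (Rat.cast_le (K := ℝ)).2 a1
      have a2' : ((A : ℝ) - κ.val) / d < (⌊((A : ℚ) - κ.val) / d⌋ : ℤ) + 1 := by
        exact_mod_cast (Rat.cast_lt (K := ℝ)).2 a2
      have : ((B : ℝ) - A) / d = ((B : ℝ) - κ.val) / d - ((A : ℝ) - κ.val) / d := by ring
      linarith
    · have : (A : ℝ) ≤ B := by exact_mod_cast hAB
      have : 0 ≤ ((B : ℝ) - A) / d := div_nonneg (by linarith) hd.le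
      linarith
  exact_mod_cast h3

open Finset in
/-- The expected value subtracted in `progressionError`. -/
noncomputable def progressionMain (d : ℕ) [NeZero d] (s : ℕ) (lo hi : ℕ → ℕ) (r : ZMod d) : ℝ :=
  ∑ b ∈ Icc 1 s, (#(Ioc (lo b) (hi b)) : ℝ) / d * #{t : ZMod d | t * b = r}

open Finset in
lemma card_filter_mul_unit {d : ℕ} [NeZero d] (b : ZMod d) (u : (ZMod d)ˣ) (r : ZMod d) :
    #{t : ZMod d | t * b = u * r} = #{t : ZMod d | t * b = r} := by
  symm
  refine Finset.card_bij (fun t _ => u * t) ?_ ?_ ?_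
  · intro t ht
    simp only [mem_filter, mem_univ, true_and] at ht ⊢
    rw [mul_assoc, ht]
  · intro t _ t' _ h
    exact u.isUnit.mul_left_cancel h
  · intro t ht
    simp only [mem_filter, mem_univ, true_and] at ht
    refine ⟨↑u⁻¹ * t, ?_, by rw [Units.mul_inv_cancel_left]⟩
    simp only [mem_filter, mem_univ, true_and]
    rw [mul_assoc, ht, Units.inv_mul_cancel_left]

lemma progressionMain_unit_mul (d : ℕ) [NeZero d] (s : ℕ) (lo hi : ℕ → ℕ) (u : (ZMod d)ˣ)
    (r : ZMod d) : progressionMain d s lo hi (u * r) = progressionMain d s lo hi r := by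
  simp only [progressionMain, card_filter_mul_unit]

open Finset in
lemma sum_card_filter_eq (d : ℕ) [NeZero d] (s : ℕ) (lo hi : ℕ → ℕ) (r : ZMod d) :
    ∑ b ∈ Icc 1 s, ∑ a ∈ Ioc (lo b) (hi b), (if ((a * b : ℕ) : ZMod d) = r then (1 : ℝ) else 0) =
      progressionMain d s lo hi r + progressionError d s lo hi r := by
  rw [progressionMain, progressionError, ← Finset.sum_add_distrib]
  refine Finset.sum_congr rfl fun b _ => ?_
  rw [add_sub_cancel, Finset.card_filter]
  push_cast
  rfl

open Finset in
/-- The number of pairs `(a, b)` with `a b ≤ X` and `a b ≡ r (mod d)`, pairs with `b > Y` being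
counted twice. -/
noncomputable def weightedPairCount (d X Y : ℕ) (r : ZMod d) : ℝ :=
  ∑ a ∈ Icc 1 X, ∑ b ∈ Icc 1 (X / a),
    (if Y < b then 2 else 1) * (if ((a * b : ℕ) : ZMod d) = r then (1 : ℝ) else 0)

open Finset in
lemma weightedPairCount_eq (d : ℕ) [NeZero d] (X Y : ℕ) (hXY : X.sqrt ≤ Y) (r : ZMod d) :
    weightedPairCount d X Y r =
      (progressionMain d X.sqrt (fun _ => 0) (fun b => X / b) r +
        progressionError d X.sqrt (fun _ => 0) (fun b => X / b) r) +
      (progressionMain d X.sqrt (fun _ => X.sqrt) (fun b => X / b) r +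
        progressionError d X.sqrt (fun _ => X.sqrt) (fun b => X / b) r) +
      (progressionMain d X.sqrt (fun _ => Y) (fun b => X / b) r +
        progressionError d X.sqrt (fun _ => Y) (fun b => X / b) r) := by
  rw [← sum_card_filter_eq, ← sum_card_filter_eq, ← sum_card_filter_eq]
  have e : weightedPairCount d X Y r =
      ∑ a ∈ Icc 1 X, ∑ b ∈ Icc 1 (X / a), (if ((a * b : ℕ) : ZMod d) = r then (1 : ℝ) else 0) +
      ∑ a ∈ Icc 1 X, ∑ b ∈ Icc 1 (X / a),
        (if Y < b then (if ((a * b : ℕ) : ZMod d) = r then (1 : ℝ) else 0) else 0) := by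
    rw [weightedPairCount, ← Finset.sum_add_distrib]
    refine Finset.sum_congr rfl fun a _ => ?_
    rw [← Finset.sum_add_distrib]
    refine Finset.sum_congr rfl fun b _ => ?_
    split_ifs <;> norm_num
  rw [e, sum_hyperbola]
  congr 1
  · congr 1
    refine Finset.sum_congr rfl fun a _ => Finset.sum_congr rfl fun b _ => ?_
    rw [mul_comm]
  · rw [← Finset.sum_subset (Icc_subset_Icc le_rfl (Nat.sqrt_le_self X))]
    · refine Finset.sum_congr rfl fun a _ => ?_
      rw [← Finset.sum_filter]
      refine Finset.sum_congr ?_ fun b _ => by rw [mul_comm]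
      ext b
      simp only [mem_filter, mem_Icc, mem_Ioc]
      omega
    · intro a ha ha'
      refine Finset.sum_eq_zero fun b hb => if_neg fun hYb => ?_
      have h1 : X.sqrt < a := by
        by_contra hcon
        exact ha' (mem_Icc.2 ⟨(mem_Icc.1 ha).1, not_lt.1 hcon⟩)
      have h2 := (mem_Icc.1 hb).2
      rw [Nat.le_div_iff_mul_le (mem_Icc.1 ha).1] at h2
      have := Nat.lt_succ_sqrt X
      have : X.sqrt.succ * X.sqrt.succ ≤ b * a := Nat.mul_le_mul (by omega) h1
      omega

lemma exists_weightedPairCount_eq {ε : ℝ} (hε : 0 < ε) : ∃ C : ℝ, 0 < C ∧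
    ∀ (d : ℕ) [NeZero d] (X Y : ℕ), X.sqrt ≤ Y → ∃ M E : ZMod d → ℝ,
      (∀ r, weightedPairCount d X Y r = M r + E r) ∧
      (∀ (u : (ZMod d)ˣ) (r : ZMod d), M (u * r) = M r) ∧
      ∑ r, E r ^ 2 ≤ C * X * ((X : ℝ) * d) ^ ε := by
  obtain ⟨C, hC, h⟩ := exists_sum_sq_progressionError_le hε
  refine ⟨9 * C, by positivity, fun d _ X Y hXY => ?_⟩
  rcases Nat.eq_zero_or_pos X with rfl | hX
  · exact ⟨0, 0, fun r => by simp [weightedPairCount], fun _ _ => rfl, by simp⟩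
  set s := X.sqrt with hs
  set hi : ℕ → ℕ := fun b => X / b with hhi
  refine ⟨fun r => progressionMain d s (fun _ => 0) hi r + progressionMain d s (fun _ => s) hi r +
      progressionMain d s (fun _ => Y) hi r, fun r => progressionError d s (fun _ => 0) hi r +
      progressionError d s (fun _ => s) hi r + progressionError d s (fun _ => Y) hi r, fun r => ?_,
      fun u r => ?_, ?_⟩
  · rw [weightedPairCount_eq d X Y hXY]
    ring
  · simp only [progressionMain_unit_mul]
  · have hs2 : s ^ 2 ≤ X := Nat.sqrt_le' X
    have hb : ∀ b ∈ Finset.Icc 1 s, hi b * b ≤ X := fun b _ => Nat.div_mul_le_self X b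
    have k1 := h d s X (fun _ => 0) hi hX hs2 hb
    have k2 := h d s X (fun _ => s) hi hX hs2 hb
    have k3 := h d s X (fun _ => Y) hi hX hs2 hb
    calc _ ≤ ∑ r, (3 * progressionError d s (fun _ => 0) hi r ^ 2 +
          3 * progressionError d s (fun _ => s) hi r ^ 2 +
          3 * progressionError d s (fun _ => Y) hi r ^ 2) := by
          refine Finset.sum_le_sum fun r _ => ?_
          set x := progressionError d s (fun _ => 0) hi r
          set y := progressionError d s (fun _ => s) hi r
          set z := progressionError d s (fun _ => Y) hi r
          nlinarith [sq_nonneg (x - y), sq_nonneg (y - z), sq_nonneg (x - z)]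
      _ ≤ _ := by
          rw [Finset.sum_add_distrib, Finset.sum_add_distrib, ← Finset.mul_sum, ← Finset.mul_sum,
            ← Finset.mul_sum]
          linarith

open Finset in
lemma card_zmod_mul_eq_unit_mul_le {d : ℕ} [NeZero d] {k : ℕ} (hk : 0 < k) (u : (ZMod d)ˣ)
    (c : ZMod d) : #{r : ZMod d | r * c = u * k} ≤ k := by
  rcases ({r : ZMod d | r * c = u * k} : Finset (ZMod d)).eq_empty_or_nonempty with h | ⟨r₀, h₀⟩
  · rw [h]; simp
  simp only [mem_filter, mem_univ, true_and] at h₀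
  refine le_trans ?_ (IsAddCyclic.card_nsmul_eq_zero_le (α := ZMod d) hk)
  refine Finset.card_le_card_of_injOn (fun r => r - r₀) ?_ ?_
  · intro r hr
    simp only [coe_filter, mem_univ, true_and, Set.mem_ofPred_eq] at hr ⊢
    rw [nsmul_eq_mul]
    have h1 : (u : ZMod d) * (k * (r - r₀)) = 0 := by
      linear_combination (r₀ - r) * h₀ + r₀ * (hr - h₀)
    exact (Units.mul_right_eq_zero u).1 h1
  · intro x _ y _ hxy
    simpa using hxy

open Finset in
/-- The solutions `c` of `r c ≡ u k (mod d)` in a set of diameter at most `2 d` number `O(k)`. -/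
lemma card_filter_mul_eq_unit_mul_le {d : ℕ} [NeZero d] {k : ℕ} (hk : 0 < k) (u : (ZMod d)ˣ)
    (r : ZMod d) (S : Finset ℕ) (hS : ∀ c ∈ S, ∀ c' ∈ S, ((c : ℝ) - c') ≤ 2 * d) :
    #{c ∈ S | r * ((c : ℕ) : ZMod d) = u * k} ≤ 5 * k := by
  rcases ({c ∈ S | r * ((c : ℕ) : ZMod d) = u * k} : Finset ℕ).eq_empty_or_nonempty with h | ⟨c₀, h₀⟩
  · rw [h]; simp
  obtain ⟨hc₀, h₀⟩ := mem_filter.1 h₀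
  have hd : (0 : ℤ) < d := by exact_mod_cast NeZero.pos d
  have hkz : (0 : ℤ) < k := by exact_mod_cast hk
  have hdvd : ∀ c ∈ {c ∈ S | r * ((c : ℕ) : ZMod d) = u * k}, ∃ t : ℤ,
      (k : ℤ) * (c - c₀) = d * t ∧ -(2 * k : ℤ) ≤ t ∧ t ≤ 2 * k := by
    intro c hc
    obtain ⟨hcS, hc⟩ := mem_filter.1 hc
    have h1 : (u : ZMod d) * (k * (c - c₀)) = 0 := by
      linear_combination (c₀ - c : ZMod d) * hc + (c : ZMod d) * (hc - h₀)
    have h2 := (Units.mul_right_eq_zero u).1 h1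
    have h3 : (((k : ℤ) * ((c : ℤ) - c₀) : ℤ) : ZMod d) = 0 := by
      push_cast
      exact h2
    rw [ZMod.intCast_zmod_eq_zero_iff_dvd] at h3
    obtain ⟨t, ht⟩ := h3
    have h4 : ((c : ℤ) - c₀) ≤ 2 * d := by exact_mod_cast hS c hcS c₀ hc₀
    have h5 : ((c₀ : ℤ) - c) ≤ 2 * d := by exact_mod_cast hS c₀ hc₀ c hcS
    refine ⟨t, ht, ?_, ?_⟩
    · by_contra hcon
      nlinarith
    · by_contra hcon
      nlinarith
  have : #{c ∈ S | r * ((c : ℕ) : ZMod d) = u * k} ≤ #(Icc (-(2 * k : ℤ)) (2 * k)) := by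
    refine Finset.card_le_card_of_injOn (fun c => (k : ℤ) * (c - c₀) / d) ?_ ?_
    · intro c hc
      obtain ⟨t, ht, h1, h2⟩ := hdvd c hc
      dsimp only
      rw [ht, Int.mul_ediv_cancel_left _ hd.ne']
      exact mem_coe.2 (mem_Icc.2 ⟨h1, h2⟩)
    · intro c hc c' hc' he
      obtain ⟨t, ht, -⟩ := hdvd c hc
      obtain ⟨t', ht', -⟩ := hdvd c' hc'
      dsimp only at he
      rw [ht, ht', Int.mul_ediv_cancel_left _ hd.ne', Int.mul_ediv_cancel_left _ hd.ne'] at he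
      rw [he, ← ht'] at ht
      have := mul_left_cancel₀ hkz.ne' ht
      omega
  refine this.trans ?_
  rw [Int.card_Icc]
  omega

open Finset in
lemma sum_Icc_sum_Icc_div_eq {X M : ℕ} (hXM : X ≤ M) (f : ℕ → ℕ → ℝ) :
    ∑ a ∈ Icc 1 X, ∑ b ∈ Icc 1 (X / a), f a b =
      ∑ a ∈ Icc 1 M, ∑ b ∈ Icc 1 M, if a * b ≤ X then f a b else 0 := by
  have h : ∑ a ∈ Icc 1 M, (∑ b ∈ Icc 1 M, if a * b ≤ X then f a b else 0) =
      ∑ a ∈ Icc 1 X, ∑ b ∈ Icc 1 M, if a * b ≤ X then f a b else 0 := by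
    symm
    refine Finset.sum_subset (Icc_subset_Icc le_rfl hXM) fun a ha ha' => ?_
    refine Finset.sum_eq_zero fun b hb => if_neg fun hab => ha' ?_
    have := (mem_Icc.1 hb).1
    exact mem_Icc.2 ⟨(mem_Icc.1 ha).1, by nlinarith⟩
  rw [h]
  exact Finset.sum_congr rfl fun a ha => sum_Icc_div_eq_sum_ite hXM (mem_Icc.1 ha).1 _

open Finset in
lemma sum_Icc_sum_Icc_div_sub_le {X X' : ℕ} (hX : X ≤ X') (f g : ℕ → ℕ → ℝ)
    (hfg : ∀ a b, f a b ≤ g a b) :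
    ∑ a ∈ Icc 1 X', ∑ b ∈ Icc 1 (X' / a), f a b - ∑ a ∈ Icc 1 X, ∑ b ∈ Icc 1 (X / a), f a b ≤
    ∑ a ∈ Icc 1 X', ∑ b ∈ Icc 1 (X' / a), g a b - ∑ a ∈ Icc 1 X, ∑ b ∈ Icc 1 (X / a), g a b := by
  rw [sum_Icc_sum_Icc_div_eq le_rfl f, sum_Icc_sum_Icc_div_eq hX f,
    sum_Icc_sum_Icc_div_eq le_rfl g, sum_Icc_sum_Icc_div_eq hX g]
  simp only [← Finset.sum_sub_distrib]
  refine Finset.sum_le_sum fun a _ => Finset.sum_le_sum fun b _ => ?_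
  have := hfg a b
  by_cases h : a * b ≤ X
  · rw [if_pos h, if_pos h, if_pos (h.trans hX), if_pos (h.trans hX)]
    simp
  · rw [if_neg h, if_neg h]
    split_ifs <;> linarith

open Finset in
/-- The sum of `d₃ m` over `m ≤ N` congruent to `κ` modulo `d`. -/
noncomputable def d3ClassSum (d N : ℕ) (κ : ZMod d) : ℝ :=
  ∑ m ∈ Icc 1 N, (d3 m : ℝ) * (if (m : ZMod d) = κ then 1 else 0)

open Finset in
/-- A version of `d3ClassSum` decomposed by the hyperbola method, in which the length `N / c` of
the inner sum is replaced by `X c`. -/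
noncomputable def d3ClassSumApprox (d Y : ℕ) (X : ℕ → ℕ) (κ : ZMod d) : ℝ :=
  ∑ c ∈ Icc 1 Y, ∑ a ∈ Icc 1 (X c), ∑ b ∈ Icc 1 (X c / a),
    (if Y < b then 2 else 1) * (if ((c * (a * b) : ℕ) : ZMod d) = κ then (1 : ℝ) else 0)

lemma d3ClassSum_eq_approx (d N : ℕ) (κ : ZMod d) :
    d3ClassSum d N κ = d3ClassSumApprox d N.sqrt (fun c => N / c) κ := by
  rw [d3ClassSum, d3ClassSumApprox, sum_d3_mul_eq_sum_sqrt]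

open Finset in
lemma d3ClassSum_eq_sum_of_le (d : ℕ) {N N' : ℕ} (hN : N ≤ N') (κ : ZMod d) :
    d3ClassSum d N κ = ∑ c ∈ Icc 1 N', ∑ a ∈ Icc 1 (N / c), ∑ b ∈ Icc 1 (N / c / a),
      (if ((c * (a * b) : ℕ) : ZMod d) = κ then (1 : ℝ) else 0) := by
  rw [d3ClassSum, sum_d3_mul N (fun m => if (m : ZMod d) = κ then 1 else 0)]
  rw [← Finset.sum_subset (Icc_subset_Icc le_rfl hN)]
  · exact Finset.sum_congr rfl fun c _ =>
      sum_card_divisors_mul (N / c) (fun l => if ((c * l : ℕ) : ZMod d) = κ then 1 else 0)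
  · intro c _ hc'
    have : N / c = 0 := by
      refine Nat.div_eq_of_lt ?_
      by_contra hcon
      simp only [mem_Icc] at *
      omega
    rw [this]
    rfl

open Finset in
lemma abs_d3ClassSumApprox_sub_le (d : ℕ) {N N' : ℕ} (hN : N ≤ N') (X : ℕ → ℕ)
    (hX : ∀ c ∈ Icc 1 N.sqrt, N / c ≤ X c ∧ X c ≤ N' / c) (κ : ZMod d) :
    |d3ClassSumApprox d N.sqrt X κ - d3ClassSum d N κ| ≤
      2 * (d3ClassSum d N' κ - d3ClassSum d N κ) := by
  have key : ∀ c ∈ Icc 1 N.sqrt,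
      |∑ a ∈ Icc 1 (X c), ∑ b ∈ Icc 1 (X c / a),
        (if N.sqrt < b then 2 else 1) * (if ((c * (a * b) : ℕ) : ZMod d) = κ then (1 : ℝ) else 0) -
      ∑ a ∈ Icc 1 (N / c), ∑ b ∈ Icc 1 (N / c / a),
        (if N.sqrt < b then 2 else 1) * (if ((c * (a * b) : ℕ) : ZMod d) = κ then (1 : ℝ) else 0)| ≤
      2 * (∑ a ∈ Icc 1 (N' / c), ∑ b ∈ Icc 1 (N' / c / a),
        (if ((c * (a * b) : ℕ) : ZMod d) = κ then (1 : ℝ) else 0) -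
      ∑ a ∈ Icc 1 (N / c), ∑ b ∈ Icc 1 (N / c / a),
        (if ((c * (a * b) : ℕ) : ZMod d) = κ then (1 : ℝ) else 0)) := by
    intro c hc
    obtain ⟨h1, h2⟩ := hX c hc
    have e1 := sum_Icc_sum_Icc_div_sub_le h1 (fun _ _ => 0) (fun a b =>
      (if N.sqrt < b then 2 else 1) * (if ((c * (a * b) : ℕ) : ZMod d) = κ then (1 : ℝ) else 0))
      (fun a b => by positivity)
    have e2 := sum_Icc_sum_Icc_div_sub_le h1 (fun a b =>
      (if N.sqrt < b then 2 else 1) * (if ((c * (a * b) : ℕ) : ZMod d) = κ then (1 : ℝ) else 0))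
      (fun a b => 2 * (if ((c * (a * b) : ℕ) : ZMod d) = κ then (1 : ℝ) else 0))
      (fun a b => by split_ifs <;> norm_num)
    have e3 := sum_Icc_sum_Icc_div_sub_le h2 (fun _ _ => 0)
      (fun a b => (if ((c * (a * b) : ℕ) : ZMod d) = κ then (1 : ℝ) else 0))
      (fun a b => by positivity)
    simp only [← Finset.mul_sum, Finset.sum_const_zero, sub_zero] at e1 e2 e3
    rw [abs_of_nonneg e1]
    linarith
  have hl : d3ClassSumApprox d N.sqrt X κ - d3ClassSum d N κ = ∑ c ∈ Icc 1 N.sqrt,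
      (∑ a ∈ Icc 1 (X c), ∑ b ∈ Icc 1 (X c / a),
        (if N.sqrt < b then 2 else 1) * (if ((c * (a * b) : ℕ) : ZMod d) = κ then (1 : ℝ) else 0) -
      ∑ a ∈ Icc 1 (N / c), ∑ b ∈ Icc 1 (N / c / a),
        (if N.sqrt < b then 2 else 1) *
          (if ((c * (a * b) : ℕ) : ZMod d) = κ then (1 : ℝ) else 0)) := by
    rw [d3ClassSum_eq_approx, Finset.sum_sub_distrib]
    rfl
  rw [hl, d3ClassSum_eq_sum_of_le d le_rfl, d3ClassSum_eq_sum_of_le d hN,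
    ← Finset.sum_sub_distrib]
  refine (Finset.abs_sum_le_sum_abs _ _).trans ((Finset.sum_le_sum key).trans ?_)
  rw [← Finset.mul_sum]
  refine mul_le_mul_of_nonneg_left ?_ zero_le_two
  refine Finset.sum_le_sum_of_subset_of_nonneg
    (Icc_subset_Icc le_rfl ((Nat.sqrt_le_self N).trans hN)) fun c _ _ => ?_
  have e3 := sum_Icc_sum_Icc_div_sub_le (Nat.div_le_div_right (c := c) hN) (fun _ _ => 0)
    (fun a b => (if ((c * (a * b) : ℕ) : ZMod d) = κ then (1 : ℝ) else 0))
    (fun a b => by positivity)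
  simpa only [Finset.sum_const_zero, sub_zero] using e3

open Finset in
lemma d3ClassSumApprox_eq_sum_weightedPairCount (d : ℕ) [NeZero d] (Y : ℕ) (X : ℕ → ℕ)
    (κ : ZMod d) :
    d3ClassSumApprox d Y X κ =
      ∑ c ∈ Icc 1 Y, ∑ r : ZMod d with r * ((c : ℕ) : ZMod d) = κ, weightedPairCount d (X c) Y r := by
  refine Finset.sum_congr rfl fun c _ => ?_
  simp only [weightedPairCount]
  rw [Finset.sum_comm]
  refine Finset.sum_congr rfl fun a _ => ?_
  rw [Finset.sum_comm]
  refine Finset.sum_congr rfl fun b _ => ?_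
  rw [← Finset.mul_sum]
  congr 1
  rw [Finset.sum_ite_eq]
  refine if_congr ?_ rfl rfl
  simp only [mem_filter, mem_univ, true_and]
  rw [← Nat.cast_mul, mul_comm (a * b) c]

open Finset in
lemma abs_d3ClassSumApprox_unit_mul_sub_le (d : ℕ) [NeZero d] (Y : ℕ) (X : ℕ → ℕ)
    (M E : ℕ → ZMod d → ℝ) (hME : ∀ c ∈ Icc 1 Y, ∀ r, weightedPairCount d (X c) Y r = M c r + E c r)
    (hM : ∀ c (u : (ZMod d)ˣ) r, M c (u * r) = M c r) (u : (ZMod d)ˣ) (κ : ZMod d) :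
    |d3ClassSumApprox d Y X (u * κ) - d3ClassSumApprox d Y X κ| ≤
      (∑ c ∈ Icc 1 Y, ∑ r : ZMod d with r * ((c : ℕ) : ZMod d) = u * κ, |E c r|) +
      ∑ c ∈ Icc 1 Y, ∑ r : ZMod d with r * ((c : ℕ) : ZMod d) = κ, |E c r| := by
  have hsum : ∀ κ', d3ClassSumApprox d Y X κ' =
      ∑ c ∈ Icc 1 Y, ∑ r : ZMod d with r * ((c : ℕ) : ZMod d) = κ', M c r +
      ∑ c ∈ Icc 1 Y, ∑ r : ZMod d with r * ((c : ℕ) : ZMod d) = κ', E c r := by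
    intro κ'
    rw [d3ClassSumApprox_eq_sum_weightedPairCount, ← Finset.sum_add_distrib]
    refine Finset.sum_congr rfl fun c hc => ?_
    rw [← Finset.sum_add_distrib]
    exact Finset.sum_congr rfl fun r _ => hME c hc r
  have hinv : ∀ c, ∑ r : ZMod d with r * ((c : ℕ) : ZMod d) = u * κ, M c r =
      ∑ r : ZMod d with r * ((c : ℕ) : ZMod d) = κ, M c r := by
    intro c
    symm
    refine Finset.sum_bij (fun r _ => u * r) ?_ ?_ ?_ ?_
    · intro t ht
      simp only [mem_filter, mem_univ, true_and] at ht ⊢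
      rw [mul_assoc, ht]
    · intro t _ t' _ h
      exact u.isUnit.mul_left_cancel h
    · intro t ht
      simp only [mem_filter, mem_univ, true_and] at ht
      refine ⟨↑u⁻¹ * t, ?_, by rw [Units.mul_inv_cancel_left]⟩
      simp only [mem_filter, mem_univ, true_and]
      rw [mul_assoc, ht, Units.inv_mul_cancel_left]
    · intro r _
      exact (hM c u r).symm
  rw [hsum, hsum]
  simp only [hinv, add_sub_add_left_eq_sub]
  refine (abs_sub _ _).trans (add_le_add ?_ ?_) <;>
  exact (Finset.abs_sum_le_sum_abs _ _).trans
    (Finset.sum_le_sum fun c _ => Finset.abs_sum_le_sum_abs _ _)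

open Finset in
lemma sq_sum_abs_le {d : ℕ} [NeZero d] {Y k J : ℕ} (hk : 0 < k) (u : (ZMod d)ˣ) (j X : ℕ → ℕ)
    (E : ℕ → ZMod d → ℝ) {A B : ℝ} (hB : 0 ≤ B)
    (hX : ∀ c ∈ Icc 1 Y, 1 ≤ X (j c) ∧ (X (j c) : ℝ) ≤ A * (1 / (c : ℝ)))
    (hj : ∀ c ∈ Icc 1 Y, j c ≤ J)
    (hdiam : ∀ c ∈ Icc 1 Y, ∀ c' ∈ Icc 1 Y, j c = j c' → (c : ℝ) - c' ≤ 2 * d)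
    (hE : ∀ i, ∑ r, E i r ^ 2 ≤ B * X i) :
    (∑ c ∈ Icc 1 Y, ∑ r : ZMod d with r * ((c : ℕ) : ZMod d) = u * k, |E (j c) r|) ^ 2 ≤
      (k * (A * ∑ c ∈ Icc 1 Y, 1 / (c : ℝ))) * (5 * k * ((J + 1) * B)) := by
  set P : Finset (ℕ × ZMod d) :=
    ((Icc 1 Y) ×ˢ (univ : Finset (ZMod d))).filter fun p => p.2 * ((p.1 : ℕ) : ZMod d) = u * k with hP
  have hsum : ∀ f : ℕ → ZMod d → ℝ,
      ∑ c ∈ Icc 1 Y, ∑ r : ZMod d with r * ((c : ℕ) : ZMod d) = u * k, f c r =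
      ∑ p ∈ P, f p.1 p.2 := by
    intro f
    rw [hP, Finset.sum_filter, Finset.sum_product]
    exact Finset.sum_congr rfl fun c _ => by rw [Finset.sum_filter]
  have hPmem : ∀ p ∈ P, p.1 ∈ Icc 1 Y := fun p hp => (mem_product.1 (mem_filter.1 hp).1).1
  have hXpos : ∀ p ∈ P, (0 : ℝ) < X (j p.1) := fun p hp => by
    exact_mod_cast (hX p.1 (hPmem p hp)).1
  have hcs := Finset.sum_sq_le_sum_mul_sum_of_sq_le_mul P (r := fun p => |E (j p.1) p.2|)
    (f := fun p => (X (j p.1) : ℝ)) (g := fun p => E (j p.1) p.2 ^ 2 / X (j p.1))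
    (fun p _ => by positivity) (fun p _ => by positivity) (fun p hp => by
      have := (hXpos p hp).ne'
      rw [sq_abs]
      field_simp
      rfl)
  rw [hsum fun c r => |E (j c) r|]
  refine hcs.trans (mul_le_mul ?_ ?_ (Finset.sum_nonneg fun p _ => by positivity) ?_)
  · rw [← hsum fun c _ => (X (j c) : ℝ), Finset.mul_sum, Finset.mul_sum]
    refine Finset.sum_le_sum fun c hc => ?_
    rw [Finset.sum_const, nsmul_eq_mul]
    refine mul_le_mul (by exact_mod_cast card_zmod_mul_eq_unit_mul_le hk u _) (hX c hc).2
      (by positivity) (by positivity)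
  · have h1 := sum_comp_le_of_card_fiber_le (S := P) (T := (range (J + 1)) ×ˢ (univ : Finset (ZMod d)))
      (fun p => (j p.1, p.2)) (fun q => E q.1 q.2 ^ 2 / X q.1) (5 * k) ?_ ?_ ?_
    · refine h1.trans ?_
      refine mul_le_mul_of_nonneg_left ?_ (by positivity)
      rw [Finset.sum_product]
      calc _ ≤ ∑ i ∈ range (J + 1), B := by
            refine Finset.sum_le_sum fun i _ => ?_
            dsimp only
            rw [← Finset.sum_div]
            rcases Nat.eq_zero_or_pos (X i) with h0 | h0
            · rw [h0]; simpa using hB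
            · have : (0 : ℝ) < X i := by exact_mod_cast h0
              rw [div_le_iff₀ this]
              exact hE i
        _ = _ := by simp
    · intro p hp
      exact mem_product.2 ⟨mem_range.2 (Nat.lt_succ_of_le (hj _ (hPmem p hp))), mem_univ _⟩
    · intro q _
      positivity
    · rintro ⟨i, r⟩ -
      have h2 := card_filter_mul_eq_unit_mul_le hk u r ((Icc 1 Y).filter fun c => j c = i)
        (fun c hc c' hc' => hdiam c (mem_filter.1 hc).1 c' (mem_filter.1 hc').1
          ((mem_filter.1 hc).2.trans (mem_filter.1 hc').2.symm))
      norm_cast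
      refine le_trans ?_ h2
      refine Finset.card_le_card_of_injOn Prod.fst ?_ ?_
      · rintro ⟨c, r'⟩ hp
        obtain ⟨hp1, hp2⟩ := mem_filter.1 (mem_coe.1 hp)
        simp only [Prod.mk.injEq] at hp2
        obtain ⟨rfl, rfl⟩ := hp2
        exact mem_coe.2 (mem_filter.2 ⟨mem_filter.2 ⟨hPmem _ hp1, rfl⟩, (mem_filter.1 hp1).2⟩)
      · rintro ⟨c, r₁⟩ h₁ ⟨c', r₂⟩ h₂ hcc
        have e1 := (mem_filter.1 (mem_coe.1 h₁)).2
        have e2 := (mem_filter.1 (mem_coe.1 h₂)).2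
        simp only [Prod.mk.injEq] at e1 e2 hcc ⊢
        exact ⟨hcc, e1.2.trans e2.2.symm⟩
  · have : 0 ≤ ∑ p ∈ P, (X (j p.1) : ℝ) := Finset.sum_nonneg fun p _ => by positivity
    refine this.trans ?_
    rw [← hsum fun c _ => (X (j c) : ℝ), Finset.mul_sum, Finset.mul_sum]
    refine Finset.sum_le_sum fun c hc => ?_
    rw [Finset.sum_const, nsmul_eq_mul]
    refine mul_le_mul (by exact_mod_cast card_zmod_mul_eq_unit_mul_le hk u _) (hX c hc).2
      (by positivity) (by positivity)

open Finset in
lemma d3ClassSum_sub_le {ε C : ℝ} (hε : 0 < ε) (hC : 0 < C)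
    (h : ∀ m : ℕ, 1 ≤ m → (d3 m : ℝ) ≤ C * (m : ℝ) ^ ε) (d : ℕ) [NeZero d] {N N' : ℕ} (hN : N ≤ N')
    (κ : ZMod d) :
    d3ClassSum d N' κ - d3ClassSum d N κ ≤ C * (N' : ℝ) ^ ε * (((N' : ℝ) - N) / d + 1) := by
  have e : d3ClassSum d N' κ - d3ClassSum d N κ =
      ∑ m ∈ Ioc N N', (d3 m : ℝ) * (if (m : ZMod d) = κ then 1 else 0) := by
    rw [sub_eq_iff_eq_add, d3ClassSum, d3ClassSum, add_comm]
    rw [← Finset.Ico_add_one_right_eq_Icc, ← Finset.Ico_add_one_right_eq_Icc,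
      ← Finset.Ico_add_one_add_one_eq_Ioc, Finset.sum_Ico_consecutive _ (by omega) (by omega)]
  rw [e]
  calc _ ≤ ∑ m ∈ Ioc N N', C * (N' : ℝ) ^ ε * (if (m : ZMod d) = κ then 1 else 0) := by
        refine Finset.sum_le_sum fun m hm => ?_
        obtain ⟨h1, h2⟩ := mem_Ioc.1 hm
        refine mul_le_mul_of_nonneg_right ((h m (by omega)).trans ?_) (by positivity)
        have : (m : ℝ) ≤ N' := by exact_mod_cast h2
        gcongr
    _ = C * (N' : ℝ) ^ ε * #{m ∈ Ioc N N' | ((m : ℕ) : ZMod d) = κ} := by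
        rw [← Finset.mul_sum, Finset.sum_boole]
    _ ≤ _ := mul_le_mul_of_nonneg_left (card_Ioc_filter_zmod_le d N N' hN κ) (by positivity)

lemma exp_sub_one_le_two_mul {η : ℝ} (h0 : 0 ≤ η) (h1 : η ≤ 1) : Real.exp η - 1 ≤ 2 * η := by
  have := Real.norm_exp_sub_one_sub_id_le (x := η) (by rw [Real.norm_eq_abs, abs_of_nonneg h0]; exact h1)
  rw [Real.norm_eq_abs, Real.norm_eq_abs, abs_of_nonneg h0] at this
  have := le_of_abs_le this
  nlinarith

/-- Geometric localisation: the lengths `N / c`, `c ≤ √N`, can be replaced by lengths depending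
only on a slowly growing function `j c`. -/
lemma exists_localisation (d N : ℕ) (hd : 0 < d) (hdN : d ≤ N.sqrt) :
    ∃ (j X : ℕ → ℕ) (J N' : ℕ), N ≤ N' ∧ (N' : ℝ) ≤ 3 * N ∧
      ((N' : ℝ) - N) / d ≤ 8 * N.sqrt ∧ (J + 1 : ℝ) ≤ (1 + Real.log N.sqrt) * N.sqrt / d ∧
      (∀ i, X i ≤ N) ∧
      ∀ c ∈ Finset.Icc 1 N.sqrt, j c ≤ J ∧ N / c ≤ X (j c) ∧ X (j c) ≤ N' / c ∧
        (X (j c) : ℝ) ≤ 3 * N * (1 / (c : ℝ)) ∧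
        ∀ c' ∈ Finset.Icc 1 N.sqrt, j c = j c' → (c : ℝ) - c' ≤ 2 * d := by
  set Y := N.sqrt with hY
  have hdR : (0 : ℝ) < d := by exact_mod_cast hd
  have hYpos : 0 < Y := by omega
  have hYR : (0 : ℝ) < Y := by exact_mod_cast hYpos
  have hYN : Y ≤ N := Nat.sqrt_le_self N
  have hNR : (0 : ℝ) < N := by exact_mod_cast hYpos.trans_le hYN
  set η : ℝ := d / Y with hη
  have hη0 : 0 < η := div_pos hdR hYR
  have hη1 : η ≤ 1 := by
    rw [hη, div_le_one hYR]; exact_mod_cast hdN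
  have hexp := exp_sub_one_le_two_mul hη0.le hη1
  have hexp0 : 1 ≤ Real.exp η := Real.one_le_exp hη0.le
  have hjlog : ∀ c : ℕ, 1 ≤ c → ((⌊Real.log c / η⌋₊ : ℕ) : ℝ) * η ≤ Real.log c ∧
      Real.log c < (⌊Real.log c / η⌋₊ : ℕ) * η + η := by
    intro c hc
    have hlog : 0 ≤ Real.log c := Real.log_nonneg (by exact_mod_cast hc)
    have h1 := Nat.floor_le (div_nonneg hlog hη0.le)
    have h2 := Nat.lt_floor_add_one (Real.log c / η)
    rw [le_div_iff₀ hη0] at h1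
    rw [div_lt_iff₀ hη0] at h2
    exact ⟨h1, by linarith⟩
  refine ⟨fun c => ⌊Real.log c / η⌋₊, fun i => ⌊(N : ℝ) * Real.exp (-(i * η))⌋₊,
    ⌊Real.log Y / η⌋₊, ⌊(N : ℝ) * Real.exp η⌋₊, ?_, ?_, ?_, ?_, ?_, ?_⟩
  · refine Nat.le_floor ?_
    nlinarith
  · refine (Nat.floor_le (by positivity)).trans ?_
    nlinarith
  · have h1 : ((⌊(N : ℝ) * Real.exp η⌋₊ : ℕ) : ℝ) ≤ N * Real.exp η := Nat.floor_le (by positivity)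
    have h2 : N < (Y + 1) * (Y + 1) := Nat.lt_succ_sqrt N
    have h3 : N ≤ 4 * (Y * Y) := by nlinarith
    have h3' : (N : ℝ) ≤ 4 * (Y * Y) := by exact_mod_cast h3
    have h4 : (N : ℝ) * η ≤ 4 * Y * d := by
      rw [hη, ← mul_div_assoc, div_le_iff₀ hYR]
      nlinarith
    rw [div_le_iff₀ hdR]
    nlinarith
  · have hlog : 0 ≤ Real.log Y := Real.log_nonneg (by exact_mod_cast hYpos)
    have h1 := Nat.floor_le (div_nonneg hlog hη0.le)
    have h2 : Real.log Y / η = Real.log Y * Y / d := by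
      rw [hη]; field_simp
    have h3 : 1 ≤ (Y : ℝ) / d := by
      rw [one_le_div hdR]; exact_mod_cast hdN
    rw [h2] at h1 ⊢
    rw [add_mul, add_div, one_mul]
    linarith
  · intro i
    refine Nat.floor_le_of_le ?_
    have : Real.exp (-(i * η)) ≤ 1 := Real.exp_le_one_iff.2 (by
      have : 0 ≤ (i : ℝ) * η := by positivity
      linarith)
    nlinarith
  · intro c hc
    obtain ⟨hc1, hcY⟩ := Finset.mem_Icc.1 hc
    have hcR : (0 : ℝ) < c := by exact_mod_cast hc1
    obtain ⟨l1, l2⟩ := hjlog c hc1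
    have e1 : (1 : ℝ) / c ≤ Real.exp (-((⌊Real.log c / η⌋₊ : ℕ) * η)) := by
      rw [one_div, Real.exp_neg]
      refine inv_anti₀ (Real.exp_pos _) ?_
      calc _ ≤ Real.exp (Real.log c) := Real.exp_le_exp.2 l1
        _ = c := Real.exp_log hcR
    have e2 : Real.exp (-((⌊Real.log c / η⌋₊ : ℕ) * η)) ≤ Real.exp η * (1 / c) := by
      have : -((⌊Real.log c / η⌋₊ : ℕ) * η) ≤ η - Real.log c := by linarith
      refine (Real.exp_le_exp.2 this).trans ?_
      rw [Real.exp_sub, Real.exp_log hcR]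
      exact le_of_eq (by ring)
    have e3 : ((⌊(N : ℝ) * Real.exp (-((⌊Real.log c / η⌋₊ : ℕ) * η))⌋₊ : ℕ) : ℝ) ≤
        N * (Real.exp η * (1 / c)) :=
      (Nat.floor_le (by positivity)).trans (mul_le_mul_of_nonneg_left e2 hNR.le)
    refine ⟨?_, ?_, ?_, ?_, ?_⟩
    · refine Nat.floor_le_floor ?_
      have : Real.log c ≤ Real.log Y := Real.log_le_log hcR (by exact_mod_cast hcY)
      gcongr
    · rw [← Nat.floor_div_eq_div (K := ℝ)]
      refine Nat.floor_le_floor ?_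
      rw [div_eq_mul_one_div]
      exact mul_le_mul_of_nonneg_left e1 hNR.le
    · rw [Nat.le_div_iff_mul_le hc1]
      refine Nat.le_floor ?_
      push_cast
      calc _ ≤ N * (Real.exp η * (1 / c)) * c := mul_le_mul_of_nonneg_right e3 hcR.le
        _ = _ := by field_simp
    · refine e3.trans ?_
      rw [← mul_assoc]
      refine mul_le_mul_of_nonneg_right ?_ (by positivity)
      nlinarith
    · intro c' hc' hjj
      obtain ⟨hc1', hcY'⟩ := Finset.mem_Icc.1 hc'
      have hcR' : (0 : ℝ) < c' := by exact_mod_cast hc1'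
      obtain ⟨l1', l2'⟩ := hjlog c' hc1'
      dsimp only at hjj
      rw [hjj] at l2
      have h3 : (c : ℝ) ≤ c' * Real.exp η := by
        rw [← Real.exp_log hcR, ← Real.exp_log hcR', ← Real.exp_add]
        exact Real.exp_le_exp.2 (by linarith)
      have h4 : (c' : ℝ) ≤ Y := by exact_mod_cast hcY'
      have h5 : (Y : ℝ) * η = d := by rw [hη]; field_simp
      nlinarith [mul_le_mul_of_nonneg_left hexp hcR'.le, mul_le_mul_of_nonneg_right h4 hη0.le]

lemma exists_one_add_log_le {ε : ℝ} (hε : 0 < ε) :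
    ∃ C : ℝ, 0 < C ∧ ∀ x : ℝ, 1 ≤ x → 1 + Real.log x ≤ C * x ^ ε := by
  refine ⟨1 + 1 / ε, by positivity, fun x hx => ?_⟩
  have h1 := Real.log_le_rpow_div (zero_le_one.trans hx) hε
  have h2 := Real.one_le_rpow hx hε.le
  rw [add_mul, one_mul, div_mul_eq_mul_div, one_mul]
  linarith

/-- The divisor sum `d3ClassSum` takes nearly the same value on all classes `u k`, `u` a unit. -/
lemma exists_abs_d3ClassSum_unit_mul_sub_le {ε : ℝ} (hε : 0 < ε) : ∃ C : ℝ, 0 < C ∧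
    ∀ (d : ℕ) [NeZero d] (N k : ℕ) (u : (ZMod d)ˣ), d ≤ N.sqrt → 1 ≤ k →
      |d3ClassSum d N (u * k) - d3ClassSum d N k| ≤ C * k * (N : ℝ) ^ (3 / 4 + ε) / √d := by
  have hδ : 0 < ε / 2 := by positivity
  obtain ⟨C₁, hC₁, h₁⟩ := exists_weightedPairCount_eq hδ
  obtain ⟨C₂, hC₂, h₂⟩ := exists_d3_le hε
  obtain ⟨C₃, hC₃, h₃⟩ := exists_one_add_log_le hδ
  refine ⟨2 * √(15 * C₁ * C₃ ^ 2) + 4 * (C₂ * 3 ^ ε * 9), by positivity, fun d _ N k u hdN hk => ?_⟩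
  have hd : 0 < d := NeZero.pos d
  obtain ⟨j, X, J, N', hNN', hN'3, hN'd, hJ, hXN, hc⟩ := exists_localisation d N hd hdN
  choose M E hwpc hM hE using fun i => h₁ d (X i) N.sqrt (Nat.sqrt_le_sqrt (hXN i))
  set Y := N.sqrt with hY
  have hdR : (0 : ℝ) < d := by exact_mod_cast hd
  have hYpos : 0 < Y := by omega
  have hYR : (1 : ℝ) ≤ Y := by exact_mod_cast hYpos
  have hYN : Y ≤ N := Nat.sqrt_le_self N
  have hNR : (1 : ℝ) ≤ N := by exact_mod_cast hYpos.trans_le hYN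
  have hkR : (1 : ℝ) ≤ k := by exact_mod_cast hk
  have hNpos : (0 : ℝ) < N := by linarith
  have hYN2 : (Y : ℝ) ≤ (N : ℝ) ^ (1 / 2 : ℝ) := by
    rw [← Real.sqrt_eq_rpow]
    refine Real.le_sqrt_of_sq_le ?_
    exact_mod_cast Nat.sqrt_le' N
  have hdY : (d : ℝ) ≤ Y := by exact_mod_cast hdN
  have hlog : 1 + Real.log Y ≤ C₃ * (N : ℝ) ^ (ε / 2) := by
    refine le_trans ?_ (h₃ N hNR)
    have : Real.log Y ≤ Real.log N := Real.log_le_log (by linarith) (by exact_mod_cast hYN)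
    linarith
  have hlog0 : 0 ≤ Real.log Y := Real.log_nonneg hYR
  set B : ℝ := C₁ * ((N : ℝ) ^ (ε / 2)) ^ 2 with hB
  have hB0 : 0 ≤ B := by positivity
  have hEB : ∀ i, ∑ r, E i r ^ 2 ≤ B * X i := by
    intro i
    refine (hE i).trans ?_
    have : ((X i : ℝ) * d) ^ (ε / 2) ≤ ((N : ℝ) ^ (ε / 2)) ^ 2 := by
      rw [sq, ← Real.mul_rpow hNpos.le hNpos.le]
      have h1 : (X i : ℝ) ≤ N := by exact_mod_cast hXN i
      have h2 : (d : ℝ) ≤ N := by exact_mod_cast hdN.trans hYN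
      gcongr
    calc C₁ * X i * ((X i : ℝ) * d) ^ (ε / 2) ≤ C₁ * X i * ((N : ℝ) ^ (ε / 2)) ^ 2 := by gcongr
      _ = _ := by rw [hB]; ring
  set R : ℝ := k * (N : ℝ) ^ (3 / 4 + ε) / √d with hR
  have hR0 : 0 ≤ R := by positivity
  have hV : ∀ v : (ZMod d)ˣ, ∑ c ∈ Finset.Icc 1 Y,
      ∑ r : ZMod d with r * ((c : ℕ) : ZMod d) = v * k, |E (j c) r| ≤ √(15 * C₁ * C₃ ^ 2) * R := by
    intro v
    have hsq := sq_sum_abs_le (Y := Y) (J := J) hk v j X E (A := 3 * N) hB0 ?_ (fun c hc' => (hc c hc').1)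
      (fun c hc' c' hc'' hj => (hc c hc').2.2.2.2 c' hc'' hj) hEB
    · refine abs_le_of_sq_le_sq' ?_ (by positivity) |>.2
      refine hsq.trans ?_
      rw [mul_pow, Real.sq_sqrt (by positivity), hR, div_pow, Real.sq_sqrt hdR.le]
      have hinv := (sum_Icc_inv_le_one_add_log Y).trans hlog
      have hJ' : (J + 1 : ℝ) ≤ C₃ * (N : ℝ) ^ (ε / 2) * (N : ℝ) ^ (1 / 2 : ℝ) / d :=
        hJ.trans (by gcongr)
      calc _ ≤ (k * (3 * N * (C₃ * (N : ℝ) ^ (ε / 2)))) *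
            (5 * k * ((C₃ * (N : ℝ) ^ (ε / 2) * (N : ℝ) ^ (1 / 2 : ℝ) / d) * B)) := by gcongr
        _ = 15 * C₁ * C₃ ^ 2 * (k ^ 2 * (N * (N : ℝ) ^ (1 / 2 : ℝ) * ((N : ℝ) ^ (ε / 2)) ^ 4) / d) := by
            rw [hB]; ring
        _ = _ := by
            congr 2
            rw [mul_pow]
            congr 1
            rw [← Real.rpow_natCast, ← Real.rpow_natCast, ← Real.rpow_mul hNpos.le,
              ← Real.rpow_mul hNpos.le, ← Real.rpow_one_add' hNpos.le (by norm_num),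
              ← Real.rpow_add hNpos]
            congr 1
            push_cast
            ring
    · intro c hc'
      refine ⟨?_, (hc c hc').2.2.2.1⟩
      refine le_trans ?_ (hc c hc').2.1
      obtain ⟨g1, g2⟩ := Finset.mem_Icc.1 hc'
      rw [Nat.le_div_iff_mul_le g1]
      omega
  have happrox : ∀ κ, |d3ClassSumApprox d Y (fun c => X (j c)) κ - d3ClassSum d N κ| ≤
      2 * (C₂ * 3 ^ ε * 9) * R := by
    intro κ
    refine (abs_d3ClassSumApprox_sub_le d hNN' (fun c => X (j c))
      (fun c hc' => ⟨(hc c hc').2.1, (hc c hc').2.2.1⟩) κ).trans ?_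
    rw [mul_assoc]
    refine mul_le_mul_of_nonneg_left ((d3ClassSum_sub_le hε hC₂ h₂ d hNN' κ).trans ?_) zero_le_two
    have hN'ε : (N' : ℝ) ^ ε ≤ 3 ^ ε * (N : ℝ) ^ ε := by
      rw [← Real.mul_rpow (by norm_num) hNpos.le]
      gcongr
    have h9 : ((N' : ℝ) - N) / d + 1 ≤ 9 * Y := by linarith
    have hYR' : (N : ℝ) ^ ε * Y ≤ R := by
      rw [hR, le_div_iff₀ (Real.sqrt_pos.2 hdR)]
      have hsd : √(d : ℝ) ≤ (N : ℝ) ^ (1 / 4 : ℝ) := by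
        refine (Real.sqrt_le_sqrt (hdY.trans hYN2)).trans ?_
        rw [Real.sqrt_eq_rpow, ← Real.rpow_mul hNpos.le]
        norm_num
      calc (N : ℝ) ^ ε * Y * √d ≤ (N : ℝ) ^ ε * (N : ℝ) ^ (1 / 2 : ℝ) * (N : ℝ) ^ (1 / 4 : ℝ) := by
            gcongr
        _ = (N : ℝ) ^ (3 / 4 + ε) := by
            rw [← Real.rpow_add hNpos, ← Real.rpow_add hNpos]
            congr 1
            ring
        _ ≤ _ := le_mul_of_one_le_left (by positivity) hkR
    have h90 : 0 ≤ ((N' : ℝ) - N) / d + 1 := by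
      have : (N : ℝ) ≤ N' := by exact_mod_cast hNN'
      have : 0 ≤ ((N' : ℝ) - N) / d := div_nonneg (by linarith) hdR.le
      linarith
    calc C₂ * (N' : ℝ) ^ ε * (((N' : ℝ) - N) / d + 1) ≤ C₂ * (3 ^ ε * (N : ℝ) ^ ε) * (9 * Y) := by
          gcongr
      _ = C₂ * 3 ^ ε * 9 * ((N : ℝ) ^ ε * Y) := by ring
      _ ≤ _ := by gcongr
  have hmain := abs_d3ClassSumApprox_unit_mul_sub_le d Y (fun c => X (j c)) (fun c => M (j c))
    (fun c => E (j c)) (fun c _ r => hwpc (j c) r) (fun c u r => hM (j c) u r) u k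
  have hVu := hV u
  have hV1 := hV 1
  rw [Units.val_one, one_mul] at hV1
  have a1 := happrox (u * k)
  have a2 := happrox k
  have e : d3ClassSum d N (u * k) - d3ClassSum d N k =
      (d3ClassSumApprox d Y (fun c => X (j c)) (u * k) - d3ClassSumApprox d Y (fun c => X (j c)) k) -
      (d3ClassSumApprox d Y (fun c => X (j c)) (u * k) - d3ClassSum d N (u * k)) +
      (d3ClassSumApprox d Y (fun c => X (j c)) k - d3ClassSum d N k) := by ring
  rw [e]
  have e' : (2 * √(15 * C₁ * C₃ ^ 2) + 4 * (C₂ * 3 ^ ε * 9)) * k * (N : ℝ) ^ (3 / 4 + ε) / √d =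
      (2 * √(15 * C₁ * C₃ ^ 2) + 4 * (C₂ * 3 ^ ε * 9)) * R := by rw [hR]; ring
  rw [e']
  refine (abs_add_le _ _).trans ((add_le_add (abs_sub _ _) le_rfl).trans ?_)
  linarith

/-- A sequence whose increments are dominated by those of a nonnegative decreasing sequence `h`
converges, with error at most `h`. -/
lemma exists_abs_sub_le_of_abs_succ_sub_le {S h : ℕ → ℝ} (h0 : ∀ n, 1 ≤ n → 0 ≤ h n)
    (hS : ∀ n, 1 ≤ n → |S (n + 1) - S n| ≤ h n - h (n + 1)) :
    ∃ c, ∀ n, 1 ≤ n → |S n - c| ≤ h n := by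
  have hup : ∀ m n, 1 ≤ m → m ≤ n → |S n - S m| ≤ h m - h n := by
    intro m n hm hmn
    induction n, hmn using Nat.le_induction with
    | base => simp
    | succ n hmn ih =>
      have h1 := hS n (hm.trans hmn)
      have h2 := abs_add_le (S (n + 1) - S n) (S n - S m)
      rw [sub_add_sub_cancel] at h2
      linarith
  have hle : ∀ m n, 1 ≤ m → 1 ≤ n → S m - h m ≤ S n + h n := by
    intro m n hm hn
    rcases le_total m n with hmn | hmn
    · have h1 := abs_le.1 (hup m n hm hmn)
      have := h0 n hn
      linarith
    · have h1 := abs_le.1 (hup n m hn hmn)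
      have := h0 m hm
      linarith
  have hbdd : BddAbove (Set.range fun m : ℕ => S (m + 1) - h (m + 1)) :=
    ⟨S 1 + h 1, by rintro _ ⟨m, rfl⟩; exact hle _ _ (by omega) le_rfl⟩
  refine ⟨⨆ m : ℕ, (S (m + 1) - h (m + 1)), fun n hn => ?_⟩
  obtain ⟨k, rfl⟩ : ∃ k, n = k + 1 := ⟨n - 1, by omega⟩
  have h1 := le_ciSup hbdd k
  have h2 : ⨆ m : ℕ, (S (m + 1) - h (m + 1)) ≤ S (k + 1) + h (k + 1) :=
    ciSup_le fun m => hle _ _ (by omega) hn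
  rw [abs_le]
  constructor <;> linarith

lemma inv_sqrt_mul_le {n : ℕ} (hn : 1 ≤ n) :
    1 / (√(n : ℝ) * (n + 1)) ≤ 2 / √(n : ℝ) - 2 / √((n + 1 : ℕ) : ℝ) := by
  have hx : 0 < √(n : ℝ) := Real.sqrt_pos.2 (by exact_mod_cast hn)
  have hxy : √(n : ℝ) ≤ √((n + 1 : ℕ) : ℝ) := Real.sqrt_le_sqrt (by push_cast; linarith)
  have hx2 : √(n : ℝ) ^ 2 = n := Real.sq_sqrt (by positivity)
  have hy2 : √((n + 1 : ℕ) : ℝ) ^ 2 = n + 1 := by rw [Real.sq_sqrt (by positivity)]; push_cast; ring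
  rw [← hy2]
  set x := √(n : ℝ)
  set y := √((n + 1 : ℕ) : ℝ)
  have hy : 0 < y := hx.trans_le hxy
  have : y ^ 2 - x ^ 2 = 1 := by rw [hx2, hy2]; ring
  rw [div_sub_div _ _ hx.ne' hy.ne', div_le_div_iff₀ (by positivity) (by positivity)]
  have e : 1 * (x * y) = x * y * (y ^ 2 - x ^ 2) := by rw [this]; ring
  rw [e]
  have : 0 ≤ x * y * (y - x) * (y - x) := by
    have := sub_nonneg.2 hxy
    positivity
  nlinarith

lemma one_div_succ_le_log_sub {n : ℕ} (hn : 1 ≤ n) :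
    1 / ((n : ℝ) + 1) ≤ Real.log ((n + 1 : ℕ) : ℝ) - Real.log n ∧
      Real.log ((n + 1 : ℕ) : ℝ) - Real.log n ≤ 1 / (n : ℝ) := by
  have hn0 : (0 : ℝ) < n := by exact_mod_cast hn
  push_cast
  rw [← Real.log_div (by positivity) hn0.ne']
  constructor
  · have := Real.one_sub_inv_le_log_of_pos (x := (n + 1 : ℝ) / n) (by positivity)
    refine le_trans (le_of_eq ?_) this
    field_simp
    ring
  · have := Real.log_le_sub_one_of_pos (x := (n + 1 : ℝ) / n) (by positivity)
    refine this.trans (le_of_eq ?_)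
    field_simp
    ring

open Finset in
lemma exists_abs_sum_inv_sub_le : ∃ γ : ℝ, ∀ n : ℕ, 1 ≤ n →
    |∑ k ∈ Icc 1 n, 1 / (k : ℝ) - Real.log n - γ| ≤ 1 / n := by
  refine exists_abs_sub_le_of_abs_succ_sub_le (h := fun n => 1 / (n : ℝ))
    (S := fun n => ∑ k ∈ Icc 1 n, 1 / (k : ℝ) - Real.log n) (fun n _ => by positivity) fun n hn => ?_
  obtain ⟨h1, h2⟩ := one_div_succ_le_log_sub hn
  rw [Finset.sum_Icc_succ_top (by omega)]
  push_cast at h1 h2 ⊢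
  rw [abs_le]
  constructor <;> linarith

lemma log_add_one_le_two_mul_sqrt {x : ℝ} (hx : 1 ≤ x) : Real.log x + 1 ≤ 2 * √x := by
  have h1 := Real.log_le_sub_one_of_pos (Real.sqrt_pos.2 (by linarith : 0 < x))
  rw [Real.log_sqrt (by linarith)] at h1
  linarith

open Finset in
lemma exists_abs_sum_log_div_sub_le : ∃ γ : ℝ, ∀ n : ℕ, 1 ≤ n →
    |∑ k ∈ Icc 1 n, Real.log k / (k : ℝ) - Real.log n ^ 2 / 2 - γ| ≤ 4 / √(n : ℝ) := by
  refine exists_abs_sub_le_of_abs_succ_sub_le (h := fun n => 4 / √(n : ℝ))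
    (S := fun n => ∑ k ∈ Icc 1 n, Real.log k / (k : ℝ) - Real.log n ^ 2 / 2)
    (fun n _ => by positivity) fun n hn => ?_
  have hn0 : (1 : ℝ) ≤ n := by exact_mod_cast hn
  obtain ⟨h1, h2⟩ := one_div_succ_le_log_sub hn
  have h3 := inv_sqrt_mul_le hn
  have h4 := log_add_one_le_two_mul_sqrt hn0
  have hlog := Real.log_nonneg hn0
  rw [Finset.sum_Icc_succ_top (by omega)]
  set a := Real.log n
  set b := Real.log ((n + 1 : ℕ) : ℝ)
  have hn' : 1 / (n : ℝ) - 1 / (n + 1) = 1 / (n * (n + 1)) := by field_simp; ring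
  have hb : b / ((n + 1 : ℕ) : ℝ) = b * (1 / ((n : ℝ) + 1)) := by push_cast; ring
  have hinv : 0 < 1 / ((n : ℝ) + 1) := by positivity
  have hinv2 : 1 / (n : ℝ) ≤ 2 * (1 / ((n : ℝ) + 1)) := by
    rw [mul_one_div, div_le_div_iff₀ (by linarith) (by linarith)]; linarith
  have key : |b * (1 / ((n : ℝ) + 1)) - (b - a) * (a + b) / 2| ≤
      (a + 1) * (1 / (n * ((n : ℝ) + 1))) := by
    have e1 : (1 : ℝ) / (n * ((n : ℝ) + 1)) = 1 / n * (1 / (n + 1)) := by field_simp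
    rw [add_mul, one_mul, e1]
    rw [e1] at hn'
    set p := 1 / ((n : ℝ) + 1)
    set q := 1 / (n : ℝ)
    rw [abs_le]
    constructor <;> nlinarith
  have e : ∑ k ∈ Icc 1 n, Real.log k / (k : ℝ) + b / ((n + 1 : ℕ) : ℝ) - b ^ 2 / 2 -
      (∑ k ∈ Icc 1 n, Real.log k / (k : ℝ) - a ^ 2 / 2) =
      b * (1 / ((n : ℝ) + 1)) - (b - a) * (a + b) / 2 := by rw [hb]; ring
  rw [e]
  refine key.trans ?_
  have e3 : 1 / (n * ((n : ℝ) + 1)) * √(n : ℝ) = 1 / (√(n : ℝ) * (n + 1)) := by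
    have : √(n : ℝ) * √(n : ℝ) = n := Real.mul_self_sqrt (by positivity)
    have hs : 0 < √(n : ℝ) := Real.sqrt_pos.2 (by linarith)
    rw [div_mul_eq_mul_div, div_eq_div_iff (by positivity) (by positivity)]
    linear_combination (n + 1 : ℝ) * this
  calc _ ≤ 2 * √(n : ℝ) * (1 / (n * ((n : ℝ) + 1))) := by gcongr
    _ = 2 * (1 / (√(n : ℝ) * (n + 1))) := by rw [← e3]; ring
    _ ≤ 2 * (2 / √(n : ℝ) - 2 / √((n + 1 : ℕ) : ℝ)) := by gcongr
    _ = _ := by ring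

open Finset in
lemma sum_div_eq_abel (u : ℕ → ℝ) (N : ℕ) :
    ∑ l ∈ Icc 1 N, u l / (l : ℝ) = (∑ l ∈ Icc 1 N, u l) / (N + 1) +
      ∑ n ∈ Icc 1 N, (∑ l ∈ Icc 1 n, u l) / (n * (n + 1)) := by
  induction N with
  | zero => simp
  | succ N ih =>
    rw [Finset.sum_Icc_succ_top (by omega), ih, Finset.sum_Icc_succ_top (a := 1) (b := N) (by omega) fun n =>
      (∑ l ∈ Icc 1 n, u l) / ((n : ℝ) * (n + 1)), Finset.sum_Icc_succ_top (by omega) u]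
    push_cast
    field_simp
    ring

open Finset in
lemma exists_abs_sum_card_divisors_sub_le : ∃ β C : ℝ, 0 < C ∧ ∀ N : ℕ, 1 ≤ N →
    |∑ l ∈ Icc 1 N, (l.divisors.card : ℝ) - N * (Real.log N + β)| ≤ C * √(N : ℝ) := by
  obtain ⟨γ, hγ⟩ := exists_abs_sum_inv_sub_le
  refine ⟨2 * γ - 1, 20, by positivity, fun N hN => ?_⟩
  have h1 := sum_card_divisors_mul N fun _ => (1 : ℝ)
  rw [sum_hyperbola] at h1
  set s := N.sqrt with hs
  have hs1 : 1 ≤ s := Nat.sqrt_pos.2 hN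
  have hsN : s * s ≤ N := Nat.sqrt_le N
  have hNs : N ≤ s * s + 2 * s := Nat.sqrt_le_add N |>.trans (by rw [← hs]; omega)
  have hs1R : (1 : ℝ) ≤ s := by exact_mod_cast hs1
  have hsNR : (s : ℝ) * s ≤ N := by exact_mod_cast hsN
  have hNsR : (N : ℝ) ≤ s * s + 2 * s := by exact_mod_cast hNs
  have hsq : (s : ℝ) ≤ √(N : ℝ) := Real.le_sqrt_of_sq_le (by nlinarith)
  have hfl : ∀ a ∈ Icc 1 s, |((N / a : ℕ) : ℝ) - N * (1 / a)| ≤ 1 := by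
    intro a _
    rw [← Nat.floor_div_eq_div (K := ℝ), mul_one_div, abs_sub_comm]
    have h1 := Nat.floor_le (a := (N : ℝ) / a) (by positivity)
    have h2 := Nat.lt_floor_add_one ((N : ℝ) / a)
    rw [abs_le]
    constructor <;> linarith
  have hA : |∑ a ∈ Icc 1 s, ((N / a : ℕ) : ℝ) - N * ∑ a ∈ Icc 1 s, 1 / (a : ℝ)| ≤ s := by
    rw [Finset.mul_sum, ← Finset.sum_sub_distrib]
    refine (Finset.abs_sum_le_sum_abs _ _).trans ((Finset.sum_le_sum hfl).trans ?_)
    simp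
  have hT : ∑ l ∈ Icc 1 N, (l.divisors.card : ℝ) =
      2 * ∑ a ∈ Icc 1 s, ((N / a : ℕ) : ℝ) - s * s := by
    simp only [mul_one] at h1
    rw [h1]
    have e2 : ∑ a ∈ Icc 1 s, ∑ b ∈ Ioc s (N / a), (1 : ℝ) =
        ∑ a ∈ Icc 1 s, (((N / a : ℕ) : ℝ) - s) := by
      refine Finset.sum_congr rfl fun a ha => ?_
      have h3 : s ≤ N / a := by
        rw [Nat.le_div_iff_mul_le (mem_Icc.1 ha).1]
        exact (Nat.mul_le_mul le_rfl (mem_Icc.1 ha).2).trans hsN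
      rw [Finset.sum_const, Nat.card_Ioc, nsmul_eq_mul, mul_one, Nat.cast_sub h3]
    rw [e2, Finset.sum_sub_distrib]
    simp only [Finset.sum_const, Nat.card_Icc, nsmul_eq_mul, mul_one, add_tsub_cancel_right]
    ring
  have hB := hγ s hs1
  have hNpos : (0 : ℝ) < N := by exact_mod_cast hN
  have hNs4 : (N : ℝ) * (1 / s) ≤ 3 * s := by
    rw [mul_one_div, div_le_iff₀ (by linarith)]
    nlinarith
  have hB' : |N * ∑ a ∈ Icc 1 s, 1 / (a : ℝ) - N * (Real.log s + γ)| ≤ 3 * s := by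
    rw [← mul_sub, abs_mul, abs_of_pos hNpos, ← sub_sub]
    exact (mul_le_mul_of_nonneg_left hB hNpos.le).trans hNs4
  have hlog1 : 2 * Real.log s ≤ Real.log N := by
    rw [two_mul, ← Real.log_mul (by positivity) (by positivity)]
    exact Real.log_le_log (by positivity) hsNR
  have hlog2 : N * (Real.log N - 2 * Real.log s) ≤ 6 * s := by
    rw [two_mul, ← Real.log_mul (by positivity) (by positivity),
      ← Real.log_div (by positivity) (by positivity)]
    have h4 := Real.log_le_sub_one_of_pos (x := (N : ℝ) / (s * s)) (by positivity)
    have h5 : (N : ℝ) / (s * s) - 1 ≤ 2 * (1 / s) := by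
      rw [div_sub_one (by positivity), div_le_iff₀ (by positivity)]
      have : 2 * (1 / (s : ℝ)) * (s * s) = 2 * s := by field_simp
      rw [this]
      linarith
    nlinarith [mul_le_mul_of_nonneg_left (h4.trans h5) hNpos.le]
  have hlog3 : 0 ≤ N * (Real.log N - 2 * Real.log s) := mul_nonneg hNpos.le (by linarith)
  rw [hT]
  rw [abs_le] at hA hB' ⊢
  constructor <;> nlinarith

lemma log_sq_le_sqrt {x : ℝ} (hx : 1 ≤ x) : Real.log x ^ 2 ≤ 16 * √x := by
  have h0 : (0 : ℝ) < √x := Real.sqrt_pos.2 (by linarith)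
  have h1 := Real.log_le_sub_one_of_pos (Real.sqrt_pos.2 h0)
  rw [Real.log_sqrt h0.le, Real.log_sqrt (by linarith)] at h1
  have h2 := Real.log_nonneg hx
  have h3 := Real.sq_sqrt h0.le
  have h4 : Real.log x ≤ 4 * √(√x) := by linarith
  nlinarith

/-- Passing from an integer to a real argument in the asymptotic main terms. -/
lemma abs_mul_log_poly_sub_floor_le (α β γ : ℝ) {y : ℝ} (hy : 1 ≤ y) :
    |y * (α * Real.log y ^ 2 + β * Real.log y + γ) -
      ⌊y⌋₊ * (α * Real.log ⌊y⌋₊ ^ 2 + β * Real.log ⌊y⌋₊ + γ)| ≤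
      (20 * |α| + 2 * |β| + |γ|) * √y := by
  have h1 := Nat.floor_le (zero_le_one.trans hy)
  have h2 := Nat.lt_floor_add_one y
  have h3 : (1 : ℝ) ≤ ⌊y⌋₊ := by exact_mod_cast (Nat.one_le_floor_iff y).2 hy
  have hs : 1 ≤ √y := Real.one_le_sqrt.2 hy
  have hl := log_add_one_le_two_mul_sqrt hy
  have hl2 := log_sq_le_sqrt hy
  set N : ℝ := (⌊y⌋₊ : ℝ)
  have hlogN := Real.log_nonneg h3
  have hNy : Real.log N ≤ Real.log y := Real.log_le_log (by linarith) h1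
  have hd : N * (Real.log y - Real.log N) ≤ 1 := by
    rw [← Real.log_div (by linarith) (by linarith)]
    have := Real.log_le_sub_one_of_pos (x := y / N) (by positivity)
    have h5 : N * (y / N) = y := by field_simp
    nlinarith
  have hd0 : 0 ≤ N * (Real.log y - Real.log N) := mul_nonneg (by linarith) (by linarith)
  set a := Real.log y
  set b := Real.log N
  have hA : |y * a ^ 2 - N * b ^ 2| ≤ 20 * √y := by
    have e : y * a ^ 2 - N * b ^ 2 = (y - N) * a ^ 2 + (N * (a - b)) * (a + b) := by ring
    rw [e, abs_of_nonneg (by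
      have : 0 ≤ y - N := by linarith
      have : 0 ≤ a + b := by linarith
      positivity)]
    have g1 : (y - N) * a ^ 2 ≤ 1 * a ^ 2 := by
      refine mul_le_mul_of_nonneg_right (by linarith) (sq_nonneg a)
    have g2 : (N * (a - b)) * (a + b) ≤ 1 * (a + b) :=
      mul_le_mul_of_nonneg_right hd (by linarith)
    linarith
  have hB : |y * a - N * b| ≤ 2 * √y := by
    have e : y * a - N * b = (y - N) * a + N * (a - b) := by ring
    rw [e, abs_of_nonneg (by
      have : 0 ≤ y - N := by linarith
      have : 0 ≤ a := by linarith
      positivity)]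
    have g1 : (y - N) * a ≤ 1 * a := mul_le_mul_of_nonneg_right (by linarith) (by linarith)
    linarith
  have hC : |y - N| ≤ √y := by
    rw [abs_of_nonneg (by linarith)]
    linarith
  have e : y * (α * a ^ 2 + β * a + γ) - N * (α * b ^ 2 + β * b + γ) =
      α * (y * a ^ 2 - N * b ^ 2) + β * (y * a - N * b) + γ * (y - N) := by ring
  rw [e]
  refine (abs_add_three _ _ _).trans ?_
  rw [abs_mul, abs_mul, abs_mul]
  nlinarith [mul_le_mul_of_nonneg_left hA (abs_nonneg α),
    mul_le_mul_of_nonneg_left hB (abs_nonneg β), mul_le_mul_of_nonneg_left hC (abs_nonneg γ)]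

open Finset in
/-- Dirichlet's divisor problem with the classical error term, and the corresponding logarithmic
sum. -/
lemma exists_abs_sum_card_divisors_floor_sub_le : ∃ β c C : ℝ, 0 < C ∧ ∀ y : ℝ, 1 ≤ y →
    |∑ l ∈ Icc 1 ⌊y⌋₊, (l.divisors.card : ℝ) - y * (Real.log y + β)| ≤ C * √y ∧
    y * |∑ l ∈ Icc 1 ⌊y⌋₊, (l.divisors.card : ℝ) / l -
      (Real.log y ^ 2 / 2 + (β + 1) * Real.log y + c)| ≤ C * √y := by
  obtain ⟨β, C₁, hC₁, h₁⟩ := exists_abs_sum_card_divisors_sub_le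
  obtain ⟨γ, hγ⟩ := exists_abs_sum_inv_sub_le
  obtain ⟨γ', hγ'⟩ := exists_abs_sum_log_div_sub_le
  set T : ℕ → ℝ := fun N => ∑ l ∈ Icc 1 N, (l.divisors.card : ℝ) with hT
  set g : ℕ → ℝ := fun n => T n / (n * (n + 1)) - (Real.log n + β) / n with hg
  set C₂ : ℝ := C₁ + 2 + |β| with hC₂
  have hC₂0 : 0 < C₂ := by positivity
  have hgb : ∀ n : ℕ, 1 ≤ n → |g n| ≤ C₂ * (1 / (√(n : ℝ) * (n + 1))) := by
    intro n hn
    have hn1 : (1 : ℝ) ≤ n := by exact_mod_cast hn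
    have hn0 : (0 : ℝ) < n := by linarith
    have hs : 1 ≤ √(n : ℝ) := Real.one_le_sqrt.2 hn1
    have hlog := log_add_one_le_two_mul_sqrt hn1
    have hlog0 := Real.log_nonneg hn1
    have e : g n = (1 / ((n : ℝ) * (n + 1))) * ((T n - n * (Real.log n + β)) - Real.log n - β) := by
      rw [hg]
      field_simp
      ring
    have e2 : 1 / ((n : ℝ) * (n + 1)) * √(n : ℝ) = 1 / (√(n : ℝ) * (n + 1)) := by
      have : √(n : ℝ) * √(n : ℝ) = n := Real.mul_self_sqrt (by positivity)
      rw [div_mul_eq_mul_div, div_eq_div_iff (by positivity) (by positivity)]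
      linear_combination (n + 1 : ℝ) * this
    rw [e, abs_mul, abs_of_pos (by positivity), ← e2]
    have h3 : |(T n - n * (Real.log n + β)) - Real.log n - β| ≤ C₂ * √(n : ℝ) := by
      refine (abs_sub _ _).trans ((add_le_add (abs_sub _ _) le_rfl).trans ?_)
      rw [abs_of_nonneg hlog0, hC₂]
      have := h₁ n hn
      have h6 : |β| ≤ |β| * √(n : ℝ) := le_mul_of_one_le_right (abs_nonneg β) hs
      have h7 : |T n - n * (Real.log n + β)| ≤ C₁ * √(n : ℝ) := this
      linarith
    calc _ ≤ 1 / ((n : ℝ) * (n + 1)) * (C₂ * √(n : ℝ)) := by gcongr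
      _ = _ := by ring
  obtain ⟨c₀, hc₀⟩ := exists_abs_sub_le_of_abs_succ_sub_le (h := fun n => C₂ * (2 / √(n : ℝ)))
    (S := fun N => ∑ n ∈ Icc 1 N, g n) (fun n _ => by positivity) (fun n hn => by
      rw [Finset.sum_Icc_succ_top (by omega), add_sub_cancel_left, ← mul_sub]
      refine (hgb (n + 1) (by omega)).trans (mul_le_mul_of_nonneg_left ?_ hC₂0.le)
      refine le_trans ?_ (inv_sqrt_mul_le hn)
      have hn1 : (1 : ℝ) ≤ n := by exact_mod_cast hn
      have hs : 1 ≤ √(n : ℝ) := Real.one_le_sqrt.2 hn1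
      gcongr
      · exact_mod_cast Nat.le_succ n
      · exact_mod_cast Nat.le_succ n)
  set c := γ' + β * γ + c₀ + β with hc
  have hbound : ∀ N : ℕ, 1 ≤ N → N * |∑ l ∈ Icc 1 N, (l.divisors.card : ℝ) / l -
      (Real.log N ^ 2 / 2 + (β + 1) * Real.log N + c)| ≤
      (C₁ + 4 + 3 * |β| + 2 + 2 * C₂) * √(N : ℝ) := by
    intro N hN
    have hn1 : (1 : ℝ) ≤ N := by exact_mod_cast hN
    have hn0 : (0 : ℝ) < N := by linarith
    have hs : 1 ≤ √(N : ℝ) := Real.one_le_sqrt.2 hn1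
    have hss : √(N : ℝ) * √(N : ℝ) = N := Real.mul_self_sqrt (by positivity)
    have hlog := log_add_one_le_two_mul_sqrt hn1
    have hlog0 := Real.log_nonneg hn1
    have e1 : ∑ n ∈ Icc 1 N, T n / (n * (n + 1)) =
        ∑ n ∈ Icc 1 N, Real.log n / (n : ℝ) + β * ∑ n ∈ Icc 1 N, 1 / (n : ℝ) + ∑ n ∈ Icc 1 N, g n := by
      rw [Finset.mul_sum, ← Finset.sum_add_distrib, ← Finset.sum_add_distrib]
      refine Finset.sum_congr rfl fun n _ => ?_
      rw [hg]
      ring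
    rw [sum_div_eq_abel, e1]
    have i1 := hγ' N hN
    have i2 := hγ N hN
    have i3 := hc₀ N hN
    have i4 := h₁ N hN
    have i5 : N * |(∑ l ∈ Icc 1 N, (l.divisors.card : ℝ)) / (N + 1) - (Real.log N + β)| ≤
        (C₁ + 2 + |β|) * √(N : ℝ) := by
      have e : (∑ l ∈ Icc 1 N, (l.divisors.card : ℝ)) / (N + 1) - (Real.log N + β) =
          1 / ((N : ℝ) + 1) * ((∑ l ∈ Icc 1 N, (l.divisors.card : ℝ) - N * (Real.log N + β)) -
            Real.log N - β) := by
        field_simp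
        ring
      rw [e, abs_mul, abs_of_pos (by positivity), ← mul_assoc]
      have h3 : |(∑ l ∈ Icc 1 N, (l.divisors.card : ℝ) - N * (Real.log N + β)) - Real.log N - β| ≤
          (C₁ + 2 + |β|) * √(N : ℝ) := by
        refine (abs_sub _ _).trans ((add_le_add (abs_sub _ _) le_rfl).trans ?_)
        rw [abs_of_nonneg hlog0]
        have h6 : |β| ≤ |β| * √(N : ℝ) := le_mul_of_one_le_right (abs_nonneg β) hs
        linarith
      refine le_trans (mul_le_of_le_one_left (abs_nonneg _) ?_) h3
      rw [mul_one_div, div_le_one (by positivity)]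
      linarith
    have e : (∑ l ∈ Icc 1 N, (l.divisors.card : ℝ)) / (N + 1) +
        (∑ n ∈ Icc 1 N, Real.log n / (n : ℝ) + β * ∑ n ∈ Icc 1 N, 1 / (n : ℝ) + ∑ n ∈ Icc 1 N, g n) -
        (Real.log N ^ 2 / 2 + (β + 1) * Real.log N + c) =
        ((∑ l ∈ Icc 1 N, (l.divisors.card : ℝ)) / (N + 1) - (Real.log N + β)) +
        (∑ n ∈ Icc 1 N, Real.log n / (n : ℝ) - Real.log N ^ 2 / 2 - γ') +
        β * (∑ n ∈ Icc 1 N, 1 / (n : ℝ) - Real.log N - γ) + (∑ n ∈ Icc 1 N, g n - c₀) := by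
      rw [hc]
      ring
    rw [e]
    have j1 : N * |∑ n ∈ Icc 1 N, Real.log n / (n : ℝ) - Real.log N ^ 2 / 2 - γ'| ≤ 4 * √(N : ℝ) := by
      refine (mul_le_mul_of_nonneg_left i1 hn0.le).trans (le_of_eq ?_)
      field_simp
      linarith
    have j2 : N * |∑ n ∈ Icc 1 N, 1 / (n : ℝ) - Real.log N - γ| ≤ √(N : ℝ) := by
      refine (mul_le_mul_of_nonneg_left i2 hn0.le).trans ?_
      rw [mul_one_div_cancel hn0.ne']
      exact hs
    have j3 : N * |∑ n ∈ Icc 1 N, g n - c₀| ≤ 2 * C₂ * √(N : ℝ) := by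
      refine (mul_le_mul_of_nonneg_left i3 hn0.le).trans (le_of_eq ?_)
      field_simp
      linarith
    have j4 := (abs_add_le _ _).trans (add_le_add (abs_add_three
      ((∑ l ∈ Icc 1 N, (l.divisors.card : ℝ)) / (N + 1) - (Real.log N + β))
      (∑ n ∈ Icc 1 N, Real.log n / (n : ℝ) - Real.log N ^ 2 / 2 - γ')
      (β * (∑ n ∈ Icc 1 N, 1 / (n : ℝ) - Real.log N - γ))) (le_refl |∑ n ∈ Icc 1 N, g n - c₀|))
    rw [abs_mul β] at j4
    have j5 := mul_le_mul_of_nonneg_left j4 hn0.le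
    have j6 := mul_le_mul_of_nonneg_left j2 (abs_nonneg β)
    have j7 : 0 ≤ √(N : ℝ) * |β| := by positivity
    linarith
  refine ⟨β, c, max (C₁ + (20 * |0| + 2 * |1| + |β|))
    (2 * ((C₁ + 4 + 3 * |β| + 2 + 2 * C₂) + 4 + 2 * |β + 1|)), by positivity, fun y hy => ⟨?_, ?_⟩⟩
  · have a1 := h₁ ⌊y⌋₊ ((Nat.one_le_floor_iff y).2 hy)
    have a2 := abs_mul_log_poly_sub_floor_le 0 1 β hy
    have a3 : √((⌊y⌋₊ : ℕ) : ℝ) ≤ √y := Real.sqrt_le_sqrt (Nat.floor_le (zero_le_one.trans hy))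
    refine le_trans ?_ (mul_le_mul_of_nonneg_right (le_max_left _ _) (Real.sqrt_nonneg y))
    rw [abs_le] at a1 a2 ⊢
    have a4 := mul_le_mul_of_nonneg_left a3 hC₁.le
    constructor <;> linarith
  · have hN1 := (Nat.one_le_floor_iff y).2 hy
    have a1 := hbound ⌊y⌋₊ hN1
    have a3 : √((⌊y⌋₊ : ℕ) : ℝ) ≤ √y := Real.sqrt_le_sqrt (Nat.floor_le (zero_le_one.trans hy))
    refine le_trans ?_ (mul_le_mul_of_nonneg_right (le_max_right _ _) (Real.sqrt_nonneg y))
    have b1 := Nat.floor_le (zero_le_one.trans hy)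
    have b2 := Nat.lt_floor_add_one y
    have b3 : (1 : ℝ) ≤ ⌊y⌋₊ := by exact_mod_cast hN1
    have hs : 1 ≤ √y := Real.one_le_sqrt.2 hy
    have hlog := log_add_one_le_two_mul_sqrt hy
    set S := ∑ l ∈ Icc 1 ⌊y⌋₊, (l.divisors.card : ℝ) / l
    set K := C₁ + 4 + 3 * |β| + 2 + 2 * C₂
    have hK : 0 ≤ K := by positivity
    set N : ℝ := (⌊y⌋₊ : ℝ)
    have hlogN := Real.log_nonneg b3
    have hNy : Real.log N ≤ Real.log y := Real.log_le_log (by linarith) b1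
    have hd : N * (Real.log y - Real.log N) ≤ 1 := by
      rw [← Real.log_div (by linarith) (by linarith)]
      have := Real.log_le_sub_one_of_pos (x := y / N) (by positivity)
      have h5 : N * (y / N) = y := by field_simp
      nlinarith
    set a := Real.log y
    set b := Real.log N
    have e : S - (a ^ 2 / 2 + (β + 1) * a + c) =
        (S - (b ^ 2 / 2 + (β + 1) * b + c)) - (a - b) * ((a + b) / 2 + (β + 1)) := by ring
    have h8 : |(a - b) * ((a + b) / 2 + (β + 1))| ≤ (a - b) * (2 * √y + |β + 1|) := by
      rw [abs_mul, abs_of_nonneg (by linarith : 0 ≤ a - b)]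
      refine mul_le_mul_of_nonneg_left ((abs_add_le _ _).trans ?_) (by linarith)
      rw [abs_of_nonneg (by linarith : 0 ≤ (a + b) / 2)]
      linarith
    have h9 : N * |S - (a ^ 2 / 2 + (β + 1) * a + c)| ≤ (K + 2 + |β + 1|) * √y := by
      rw [e]
      have g1 := mul_le_mul_of_nonneg_left ((abs_sub (S - (b ^ 2 / 2 + (β + 1) * b + c))
        ((a - b) * ((a + b) / 2 + (β + 1)))).trans (add_le_add le_rfl h8)) (by linarith : 0 ≤ N)
      have g2 : N * (a - b) * (2 * √y + |β + 1|) ≤ 1 * (2 * √y + |β + 1|) :=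
        mul_le_mul_of_nonneg_right hd (by positivity)
      have g3 := mul_le_mul_of_nonneg_left a3 hK
      have g4 : |β + 1| ≤ |β + 1| * √y := le_mul_of_one_le_right (abs_nonneg _) hs
      linarith
    have h10 : y * |S - (a ^ 2 / 2 + (β + 1) * a + c)| ≤
        2 * (N * |S - (a ^ 2 / 2 + (β + 1) * a + c)|) := by
      rw [← mul_assoc]
      exact mul_le_mul_of_nonneg_right (by linarith) (abs_nonneg _)
    nlinarith [abs_nonneg (β + 1)]

open Finset in
/-- Dirichlet's hyperbola method with an arbitrary splitting point `K`. -/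
lemma sum_hyperbola_split {N K : ℕ} (hK : 1 ≤ K) (hKN : K ≤ N) (g : ℕ → ℝ) :
    ∑ c ∈ Icc 1 N, ∑ l ∈ Icc 1 (N / c), g l =
      ∑ c ∈ Icc 1 K, ∑ l ∈ Icc 1 (N / c), g l +
        ∑ l ∈ Icc 1 (N / K), g l * (((N / l : ℕ) : ℝ) - K) := by
  have h1 : ∑ c ∈ Icc 1 N, ∑ l ∈ Icc 1 (N / c), g l =
      ∑ c ∈ Icc 1 K, ∑ l ∈ Icc 1 (N / c), g l + ∑ c ∈ Ioc K N, ∑ l ∈ Icc 1 (N / c), g l := by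
    rw [← Finset.Ico_add_one_right_eq_Icc, ← Finset.Ico_add_one_right_eq_Icc 1 K,
      ← Finset.Ico_add_one_add_one_eq_Ioc, Finset.sum_Ico_consecutive _ (by omega) (by omega)]
  rw [h1]
  congr 1
  have h2 : ∑ c ∈ Ioc K N, ∑ l ∈ Icc 1 (N / c), g l =
      ∑ c ∈ Ioc K N, ∑ l ∈ Icc 1 N, if c * l ≤ N then g l else 0 :=
    Finset.sum_congr rfl fun c hc => sum_Icc_div_eq_sum_ite le_rfl
      (by have := (mem_Ioc.1 hc).1; omega) _
  rw [h2, Finset.sum_comm, ← Finset.sum_subset (Icc_subset_Icc le_rfl (Nat.div_le_self N K))]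
  · refine Finset.sum_congr rfl fun l hl => ?_
    obtain ⟨l1, l2⟩ := mem_Icc.1 hl
    have h3 : K ≤ N / l := by
      rw [Nat.le_div_iff_mul_le l1, mul_comm]
      rwa [Nat.le_div_iff_mul_le hK] at l2
    rw [← Finset.sum_filter, Finset.sum_const, nsmul_eq_mul, mul_comm]
    congr 1
    rw [← Nat.cast_sub h3, ← Nat.card_Ioc]
    congr 2
    ext c
    simp only [mem_filter, mem_Ioc, Nat.le_div_iff_mul_le l1]
    constructor
    · rintro ⟨⟨g1, -⟩, g2⟩
      exact ⟨g1, g2⟩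
    · rintro ⟨g1, g2⟩
      exact ⟨⟨g1, by nlinarith⟩, g2⟩
  · intro l hl hl'
    refine Finset.sum_eq_zero fun c hc => if_neg fun hcl => hl' ?_
    refine mem_Icc.2 ⟨(mem_Icc.1 hl).1, ?_⟩
    rw [Nat.le_div_iff_mul_le hK]
    have := (mem_Ioc.1 hc).1
    nlinarith

open Finset in
lemma sum_inv_sqrt_le (K : ℕ) : ∑ c ∈ Icc 1 K, 1 / √(c : ℝ) ≤ 2 * √(K : ℝ) := by
  induction K with
  | zero => simp
  | succ n ih =>
    rw [Finset.sum_Icc_succ_top (by omega)]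
    have h1 : √((n + 1 : ℕ) : ℝ) ^ 2 = n + 1 := by rw [Real.sq_sqrt (by positivity)]; push_cast; ring
    have h2 : √(n : ℝ) ^ 2 = n := Real.sq_sqrt (by positivity)
    have h3 : 0 < √((n + 1 : ℕ) : ℝ) := Real.sqrt_pos.2 (by positivity)
    have h4 : 1 / √((n + 1 : ℕ) : ℝ) ≤ 2 * √((n + 1 : ℕ) : ℝ) - 2 * √(n : ℝ) := by
      rw [div_le_iff₀ h3]
      nlinarith [sq_nonneg (√((n + 1 : ℕ) : ℝ) - √(n : ℝ))]
    linarith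

set_option maxHeartbeats 800000 in
open Finset in
lemma exists_abs_sum_d3_sub_le : ∃ β γ C : ℝ, 0 < C ∧ ∀ N : ℕ, 1 ≤ N →
    |∑ m ∈ Icc 1 N, (d3 m : ℝ) - N * (1 / 2 * Real.log N ^ 2 + β * Real.log N + γ)| ≤
      C * √(√(N : ℝ)) ^ 3 := by
  obtain ⟨β, c₀, C, hC, hT⟩ := exists_abs_sum_card_divisors_floor_sub_le
  obtain ⟨γ, hγ⟩ := exists_abs_sum_inv_sub_le
  obtain ⟨γ', hγ'⟩ := exists_abs_sum_log_div_sub_le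
  refine ⟨γ + β, β * γ - γ' + c₀ - β, 2 * C + 3 * (4 + |β|) + 12 + (3 * (4 + |β|) + 2 * C) + 4 * C,
    by positivity, fun N hN => ?_⟩
  set K := N.sqrt with hs
  set q := √(√(N : ℝ)) with hq
  set ℓ := Real.log N with hℓ
  set κ := Real.log K with hκ
  have hK1 : 1 ≤ K := Nat.sqrt_pos.2 hN
  have hKN : K * K ≤ N := Nat.sqrt_le N
  have hNK : N ≤ K * K + 2 * K := Nat.sqrt_le_add N |>.trans (by rw [← hs]; omega)
  have hK1R : (1 : ℝ) ≤ K := by exact_mod_cast hK1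
  have hKNR : (K : ℝ) * K ≤ N := by exact_mod_cast hKN
  have hNKR : (N : ℝ) ≤ K * K + 2 * K := by exact_mod_cast hNK
  have hN1 : (1 : ℝ) ≤ N := by exact_mod_cast hN
  have hNpos : (0 : ℝ) < N := by linarith
  have hKpos : (0 : ℝ) < K := by linarith
  have hsN1 : 1 ≤ √(N : ℝ) := Real.one_le_sqrt.2 hN1
  have hq1 : 1 ≤ q := Real.one_le_sqrt.2 hsN1
  have hq2 : q ^ 2 = √(N : ℝ) := Real.sq_sqrt (Real.sqrt_nonneg _)
  have hKq : (K : ℝ) ≤ q ^ 2 := hq2 ▸ Real.le_sqrt_of_sq_le (by nlinarith)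
  have hsKq : √(K : ℝ) ≤ q := Real.sqrt_le_iff.2 ⟨by linarith, hKq⟩
  have hsK : √(K : ℝ) * √(K : ℝ) = K := Real.mul_self_sqrt hKpos.le
  have hsK1 : 1 ≤ √(K : ℝ) := Real.one_le_sqrt.2 hK1R
  have hℓ0 : 0 ≤ ℓ := Real.log_nonneg hN1
  have hκ0 : 0 ≤ κ := Real.log_nonneg hK1R
  have hℓq : ℓ ≤ 4 * q := by
    have h1 := log_add_one_le_two_mul_sqrt hsN1
    rw [Real.log_sqrt hNpos.le] at h1
    linarith
  have hlβ : ℓ + |β| ≤ (4 + |β|) * q := by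
    have : |β| ≤ |β| * q := le_mul_of_one_le_right (abs_nonneg β) hq1
    linarith
  set x : ℝ := N / K with hx
  have hKx : K * x = N := by rw [hx]; field_simp
  have hx1 : 1 ≤ x := by
    rw [hx, one_le_div hKpos]; nlinarith
  have hx3 : x ≤ 3 * K := by
    rw [hx, div_le_iff₀ hKpos]; nlinarith
  have hsx : √x ≤ 2 * √(K : ℝ) := by
    rw [Real.sqrt_le_iff]
    exact ⟨by positivity, by nlinarith⟩
  have hlx : Real.log x = ℓ - κ := by rw [hx, Real.log_div hNpos.ne' hKpos.ne']
  have hlx0 : 0 ≤ Real.log x := Real.log_nonneg hx1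
  have hKsx : K * √x ≤ 2 * q ^ 3 := by
    calc K * √x ≤ q ^ 2 * (2 * q) := by
          gcongr
          exact hsx.trans (by linarith)
      _ = 2 * q ^ 3 := by ring
  -- the sum over `c ≤ K`
  have hA : |∑ c ∈ Icc 1 K, ∑ l ∈ Icc 1 (N / c), (l.divisors.card : ℝ) -
      N * ((ℓ + β) * ∑ c ∈ Icc 1 K, 1 / (c : ℝ) - ∑ c ∈ Icc 1 K, Real.log c / c)| ≤
      2 * C * q ^ 3 := by
    have e : N * ((ℓ + β) * ∑ c ∈ Icc 1 K, 1 / (c : ℝ) - ∑ c ∈ Icc 1 K, Real.log c / c) =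
        ∑ c ∈ Icc 1 K, (N : ℝ) / c * (Real.log ((N : ℝ) / c) + β) := by
      rw [Finset.mul_sum, ← Finset.sum_sub_distrib, Finset.mul_sum]
      refine Finset.sum_congr rfl fun c hc => ?_
      have : (c : ℝ) ≠ 0 := by
        have := (mem_Icc.1 hc).1
        positivity
      rw [Real.log_div hNpos.ne' this]
      ring
    rw [e, ← Finset.sum_sub_distrib]
    have hterm : ∀ c ∈ Icc 1 K, |∑ l ∈ Icc 1 (N / c), (l.divisors.card : ℝ) -
        (N : ℝ) / c * (Real.log ((N : ℝ) / c) + β)| ≤ C * (√(N : ℝ) * (1 / √(c : ℝ))) := by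
      intro c hc
      obtain ⟨hc1, hc2⟩ := mem_Icc.1 hc
      have hc0 : (0 : ℝ) < c := by exact_mod_cast hc1
      have := (hT ((N : ℝ) / c) (by
        rw [one_le_div hc0]
        have : (c : ℝ) ≤ K := by exact_mod_cast hc2
        nlinarith)).1
      rw [Nat.floor_div_eq_div, Real.sqrt_div hNpos.le, div_eq_mul_one_div √(N : ℝ)] at this
      exact this
    refine (Finset.abs_sum_le_sum_abs _ _).trans ((Finset.sum_le_sum hterm).trans ?_)
    rw [← Finset.mul_sum, ← Finset.mul_sum, ← hq2]
    calc C * (q ^ 2 * ∑ c ∈ Icc 1 K, 1 / √(c : ℝ)) ≤ C * (q ^ 2 * (2 * q)) := by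
          gcongr
          exact (sum_inv_sqrt_le K).trans (by linarith)
      _ = _ := by ring
  have hNK' : (N : ℝ) * (1 / K) ≤ 3 * q ^ 2 := by rw [mul_one_div, ← hx]; linarith
  have hA1 : |N * (ℓ + β) * (∑ c ∈ Icc 1 K, 1 / (c : ℝ) - κ - γ)| ≤ 3 * (4 + |β|) * q ^ 3 := by
    have h1 : |ℓ + β| ≤ (4 + |β|) * q := by
      refine (abs_add_le _ _).trans ?_
      rwa [abs_of_nonneg hℓ0]
    rw [abs_mul, abs_mul, abs_of_pos hNpos]
    calc _ ≤ N * ((4 + |β|) * q) * (1 / K) := by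
          gcongr
          exact hγ K hK1
      _ = ((4 + |β|) * q) * (N * (1 / K)) := by ring
      _ ≤ ((4 + |β|) * q) * (3 * q ^ 2) := mul_le_mul_of_nonneg_left hNK' (by positivity)
      _ = _ := by ring
  have hA2 : |N * (∑ c ∈ Icc 1 K, Real.log c / c - κ ^ 2 / 2 - γ')| ≤ 12 * q ^ 3 := by
    rw [abs_mul, abs_of_pos hNpos]
    calc _ ≤ N * (4 / √(K : ℝ)) := by
          gcongr
          exact hγ' K hK1
      _ = 4 * √(K : ℝ) * (N * (1 / K)) := by
          have e : 1 / (K : ℝ) = 1 / (√(K : ℝ) * √(K : ℝ)) := by rw [hsK]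
          rw [e]
          field_simp
      _ ≤ 4 * q * (3 * q ^ 2) := mul_le_mul (by linarith) hNK' (by positivity) (by positivity)
      _ = _ := by ring
  -- the complementary sum
  have hxfl : N / K = ⌊x⌋₊ := by rw [hx, Nat.floor_div_eq_div]
  obtain ⟨t1, t2⟩ := hT x hx1
  rw [← hxfl] at t1 t2
  set T := ∑ l ∈ Icc 1 (N / K), (l.divisors.card : ℝ) with hTdef
  set L := ∑ l ∈ Icc 1 (N / K), (l.divisors.card : ℝ) / l with hLdef
  have hT0 : 0 ≤ T := Finset.sum_nonneg fun _ _ => by positivity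
  have hTle : T ≤ (3 * (4 + |β|) + 2 * C) * q ^ 3 := by
    have h1 := (abs_le.1 t1).2
    have h2 : x * (Real.log x + β) ≤ 3 * K * ((4 + |β|) * q) := by
      have : Real.log x + β ≤ (4 + |β|) * q := by
        have := le_abs_self β
        linarith
      calc _ ≤ x * ((4 + |β|) * q) := by gcongr
        _ ≤ _ := by gcongr
    have h3 : 3 * K * ((4 + |β|) * q) ≤ 3 * q ^ 2 * ((4 + |β|) * q) := by gcongr
    have h4 : √x ≤ 2 * q ^ 3 := (le_mul_of_one_le_left (Real.sqrt_nonneg x) hK1R).trans hKsx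
    have h5 := mul_le_mul_of_nonneg_left h4 hC.le
    linarith
  have hB : |∑ l ∈ Icc 1 (N / K), (l.divisors.card : ℝ) * (((N / l : ℕ) : ℝ) - K) -
      (N * L - K * T)| ≤ (3 * (4 + |β|) + 2 * C) * q ^ 3 := by
    refine le_trans ?_ hTle
    rw [hLdef, hTdef, Finset.mul_sum, Finset.mul_sum, ← Finset.sum_sub_distrib,
      ← Finset.sum_sub_distrib]
    refine (Finset.abs_sum_le_sum_abs _ _).trans (Finset.sum_le_sum fun l hl => ?_)
    have e : (l.divisors.card : ℝ) * (((N / l : ℕ) : ℝ) - K) -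
        (N * ((l.divisors.card : ℝ) / l) - K * l.divisors.card) =
        l.divisors.card * (((N / l : ℕ) : ℝ) - N / l) := by ring
    rw [e, abs_mul, Nat.abs_cast]
    refine mul_le_of_le_one_right (by positivity) ?_
    rw [← Nat.floor_div_eq_div (K := ℝ), abs_sub_comm]
    have h1 := Nat.floor_le (a := (N : ℝ) / l) (by positivity)
    have h2 := Nat.lt_floor_add_one ((N : ℝ) / l)
    rw [abs_le]
    constructor <;> linarith
  have hL : |N * (L - (Real.log x ^ 2 / 2 + (β + 1) * Real.log x + c₀))| ≤ 2 * C * q ^ 3 := by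
    rw [abs_mul, abs_of_pos hNpos, ← hKx, mul_assoc]
    calc _ ≤ K * (C * √x) := by gcongr
      _ = C * (K * √x) := by ring
      _ ≤ C * (2 * q ^ 3) := by gcongr
      _ = _ := by ring
  have hKT : |K * (T - x * (Real.log x + β))| ≤ 2 * C * q ^ 3 := by
    rw [abs_mul, abs_of_pos hKpos]
    calc _ ≤ K * (C * √x) := by gcongr
      _ = C * (K * √x) := by ring
      _ ≤ C * (2 * q ^ 3) := by gcongr
      _ = _ := by ring
  have h1 := sum_d3_mul N fun _ => (1 : ℝ)
  simp only [mul_one] at h1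
  rw [h1, sum_hyperbola_split hK1 (by nlinarith : K ≤ N)]
  have hKT' : K * (T - x * (Real.log x + β)) = K * T - N * (Real.log x + β) := by
    rw [← hKx]; ring
  rw [hKT'] at hKT
  rw [hlx] at hL hKT
  rw [abs_le] at hA hA1 hA2 hB hL hKT ⊢
  obtain ⟨u1, v1⟩ := hA
  obtain ⟨u2, v2⟩ := hA1
  obtain ⟨u3, v3⟩ := hA2
  obtain ⟨u4, v4⟩ := hB
  obtain ⟨u5, v5⟩ := hL
  obtain ⟨u6, v6⟩ := hKT
  constructor <;> linarith

open Finset in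
/-- The Piltz divisor problem for `d₃`, with an elementary error term. -/
lemma exists_abs_sum_d3_floor_sub_le : ∃ β γ C : ℝ, 0 < C ∧ ∀ y : ℝ, 0 < y →
    |∑ m ∈ Icc 1 ⌊y⌋₊, (d3 m : ℝ) - y * (1 / 2 * Real.log y ^ 2 + β * Real.log y + γ)| ≤
      C * y ^ (3 / 4 : ℝ) := by
  obtain ⟨β, γ, C, hC, h⟩ := exists_abs_sum_d3_sub_le
  refine ⟨β, γ, max (C + (20 * |1 / 2| + 2 * |β| + |γ|)) (32 + 4 * |β| + |γ|), by positivity,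
    fun y hy => ?_⟩
  have hq : √(√y) ^ 3 = y ^ (3 / 4 : ℝ) := by
    rw [Real.sqrt_eq_rpow, Real.sqrt_eq_rpow, ← Real.rpow_mul hy.le, ← Real.rpow_natCast,
      ← Real.rpow_mul hy.le]
    norm_num
  rw [← hq]
  rcases le_or_gt 1 y with hy1 | hy1
  · refine le_trans ?_ (mul_le_mul_of_nonneg_right (le_max_left _ _) (by positivity))
    have a1 := h ⌊y⌋₊ ((Nat.one_le_floor_iff y).2 hy1)
    have a2 := abs_mul_log_poly_sub_floor_le (1 / 2) β γ hy1
    have a3 : √(√((⌊y⌋₊ : ℕ) : ℝ)) ≤ √(√y) :=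
      Real.sqrt_le_sqrt (Real.sqrt_le_sqrt (Nat.floor_le hy.le))
    have a4 : √(√((⌊y⌋₊ : ℕ) : ℝ)) ^ 3 ≤ √(√y) ^ 3 := by gcongr
    have a5 : √y ≤ √(√y) ^ 3 := by
      have h1 : 1 ≤ √(√y) := Real.one_le_sqrt.2 (Real.one_le_sqrt.2 hy1)
      have h2 : √(√y) ^ 2 = √y := Real.sq_sqrt (Real.sqrt_nonneg _)
      nlinarith
    have a6 := mul_le_mul_of_nonneg_left a4 hC.le
    have a7 := mul_le_mul_of_nonneg_left a5 (by positivity : 0 ≤ 20 * |(1 / 2 : ℝ)| + 2 * |β| + |γ|)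
    rw [abs_le] at a1 a2 ⊢
    constructor <;> linarith
  · refine le_trans ?_ (mul_le_mul_of_nonneg_right (le_max_right _ _) (by positivity))
    rw [Nat.floor_eq_zero.2 hy1]
    simp only [Order.lt_one_iff, Icc_eq_empty_of_lt, sum_empty, zero_sub, abs_neg]
    have h0 : 0 < √y := Real.sqrt_pos.2 hy
    set q := √(√y)
    have hq0 : 0 < q := Real.sqrt_pos.2 h0
    have hq2 : q ^ 2 = √y := Real.sq_sqrt h0.le
    have hq4 : q ^ 4 = y := by
      have : √y ^ 2 = y := Real.sq_sqrt hy.le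
      rw [← this, ← hq2]; ring
    have hqlt : q ≤ 1 := by
      have : √y ≤ 1 := Real.sqrt_le_one.2 hy1.le
      exact Real.sqrt_le_one.2 this
    have hlog : Real.log y = 4 * Real.log q := by rw [← hq4, Real.log_pow]; norm_num
    have hr : 0 < √q := Real.sqrt_pos.2 hq0
    have hlr : Real.log q = 2 * Real.log √q := by rw [Real.log_sqrt hq0.le]; ring
    have key : ∀ z : ℝ, 0 < z → z ≤ 1 → z * |Real.log z| ≤ 1 := fun z hz hz1 => by
      rw [abs_of_nonpos (Real.log_nonpos hz.le hz1)]
      have := mul_le_mul_of_nonneg_left (Real.one_sub_inv_le_log_of_pos hz) hz.le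
      rw [mul_sub, mul_inv_cancel₀ hz.ne'] at this
      linarith
    have k1 := key q hq0 hqlt
    have k2 := key √q hr (Real.sqrt_le_one.2 hqlt)
    have k3 : q * Real.log q ^ 2 ≤ 4 := by
      have : q * Real.log q ^ 2 = 4 * (√q * |Real.log √q|) ^ 2 := by
        rw [hlr, mul_pow √q, Real.sq_sqrt hq0.le, sq_abs]; ring
      rw [this]
      have := pow_le_one₀ (n := 2) (by positivity) k2
      linarith
    rw [abs_mul, abs_of_pos hy, ← hq4]
    have k4 : |1 / 2 * Real.log (q ^ 4) ^ 2 + β * Real.log (q ^ 4) + γ| ≤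
        8 * Real.log q ^ 2 + 4 * |β| * |Real.log q| + |γ| := by
      rw [hq4, hlog]
      refine (abs_add_three _ _ _).trans (le_of_eq ?_)
      rw [abs_of_nonneg (by positivity), abs_mul, abs_mul, abs_of_pos (by norm_num : (0 : ℝ) < 4)]
      ring
    calc _ ≤ q ^ 4 * (8 * Real.log q ^ 2 + 4 * |β| * |Real.log q| + |γ|) := by gcongr
      _ = (8 * (q * Real.log q ^ 2) + 4 * |β| * (q * |Real.log q|) + |γ| * q) * q ^ 3 := by ring
      _ ≤ (8 * 4 + 4 * |β| * 1 + |γ| * 1) * q ^ 3 := by gcongr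
      _ = _ := by ring

open Finset in
lemma sum_moebius_divisors {n : ℕ} :
    ∑ f ∈ n.divisors, (ArithmeticFunction.moebius f : ℝ) = if n = 1 then 1 else 0 := by
  have h := congrArg (fun F : ArithmeticFunction ℝ => F n)
    (ArithmeticFunction.coe_zeta_mul_coe_moebius (R := ℝ))
  rw [ArithmeticFunction.coe_zeta_mul_apply, ArithmeticFunction.one_apply] at h
  exact h

open Finset ArithmeticFunction in
lemma sum_moebius_gcd_indicator {q g a : ℕ} (hq : q ≠ 0) (ha : a ≠ 0) (hg : g ∣ q) :
    ∑ f ∈ q.divisors, (if f ∣ q / g then (moebius f : ℝ) else 0) *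
      (if g * f ∣ a then 1 else 0) = if q.gcd a = g then 1 else 0 := by
  by_cases hga : g ∣ a
  · obtain ⟨q', rfl⟩ := hg
    obtain ⟨a', rfl⟩ := hga
    have hg0 : 0 < g := Nat.pos_of_ne_zero (left_ne_zero_of_mul hq)
    have h1 : ∀ f ∈ (g * q').divisors, (if f ∣ g * q' / g then (moebius f : ℝ) else 0) *
        (if g * f ∣ g * a' then 1 else 0) = if f ∣ q'.gcd a' then (moebius f : ℝ) else 0 := by
      intro f _
      simp only [Nat.mul_div_cancel_left _ hg0, Nat.mul_dvd_mul_iff_left hg0, Nat.dvd_gcd_iff]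
      by_cases h1 : f ∣ q' <;> by_cases h2 : f ∣ a' <;> simp [h1, h2]
    have h2 : (g * q').divisors.filter (fun f => f ∣ q'.gcd a') = (q'.gcd a').divisors := by
      ext f
      simp only [mem_filter, Nat.mem_divisors]
      refine ⟨fun h => ⟨h.2, Nat.gcd_ne_zero_left (right_ne_zero_of_mul hq)⟩, fun h => ⟨⟨?_, hq⟩, h.1⟩⟩
      exact (h.1.trans (Nat.gcd_dvd_left _ _)).trans (dvd_mul_left _ _)
    rw [Finset.sum_congr rfl h1, ← Finset.sum_filter, h2, sum_moebius_divisors, Nat.gcd_mul_left]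
    congr 1
    simp [hg0.ne']
  · rw [if_neg (fun h : q.gcd a = g => hga (h ▸ Nat.gcd_dvd_right q a))]
    refine Finset.sum_eq_zero fun f _ => ?_
    rw [if_neg (fun h => hga ((dvd_mul_right g f).trans h)), mul_zero]

open Finset ArithmeticFunction in
/-- The indicator of `q ∣ a * l` as a combination of products of divisibility indicators. -/
lemma indicator_dvd_mul {q a : ℕ} (hq : q ≠ 0) (ha : a ≠ 0) (l : ℕ) :
    (if q ∣ a * l then (1 : ℝ) else 0) = ∑ g ∈ q.divisors, ∑ f ∈ q.divisors,
      (if f ∣ q / g then (moebius f : ℝ) else 0) * (if g * f ∣ a then 1 else 0) *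
        (if q / g ∣ l then 1 else 0) := by
  have h1 : ∀ g ∈ q.divisors, ∑ f ∈ q.divisors,
      (if f ∣ q / g then (moebius f : ℝ) else 0) * (if g * f ∣ a then 1 else 0) *
        (if q / g ∣ l then 1 else 0) = if q.gcd a = g then (if q / g ∣ l then 1 else 0) else 0 := by
    intro g hg
    rw [← Finset.sum_mul, sum_moebius_gcd_indicator hq ha (Nat.dvd_of_mem_divisors hg)]
    split_ifs <;> simp
  rw [Finset.sum_congr rfl h1, Finset.sum_ite_eq,
    if_pos (Nat.mem_divisors.2 ⟨Nat.gcd_dvd_left _ _, hq⟩)]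
  congr 1
  rw [eq_iff_iff]
  have hg : 0 < q.gcd a := Nat.gcd_pos_of_pos_left _ (Nat.pos_of_ne_zero hq)
  obtain ⟨q', a', hc, h2, h3⟩ := Nat.exists_coprime q a
  generalize q.gcd a = g at *
  subst h2 h3
  rw [Nat.mul_div_cancel _ hg, mul_comm q', mul_comm a', mul_assoc, Nat.mul_dvd_mul_iff_left hg]
  exact hc.dvd_mul_left

open Finset in
lemma sum_Icc_ite_dvd {R : Type*} [AddCommMonoid R] {u : ℕ} (hu : 0 < u) (N : ℕ) (F : ℕ → R) :
    ∑ a ∈ Icc 1 N, (if u ∣ a then F a else 0) = ∑ a ∈ Icc 1 (N / u), F (u * a) := by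
  rw [← Finset.sum_filter]
  symm
  refine Finset.sum_bij (fun a _ => u * a) ?_ ?_ ?_ ?_
  · intro a ha
    obtain ⟨h1, h2⟩ := mem_Icc.1 ha
    rw [Nat.le_div_iff_mul_le hu] at h2
    exact mem_filter.2 ⟨mem_Icc.2 ⟨Nat.mul_pos hu h1, by linarith⟩, dvd_mul_right _ _⟩
  · intro a _ b _ h
    exact Nat.eq_of_mul_eq_mul_left hu h
  · intro b hb
    obtain ⟨h1, a, rfl⟩ := mem_filter.1 hb
    obtain ⟨h2, h3⟩ := mem_Icc.1 h1
    refine ⟨a, mem_Icc.2 ⟨Nat.pos_of_mul_pos_left h2, ?_⟩, rfl⟩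
    rw [Nat.le_div_iff_mul_le hu]
    linarith
  · intro _ _
    rfl

open Finset in
lemma sum_Icc_ite_dvd_div {u v : ℕ} (hu : 0 < u) (N : ℕ) (S : ℕ → ℝ) (hS : S 0 = 0) :
    ∑ c ∈ Icc 1 N, (if u ∣ c then S (N / c / v) else 0) =
      ∑ c ∈ Icc 1 (N / (u * v)), S (N / (u * v) / c) := by
  rw [sum_Icc_ite_dvd hu, ← Nat.div_div_eq_div_mul]
  have h1 : ∀ c, N / (u * c) / v = N / u / v / c := fun c => by
    rw [Nat.div_div_eq_div_mul, Nat.div_div_eq_div_mul, Nat.div_div_eq_div_mul]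
    congr 1; ring
  simp only [h1]
  symm
  refine Finset.sum_subset (Icc_subset_Icc le_rfl (Nat.div_le_self _ _)) fun c hc hc' => ?_
  rw [Nat.div_eq_of_lt, hS]
  by_contra h
  exact hc' (mem_Icc.2 ⟨(mem_Icc.1 hc).1, not_lt.1 h⟩)

open Finset ArithmeticFunction in
lemma sum_card_divisors_ite_dvd {q : ℕ} (hq : q ≠ 0) (X : ℕ) :
    ∑ l ∈ Icc 1 X, (if q ∣ l then (l.divisors.card : ℝ) else 0) =
      ∑ g ∈ q.divisors, ∑ f ∈ q.divisors, (if f ∣ q / g then (moebius f : ℝ) else 0) *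
        ∑ l ∈ Icc 1 (X / (g * f * (q / g))), (l.divisors.card : ℝ) := by
  have h0 : ∀ Y : ℕ, ∑ l ∈ Icc 1 Y, (l.divisors.card : ℝ) =
      ∑ a ∈ Icc 1 Y, ((Y / a : ℕ) : ℝ) := fun Y => by
    have := sum_card_divisors_mul Y fun _ => (1 : ℝ)
    simpa using this
  have h1 := sum_card_divisors_mul X fun l => if q ∣ l then (1 : ℝ) else 0
  simp only [mul_ite, mul_one, mul_zero] at h1
  rw [h1]
  have h2 : ∀ a ∈ Icc 1 X, ∑ b ∈ Icc 1 (X / a), (if q ∣ a * b then (1 : ℝ) else 0) =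
      ∑ g ∈ q.divisors, ∑ f ∈ q.divisors, (if f ∣ q / g then (moebius f : ℝ) else 0) *
        (if g * f ∣ a then ((X / a / (q / g) : ℕ) : ℝ) else 0) := by
    intro a ha
    rw [Finset.sum_congr rfl fun b _ =>
      indicator_dvd_mul hq (Nat.pos_iff_ne_zero.1 (mem_Icc.1 ha).1) b, Finset.sum_comm]
    refine Finset.sum_congr rfl fun g hg => ?_
    rw [Finset.sum_comm]
    refine Finset.sum_congr rfl fun f _ => ?_
    have hqg : 0 < q / g := Nat.div_pos (Nat.divisor_le hg) (Nat.pos_of_mem_divisors hg)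
    rw [← Finset.mul_sum, sum_Icc_ite_dvd hqg]
    simp only [sum_const, Nat.card_Icc, add_tsub_cancel_right, nsmul_eq_mul, mul_one]
    rw [mul_assoc]
    congr 1
    split_ifs <;> simp
  rw [Finset.sum_congr rfl h2, Finset.sum_comm]
  refine Finset.sum_congr rfl fun g hg => ?_
  rw [Finset.sum_comm]
  refine Finset.sum_congr rfl fun f hf => ?_
  have hgf : 0 < g * f := Nat.mul_pos (Nat.pos_of_mem_divisors hg) (Nat.pos_of_mem_divisors hf)
  rw [← Finset.mul_sum, h0, sum_Icc_ite_dvd_div hgf X (fun n => (n : ℝ)) (by simp)]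

open Finset ArithmeticFunction in
lemma sum_d3_ite_dvd {q : ℕ} (hq : q ≠ 0) (N : ℕ) :
    ∑ m ∈ Icc 1 N, (if q ∣ m then (d3 m : ℝ) else 0) =
      ∑ g ∈ q.divisors, ∑ f ∈ q.divisors, (if f ∣ q / g then (moebius f : ℝ) else 0) *
        ∑ i ∈ (q / g).divisors, ∑ j ∈ (q / g).divisors,
          (if j ∣ q / g / i then (moebius j : ℝ) else 0) *
          ∑ m ∈ Icc 1 (N / (g * f * (i * j * (q / g / i)))), (d3 m : ℝ) := by
  have h0 : ∀ Y : ℕ, ∑ m ∈ Icc 1 Y, (d3 m : ℝ) =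
      ∑ c ∈ Icc 1 Y, ∑ l ∈ Icc 1 (Y / c), (l.divisors.card : ℝ) := fun Y => by
    have := sum_d3_mul Y fun _ => (1 : ℝ)
    simpa using this
  have h1 := sum_d3_mul N fun m => if q ∣ m then (1 : ℝ) else 0
  simp only [mul_ite, mul_one, mul_zero] at h1
  rw [h1]
  have h2 : ∀ c ∈ Icc 1 N, ∑ l ∈ Icc 1 (N / c),
      (if q ∣ c * l then (l.divisors.card : ℝ) else 0) =
      ∑ g ∈ q.divisors, ∑ f ∈ q.divisors, (if f ∣ q / g then (moebius f : ℝ) else 0) *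
        ∑ i ∈ (q / g).divisors, ∑ j ∈ (q / g).divisors,
          (if j ∣ q / g / i then (moebius j : ℝ) else 0) *
          (if g * f ∣ c then
            ∑ l ∈ Icc 1 (N / c / (i * j * (q / g / i))), (l.divisors.card : ℝ) else 0) := by
    intro c hc
    have e : ∀ l, (if q ∣ c * l then (l.divisors.card : ℝ) else 0) =
        (if q ∣ c * l then 1 else 0) * (l.divisors.card : ℝ) := fun l => by split_ifs <;> simp
    simp only [e, indicator_dvd_mul hq (Nat.pos_iff_ne_zero.1 (mem_Icc.1 hc).1), Finset.sum_mul]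
    rw [Finset.sum_comm]
    refine Finset.sum_congr rfl fun g hg => ?_
    rw [Finset.sum_comm]
    refine Finset.sum_congr rfl fun f _ => ?_
    have hqg : 0 < q / g := Nat.div_pos (Nat.divisor_le hg) (Nat.pos_of_mem_divisors hg)
    have e2 : ∀ l, (if f ∣ q / g then (moebius f : ℝ) else 0) * (if g * f ∣ c then 1 else 0) *
        (if q / g ∣ l then 1 else 0) * (l.divisors.card : ℝ) =
        (if f ∣ q / g then (moebius f : ℝ) else 0) * ((if g * f ∣ c then 1 else 0) *
        (if q / g ∣ l then (l.divisors.card : ℝ) else 0)) := fun l => by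
      split_ifs <;> simp
    simp only [e2, ← Finset.mul_sum]
    congr 1
    rw [sum_card_divisors_ite_dvd hqg.ne']
    split_ifs <;> simp
  rw [Finset.sum_congr rfl h2, Finset.sum_comm]
  refine Finset.sum_congr rfl fun g hg => ?_
  rw [Finset.sum_comm]
  refine Finset.sum_congr rfl fun f hf => ?_
  have hgf : 0 < g * f := Nat.mul_pos (Nat.pos_of_mem_divisors hg) (Nat.pos_of_mem_divisors hf)
  rw [← Finset.mul_sum, Finset.sum_comm]
  congr 1
  refine Finset.sum_congr rfl fun i _ => ?_
  rw [Finset.sum_comm]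
  refine Finset.sum_congr rfl fun j _ => ?_
  rw [← Finset.mul_sum, h0, sum_Icc_ite_dvd_div hgf N
    (fun n => ∑ l ∈ Icc 1 n, (l.divisors.card : ℝ)) (by simp)]

/-- `S N` is approximated up to `W * N ^ (3/4)` by `N` times a quadratic polynomial in `log N`
with coefficients bounded by `W`. -/
def LogQuadApprox (S : ℕ → ℝ) (W : ℝ) : Prop :=
  ∃ α β γ : ℝ, |α| ≤ W ∧ |β| ≤ W ∧ |γ| ≤ W ∧ ∀ N : ℕ, 1 ≤ N →
    |S N - N * (α * Real.log N ^ 2 + β * Real.log N + γ)| ≤ W * (N : ℝ) ^ (3 / 4 : ℝ)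

namespace LogQuadApprox

lemma mono {S : ℕ → ℝ} {W W' : ℝ} (h : LogQuadApprox S W) (hW : W ≤ W') : LogQuadApprox S W' := by
  obtain ⟨α, β, γ, h1, h2, h3, h4⟩ := h
  exact ⟨α, β, γ, h1.trans hW, h2.trans hW, h3.trans hW, fun N hN => (h4 N hN).trans
    (mul_le_mul_of_nonneg_right hW (by positivity))⟩

lemma const_mul {S : ℕ → ℝ} {W c B : ℝ} (h : LogQuadApprox S W) (hc : |c| ≤ B) :
    LogQuadApprox (fun N => c * S N) (B * W) := by
  obtain ⟨α, β, γ, h1, h2, h3, h4⟩ := h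
  have hW : 0 ≤ W := (abs_nonneg _).trans h1
  have hB : 0 ≤ B := (abs_nonneg _).trans hc
  refine ⟨c * α, c * β, c * γ, ?_, ?_, ?_, fun N hN => ?_⟩
  · rw [abs_mul]; gcongr
  · rw [abs_mul]; gcongr
  · rw [abs_mul]; gcongr
  · have e : c * S N - N * (c * α * Real.log N ^ 2 + c * β * Real.log N + c * γ) =
        c * (S N - N * (α * Real.log N ^ 2 + β * Real.log N + γ)) := by ring
    rw [e, abs_mul, mul_assoc]
    exact mul_le_mul hc (h4 N hN) (abs_nonneg _) hB

open Finset in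
lemma sum {ι : Type*} (I : Finset ι) {S : ι → ℕ → ℝ} {W : ℝ}
    (h : ∀ i ∈ I, LogQuadApprox (S i) W) :
    LogQuadApprox (fun N => ∑ i ∈ I, S i N) (#I * W) := by
  have h' : ∀ i, ∃ α β γ : ℝ, i ∈ I → |α| ≤ W ∧ |β| ≤ W ∧ |γ| ≤ W ∧ ∀ N : ℕ, 1 ≤ N →
      |S i N - N * (α * Real.log N ^ 2 + β * Real.log N + γ)| ≤ W * (N : ℝ) ^ (3 / 4 : ℝ) := by
    intro i
    by_cases hi : i ∈ I
    · obtain ⟨α, β, γ, h1⟩ := h i hi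
      exact ⟨α, β, γ, fun _ => h1⟩
    · exact ⟨0, 0, 0, fun h => absurd h hi⟩
  choose α β γ h1 using h'
  have key : ∀ f : ι → ℝ, ∀ B : ℝ, (∀ i ∈ I, |f i| ≤ B) → |∑ i ∈ I, f i| ≤ #I * B := by
    intro f B hf
    refine (Finset.abs_sum_le_sum_abs _ _).trans ?_
    rw [← nsmul_eq_mul]
    exact Finset.sum_le_card_nsmul _ _ _ hf
  refine ⟨∑ i ∈ I, α i, ∑ i ∈ I, β i, ∑ i ∈ I, γ i, key _ _ fun i hi => (h1 i hi).1,
    key _ _ fun i hi => (h1 i hi).2.1, key _ _ fun i hi => (h1 i hi).2.2.1, fun N hN => ?_⟩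
  have e : ∑ i ∈ I, S i N - N * ((∑ i ∈ I, α i) * Real.log N ^ 2 + (∑ i ∈ I, β i) * Real.log N +
      ∑ i ∈ I, γ i) =
      ∑ i ∈ I, (S i N - N * (α i * Real.log N ^ 2 + β i * Real.log N + γ i)) := by
    rw [Finset.sum_mul, Finset.sum_mul, ← Finset.sum_add_distrib, ← Finset.sum_add_distrib,
      Finset.mul_sum, ← Finset.sum_sub_distrib]
  rw [e, mul_assoc]
  exact key _ _ fun i hi => (h1 i hi).2.2.2 N hN

end LogQuadApprox

open Finset in
lemma exists_logQuadApprox_sum_d3_div : ∃ W : ℝ, 0 < W ∧ ∀ v : ℕ, 1 ≤ v →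
    LogQuadApprox (fun N => ∑ m ∈ Icc 1 (N / v), (d3 m : ℝ)) W := by
  obtain ⟨β, γ, C, hC, h⟩ := exists_abs_sum_d3_floor_sub_le
  refine ⟨16 + 2 * |β| + |γ| + C, by positivity, fun v hv => ?_⟩
  have hv1 : (1 : ℝ) ≤ v := by exact_mod_cast hv
  have hv0 : (0 : ℝ) < v := by linarith
  set l := Real.log v with hl
  have hl0 : 0 ≤ l := Real.log_nonneg hv1
  have l1 : l / v ≤ 1 := by
    rw [div_le_one hv0]
    have := Real.log_le_sub_one_of_pos hv0
    linarith
  have l2 : l ^ 2 / v ≤ 16 := by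
    rw [div_le_iff₀ hv0]
    refine (log_sq_le_sqrt hv1).trans ?_
    have : √(v : ℝ) ≤ v := Real.sqrt_le_iff.2 ⟨hv0.le, by nlinarith⟩
    linarith
  have hinv : 1 / (v : ℝ) ≤ 1 := by rw [div_le_one hv0]; exact hv1
  have hinv0 : 0 ≤ 1 / (v : ℝ) := by positivity
  have l1' : 0 ≤ l / v := by positivity
  have l2' : 0 ≤ l ^ 2 / v := by positivity
  have b1 : |β * (1 / (v : ℝ))| ≤ |β| := by
    rw [abs_mul, abs_of_nonneg hinv0]
    exact mul_le_of_le_one_right (abs_nonneg _) hinv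
  have b2 : |β * (l / (v : ℝ))| ≤ |β| := by
    rw [abs_mul, abs_of_nonneg l1']
    exact mul_le_of_le_one_right (abs_nonneg _) l1
  have b3 : |γ * (1 / (v : ℝ))| ≤ |γ| := by
    rw [abs_mul, abs_of_nonneg hinv0]
    exact mul_le_of_le_one_right (abs_nonneg _) hinv
  have n1 := abs_nonneg β
  have n2 := abs_nonneg γ
  rw [abs_le] at b1 b2 b3
  refine ⟨1 / 2 * (1 / v), β * (1 / v) - l / v, 1 / 2 * (l ^ 2 / v) - β * (l / v) + γ * (1 / v),
    ?_, ?_, ?_, fun N hN => ?_⟩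
  · rw [abs_le]; constructor <;> linarith
  · rw [abs_le]; constructor <;> linarith
  · rw [abs_le]; constructor <;> linarith
  · have hN0 : (0 : ℝ) < N := by exact_mod_cast hN
    have h1 := h ((N : ℝ) / v) (by positivity)
    rw [Nat.floor_div_eq_div, Real.log_div hN0.ne' hv0.ne'] at h1
    have e : (N : ℝ) / v * (1 / 2 * (Real.log N - Real.log v) ^ 2 +
        β * (Real.log N - Real.log v) + γ) = N * (1 / 2 * (1 / v) * Real.log N ^ 2 +
        (β * (1 / v) - l / v) * Real.log N + (1 / 2 * (l ^ 2 / v) - β * (l / v) + γ * (1 / v))) := by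
      rw [← hl]; ring
    rw [e] at h1
    refine h1.trans ?_
    have h2 : ((N : ℝ) / v) ^ (3 / 4 : ℝ) ≤ (N : ℝ) ^ (3 / 4 : ℝ) :=
      Real.rpow_le_rpow (by positivity) (div_le_self hN0.le hv1) (by norm_num)
    refine mul_le_mul ?_ h2 (by positivity) (by positivity)
    linarith

open Finset in
lemma exists_logQuadApprox_sum_d3_ite_dvd : ∃ W : ℝ, 0 < W ∧ ∀ q : ℕ, q ≠ 0 →
    LogQuadApprox (fun N => ∑ m ∈ Icc 1 N, (if q ∣ m then (d3 m : ℝ) else 0))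
      ((#q.divisors : ℝ) ^ 4 * W) := by
  obtain ⟨W, hW, h⟩ := exists_logQuadApprox_sum_d3_div
  have hμ : ∀ (p : Prop) [Decidable p] (f : ℕ),
      |if p then (ArithmeticFunction.moebius f : ℝ) else 0| ≤ 1 := by
    intro p _ f
    split_ifs
    · exact_mod_cast ArithmeticFunction.abs_moebius_le_one
    · simp
  refine ⟨W, hW, fun q hq => ?_⟩
  simp only [sum_d3_ite_dvd hq]
  have h4 : (#q.divisors : ℝ) ^ 4 * W =
      #q.divisors * (#q.divisors * (1 * (#q.divisors * (#q.divisors * (1 * W))))) := by ring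
  rw [h4]
  refine LogQuadApprox.sum _ fun g hg => LogQuadApprox.sum _ fun f hf =>
    LogQuadApprox.const_mul ?_ (hμ _ _)
  have hqg : 0 < q / g := Nat.div_pos (Nat.divisor_le hg) (Nat.pos_of_mem_divisors hg)
  have hcard : (#(q / g).divisors : ℝ) ≤ #q.divisors := by
    exact_mod_cast Finset.card_le_card
      (Nat.divisors_subset_of_dvd hq (Nat.div_dvd_of_dvd (Nat.dvd_of_mem_divisors hg)))
  refine (LogQuadApprox.sum _ fun i hi => LogQuadApprox.sum _ fun j hj =>
    LogQuadApprox.const_mul (h _ ?_) (hμ _ _)).mono (by gcongr)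
  have hi0 := Nat.pos_of_mem_divisors hi
  exact Nat.mul_pos (Nat.mul_pos (Nat.pos_of_mem_divisors hg) (Nat.pos_of_mem_divisors hf))
    (Nat.mul_pos (Nat.mul_pos hi0 (Nat.pos_of_mem_divisors hj))
      (Nat.div_pos (Nat.divisor_le hi) hi0))

lemma le_totient_mul_card_divisors (d : ℕ) : d ≤ d.totient * d.divisors.card := by
  rcases Nat.eq_zero_or_pos d with rfl | hd
  · simp
  conv_lhs => rw [← Nat.sum_totient d]
  rw [mul_comm, ← smul_eq_mul]
  exact Finset.sum_le_card_nsmul _ _ _ fun e he => Nat.le_of_dvd (Nat.totient_pos.2 hd)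
    (Nat.totient_dvd_of_dvd (Nat.dvd_of_mem_divisors he))

lemma zmod_eq_unit_mul_gcd {d : ℕ} [NeZero d] (m : ℕ) :
    ∃ w : (ZMod d)ˣ, (m : ZMod d) = w * (m.gcd d : ℕ) := by
  obtain ⟨g, hg, u, hu, h⟩ := ZMod.eq_unit_mul_divisor (m : ZMod d)
  obtain ⟨w, rfl⟩ := hu
  refine ⟨w, ?_⟩
  have h1 : ((m : ℕ) : ZMod d) = ((w : ZMod d).val * g : ℕ) := by
    rw [h, Nat.cast_mul, ZMod.natCast_zmod_val]
  rw [ZMod.natCast_eq_natCast_iff] at h1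
  have h2 : m.gcd d = g := by
    rw [h1.gcd_eq, Nat.Coprime.gcd_mul_left_cancel _ (ZMod.val_coe_unit_coprime w)]
    exact Nat.gcd_eq_left hg
  rw [h2, h]

open Finset in
lemma card_units_mul_eq_gcd {d : ℕ} [NeZero d] (k m : ℕ) :
    #{u : (ZMod d)ˣ | (m : ZMod d) = u * k} =
      #{u : (ZMod d)ˣ | ((m.gcd d : ℕ) : ZMod d) = u * k} := by
  obtain ⟨w, hw⟩ := zmod_eq_unit_mul_gcd (d := d) m
  refine Finset.card_bij (fun u _ => w⁻¹ * u) ?_ ?_ ?_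
  · intro u hu
    simp only [mem_filter, mem_univ, true_and] at hu ⊢
    rw [Units.val_mul, mul_assoc, ← hu, hw, Units.inv_mul_cancel_left]
  · intro a _ b _ h
    exact mul_left_cancel h
  · intro u hu
    simp only [mem_filter, mem_univ, true_and] at hu
    refine ⟨w * u, ?_, by simp⟩
    simp only [mem_filter, mem_univ, true_and]
    rw [hw, hu, Units.val_mul, mul_assoc]

open Finset in
lemma card_units_mul_eq_le {d : ℕ} [NeZero d] {k : ℕ} (hk : 0 < k) (c : ZMod d) :
    #{u : (ZMod d)ˣ | c = u * k} ≤ k := by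
  rcases ({u : (ZMod d)ˣ | c = u * k} : Finset (ZMod d)ˣ).eq_empty_or_nonempty with h | ⟨u₀, h₀⟩
  · rw [h]; simp
  simp only [mem_filter, mem_univ, true_and] at h₀
  refine le_trans ?_ (card_zmod_mul_eq_unit_mul_le hk u₀ (k : ZMod d))
  refine Finset.card_le_card_of_injOn (fun u => (u : ZMod d)) ?_ (fun a _ b _ h => Units.ext h)
  intro u hu
  simp only [coe_filter, mem_univ, true_and, Set.mem_ofPred_eq] at hu ⊢
  rw [← hu, h₀]

open Finset ArithmeticFunction in
/-- The average of `d3ClassSum d N (u * k)` over units `u` is a combination of sums of `d₃` over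
multiples of divisors of `d`. -/
lemma exists_sum_units_d3ClassSum_eq {d : ℕ} [NeZero d] {k : ℕ} (hk : 1 ≤ k) :
    ∃ l : ℕ → ℝ, (∀ q ∈ d.divisors, |l q| ≤ #d.divisors * k) ∧ ∀ N : ℕ,
      ∑ u : (ZMod d)ˣ, d3ClassSum d N (u * k) =
        ∑ q ∈ d.divisors, l q * ∑ m ∈ Icc 1 N, (if q ∣ m then (d3 m : ℝ) else 0) := by
  set R : ℕ → ℝ := fun g => #{u : (ZMod d)ˣ | ((g : ℕ) : ZMod d) = u * k} with hR
  have hRk : ∀ g, |R g| ≤ k := fun g => by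
    rw [hR, Nat.abs_cast]
    exact_mod_cast card_units_mul_eq_le hk _
  set l : ℕ → ℝ := fun q => ∑ x ∈ q.divisorsAntidiagonal, (moebius x.1 : ℝ) * R x.2 with hl
  have hlR : ∀ n > 0, ∑ i ∈ n.divisors, l i = R n :=
    sum_eq_iff_sum_mul_moebius_eq.2 fun n _ => rfl
  refine ⟨l, fun q hq => ?_, fun N => ?_⟩
  · rw [hl]
    dsimp only
    rw [Nat.sum_divisorsAntidiagonal (fun i j => (moebius i : ℝ) * R j)]
    refine (Finset.abs_sum_le_sum_abs _ _).trans ?_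
    refine (Finset.sum_le_card_nsmul _ _ (k : ℝ) fun i _ => ?_).trans ?_
    · rw [abs_mul]
      have : |(moebius i : ℝ)| ≤ 1 := by exact_mod_cast abs_moebius_le_one
      exact (mul_le_of_le_one_left (abs_nonneg _) this).trans (hRk _)
    · rw [nsmul_eq_mul]
      refine mul_le_mul_of_nonneg_right ?_ (by positivity)
      exact_mod_cast Finset.card_le_card
        (Nat.divisors_subset_of_dvd (NeZero.ne d) (Nat.dvd_of_mem_divisors hq))
  · simp only [d3ClassSum, Finset.mul_sum]
    rw [Finset.sum_comm, Finset.sum_comm (s := d.divisors)]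
    refine Finset.sum_congr rfl fun m hm => ?_
    rw [← Finset.mul_sum, Finset.sum_boole, card_units_mul_eq_gcd]
    have h1 := hlR (m.gcd d) (Nat.gcd_pos_of_pos_right _ (NeZero.pos d))
    have h2 : (m.gcd d).divisors = d.divisors.filter (fun q => q ∣ m) := by
      ext q
      simp only [mem_filter, Nat.mem_divisors, Nat.dvd_gcd_iff]
      have := NeZero.ne d
      have h3 : m.gcd d ≠ 0 := Nat.gcd_ne_zero_right this
      tauto
    rw [h2, Finset.sum_filter] at h1
    change (d3 m : ℝ) * R (m.gcd d) = _
    rw [← h1, Finset.mul_sum]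
    refine Finset.sum_congr rfl fun q _ => ?_
    split_ifs <;> ring

open Finset in
lemma exists_logQuadApprox_avg : ∃ W : ℝ, 0 < W ∧ ∀ (d : ℕ) [NeZero d] (k : ℕ), 1 ≤ k →
    LogQuadApprox (fun N => 1 / (d.totient : ℝ) * ∑ u : (ZMod d)ˣ, d3ClassSum d N (u * k))
      ((#d.divisors : ℝ) ^ 7 * W * k / d) := by
  obtain ⟨W, hW, h⟩ := exists_logQuadApprox_sum_d3_ite_dvd
  refine ⟨W, hW, fun d _ k hk => ?_⟩
  obtain ⟨l, hl, hS⟩ := exists_sum_units_d3ClassSum_eq (d := d) hk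
  simp only [hS]
  have hd : 0 < d := NeZero.pos d
  have hd0 : (0 : ℝ) < d := by exact_mod_cast hd
  have hφ : (0 : ℝ) < d.totient := by exact_mod_cast Nat.totient_pos.2 hd
  have h1 := LogQuadApprox.const_mul (c := 1 / (d.totient : ℝ)) (LogQuadApprox.sum d.divisors
    fun q hq => LogQuadApprox.const_mul (c := l q)
      ((h q (Nat.pos_of_mem_divisors hq).ne').mono (W' := (#d.divisors : ℝ) ^ 4 * W) (by
        have : (#q.divisors : ℝ) ≤ #d.divisors := by
          exact_mod_cast Finset.card_le_card
            (Nat.divisors_subset_of_dvd hd.ne' (Nat.dvd_of_mem_divisors hq))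
        gcongr)) (hl q hq)) le_rfl
  refine h1.mono ?_
  rw [abs_of_pos (by positivity), one_div, inv_mul_le_iff₀ hφ]
  have h2 : (d : ℝ) ≤ d.totient * #d.divisors := by exact_mod_cast le_totient_mul_card_divisors d
  rw [mul_div_assoc', le_div_iff₀ hd0]
  calc _ ≤ #d.divisors * (#d.divisors * k * (#d.divisors ^ 4 * W)) *
        ((d.totient : ℝ) * #d.divisors) := by gcongr
    _ = _ := by ring

open Finset in
/-- The distribution of `d₃` in an arbitrary (possibly non-reduced) residue class. -/
lemma exists_d3ClassSum_natCast_approx : ∃ A B G : ℕ → ℕ → ℝ, ∀ ε : ℝ, 0 < ε → ∃ C : ℝ, 0 < C ∧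
    ∀ (d k : ℕ), 1 ≤ d → 1 ≤ k → |A d k| ≤ C * k * (d : ℝ) ^ ε / d ∧
      |B d k| ≤ C * k * (d : ℝ) ^ ε / d ∧ |G d k| ≤ C * k * (d : ℝ) ^ ε / d ∧
      ∀ N : ℕ, d ≤ N.sqrt → |d3ClassSum d N k -
        N * (A d k * Real.log N ^ 2 + B d k * Real.log N + G d k)| ≤
          C * k * (N : ℝ) ^ (3 / 4 + ε) / √d := by
  obtain ⟨W, hW, h⟩ := exists_logQuadApprox_avg
  have h' : ∀ d k : ℕ, ∃ α β γ : ℝ, ∀ hd : d ≠ 0, 1 ≤ k →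
      |α| ≤ (#d.divisors : ℝ) ^ 7 * W * k / d ∧ |β| ≤ (#d.divisors : ℝ) ^ 7 * W * k / d ∧
      |γ| ≤ (#d.divisors : ℝ) ^ 7 * W * k / d ∧
      ∀ N : ℕ, 1 ≤ N → |1 / (d.totient : ℝ) *
        (have : NeZero d := ⟨hd⟩; ∑ u : (ZMod d)ˣ, d3ClassSum d N (u * k)) -
          N * (α * Real.log N ^ 2 + β * Real.log N + γ)| ≤
        (#d.divisors : ℝ) ^ 7 * W * k / d * (N : ℝ) ^ (3 / 4 : ℝ) := by
    intro d k
    by_cases hdk : d ≠ 0 ∧ 1 ≤ k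
    · have : NeZero d := ⟨hdk.1⟩
      obtain ⟨α, β, γ, h1⟩ := h d k hdk.2
      exact ⟨α, β, γ, fun _ _ => h1⟩
    · exact ⟨0, 0, 0, fun h1 h2 => absurd ⟨h1, h2⟩ hdk⟩
  choose A B G hABG using h'
  refine ⟨A, B, G, fun ε hε => ?_⟩
  obtain ⟨C₁, hC₁, h₁⟩ := exists_card_divisors_le (by positivity : 0 < ε / 7)
  obtain ⟨C₂, hC₂, h₂⟩ := exists_abs_d3ClassSum_unit_mul_sub_le hε
  have hτ : ∀ d : ℕ, (#d.divisors : ℝ) ^ 7 ≤ C₁ ^ 7 * (d : ℝ) ^ ε := fun d => by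
    calc _ ≤ (C₁ * (d : ℝ) ^ (ε / 7)) ^ 7 := by gcongr; exact h₁ d
      _ = _ := by
        rw [mul_pow, ← Real.rpow_natCast ((d : ℝ) ^ (ε / 7)), ← Real.rpow_mul (by positivity)]
        norm_num
  refine ⟨C₁ ^ 7 * W + C₂, by positivity, fun d k hd hk => ?_⟩
  have : NeZero d := ⟨by omega⟩
  obtain ⟨g1, g2, g3, g4⟩ := hABG d k (NeZero.ne d) hk
  have hd0 : (0 : ℝ) < d := by exact_mod_cast hd
  have hb0 : (#d.divisors : ℝ) ^ 7 * W * k / d ≤ C₁ ^ 7 * W * k * (d : ℝ) ^ ε / d := by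
    calc _ ≤ (C₁ ^ 7 * (d : ℝ) ^ ε) * W * k / d := by gcongr; exact hτ d
      _ = _ := by ring
  have hb : (#d.divisors : ℝ) ^ 7 * W * k / d ≤ (C₁ ^ 7 * W + C₂) * k * (d : ℝ) ^ ε / d := by
    refine hb0.trans ?_
    gcongr
    linarith
  refine ⟨g1.trans hb, g2.trans hb, g3.trans hb, fun N hN => ?_⟩
  have hN1 : 1 ≤ N := Nat.sqrt_pos.1 (by omega)
  have hN0 : (0 : ℝ) < N := by exact_mod_cast hN1
  have hdN : (d : ℝ) ≤ N := by exact_mod_cast hN.trans (Nat.sqrt_le_self N)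
  have hφ : (0 : ℝ) < d.totient := by exact_mod_cast Nat.totient_pos.2 hd
  have e1 : |d3ClassSum d N k - 1 / (d.totient : ℝ) * ∑ u : (ZMod d)ˣ, d3ClassSum d N (u * k)| ≤
      C₂ * k * (N : ℝ) ^ (3 / 4 + ε) / √d := by
    have e : d3ClassSum d N k - 1 / (d.totient : ℝ) * ∑ u : (ZMod d)ˣ, d3ClassSum d N (u * k) =
        -(1 / (d.totient : ℝ) *
          ∑ u : (ZMod d)ˣ, (d3ClassSum d N (u * k) - d3ClassSum d N k)) := by
      rw [Finset.sum_sub_distrib, Finset.sum_const, Finset.card_univ, ZMod.card_units_eq_totient,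
        nsmul_eq_mul]
      field_simp
      ring
    rw [e, abs_neg, abs_mul, abs_of_pos (by positivity), one_div, inv_mul_le_iff₀ hφ]
    refine (Finset.abs_sum_le_sum_abs _ _).trans ((Finset.sum_le_card_nsmul _ _ _ fun u _ =>
      h₂ d N k u hN hk).trans (le_of_eq ?_))
    rw [Finset.card_univ, ZMod.card_units_eq_totient, nsmul_eq_mul]
  have e2 := g4 N hN1
  have e3 : (#d.divisors : ℝ) ^ 7 * W * k / d * (N : ℝ) ^ (3 / 4 : ℝ) ≤
      C₁ ^ 7 * W * k * (N : ℝ) ^ (3 / 4 + ε) / √d := by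
    have hsd : √(d : ℝ) ≤ d := Real.sqrt_le_iff.2 ⟨hd0.le, by
      have : (1 : ℝ) ≤ d := by exact_mod_cast hd
      nlinarith⟩
    have hs0 : 0 < √(d : ℝ) := Real.sqrt_pos.2 hd0
    calc _ ≤ C₁ ^ 7 * W * k * (d : ℝ) ^ ε / d * (N : ℝ) ^ (3 / 4 : ℝ) := by gcongr
      _ ≤ C₁ ^ 7 * W * k * (N : ℝ) ^ ε / √d * (N : ℝ) ^ (3 / 4 : ℝ) := by gcongr
      _ = _ := by rw [Real.rpow_add hN0]; ring
  have e4 := (e2.trans e3)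
  rw [add_mul, add_mul, add_div]
  have := abs_sub_le (d3ClassSum d N k)
    (1 / (d.totient : ℝ) * ∑ u : (ZMod d)ˣ, d3ClassSum d N (u * k))
    (N * (A d k * Real.log N ^ 2 + B d k * Real.log N + G d k))
  linarith

lemma abelianCount_prime_mul {p e : ℕ} (hp : p.Prime) (hpe : ¬p ∣ e) :
    abelianCount (p * e) = abelianCount e := by
  have hc : p.Coprime e := (Nat.Prime.coprime_iff_not_dvd hp).2 hpe
  rw [abelianCount, Nat.factorization_mul_of_coprime hc,
    Finsupp.prod_add_index_of_disjoint (by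
      simpa using Nat.Coprime.disjoint_primeFactors hc), hp.factorization,
    Finsupp.prod_single_index (by simp)]
  have : Fintype.card (Nat.Partition 1) = 1 := Fintype.card_unique
  rw [this, one_mul, abelianCount]

lemma one_le_abelianCount (n : ℕ) : 1 ≤ abelianCount n := by
  rw [abelianCount, Finsupp.prod]
  exact Finset.prod_pos fun _ _ => Fintype.card_pos

lemma abelianCount_of_squarefree {n : ℕ} (hn : Squarefree n) : abelianCount n = 1 := by
  rw [abelianCount, Finsupp.prod]
  refine Finset.prod_eq_one fun p hp => ?_
  have h1 : n.factorization p ≤ 1 := hn.natFactorization_le_one p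
  have h2 : n.factorization p ≠ 0 := Finsupp.mem_support_iff.1 hp
  have h3 : n.factorization p = 1 := by omega
  rw [h3]
  exact Fintype.card_unique

/-- `d` is squarefull if every prime divisor of `d` divides it at least twice. -/
def Squarefull (d : ℕ) : Prop := ∀ p : ℕ, p.Prime → p ∣ d → p ^ 2 ∣ d

lemma Squarefull.exists_eq {d : ℕ} (hd : Squarefull d) : ∃ u v : ℕ, d = u ^ 2 * v ^ 3 := by
  obtain ⟨a, b, h, ha⟩ := Nat.sq_mul_squarefree d
  rcases Nat.eq_zero_or_pos b with rfl | hb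
  · exact ⟨0, 0, by simp [← h]⟩
  have hab : a ∣ b := by
    rw [← Nat.prod_primeFactors_of_squarefree ha]
    refine dvd_trans (Finset.prod_dvd_prod_of_subset _ _ (fun p : ℕ => p) ?_)
      (Nat.prod_primeFactors_dvd b)
    intro p hp
    have hp' := Nat.prime_of_mem_primeFactors hp
    refine Nat.mem_primeFactors.2 ⟨hp', ?_, hb.ne'⟩
    by_contra hpb
    have h1 : p ^ 2 ∣ b ^ 2 * a := h ▸ hd p hp' (h ▸ (Nat.dvd_of_mem_primeFactors hp).mul_left _)
    have h2 : p ^ 2 ∣ a := Nat.Coprime.dvd_of_dvd_mul_left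
      (((Nat.Prime.coprime_iff_not_dvd hp').2 hpb).pow 2 2) h1
    have h3 := ha p (by rwa [← sq])
    exact hp'.one_lt.ne' (Nat.isUnit_iff.1 h3)
  obtain ⟨u, rfl⟩ := hab
  exact ⟨u, a, by rw [← h]; ring⟩

open Finset ArithmeticFunction in
lemma sum_moebius_mul_eq_zero_of_not_squarefull {d : ℕ} (hd : ¬Squarefull d) {f : ℕ → ℝ}
    (hf : ∀ p e : ℕ, p.Prime → ¬p ∣ e → f (p * e) = f e) :
    ∑ e ∈ d.divisors, (moebius (d / e) : ℝ) * f e = 0 := by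
  simp only [Squarefull, not_forall] at hd
  obtain ⟨p, hp, ⟨m, rfl⟩, hpm⟩ := hd
  have hpm' : ¬p ∣ m := fun h => hpm (by rw [sq]; exact Nat.mul_dvd_mul_left p h)
  have hm0 : m ≠ 0 := fun h => hpm' (h ▸ dvd_zero p)
  have hp0 := hp.pos
  have key : ∀ e, e ∣ m → (moebius (p * m / e) : ℝ) * f e +
      (moebius (p * m / (p * e)) : ℝ) * f (p * e) = 0 := by
    rintro e ⟨c, rfl⟩
    have he0 : 0 < e := Nat.pos_of_ne_zero (left_ne_zero_of_mul hm0)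
    have hpe : ¬p ∣ e := fun h => hpm' (h.mul_right c)
    have hpc : ¬p ∣ c := fun h => hpm' (h.mul_left e)
    have e1 : p * (e * c) / e = p * c := by
      rw [mul_left_comm, Nat.mul_div_cancel_left _ he0]
    have e2 : p * (e * c) / (p * e) = c := by
      rw [← mul_assoc, Nat.mul_div_cancel_left _ (Nat.mul_pos hp0 he0)]
    rw [e1, e2, hf p e hp hpe, isMultiplicative_moebius.map_mul_of_coprime
      ((Nat.Prime.coprime_iff_not_dvd hp).2 hpc), moebius_apply_prime hp]
    push_cast
    ring
  refine Finset.sum_involution (fun e _ => if p ∣ e then e / p else p * e) ?_ ?_ ?_ ?_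
  · intro e he
    have hed := Nat.dvd_of_mem_divisors he
    split_ifs with h
    · obtain ⟨c, rfl⟩ := h
      rw [Nat.mul_div_cancel_left _ hp0, add_comm]
      exact key c (Nat.dvd_of_mul_dvd_mul_left hp0 hed)
    · exact key e (((Nat.Prime.coprime_iff_not_dvd hp).2 h).symm.dvd_of_dvd_mul_left hed)
  · intro e he _
    have he0 := Nat.pos_of_mem_divisors he
    split_ifs with h
    · exact (Nat.div_lt_self he0 hp.one_lt).ne
    · exact ((Nat.lt_mul_iff_one_lt_left he0).2 hp.one_lt).ne'
  · intro e he
    have hed := Nat.dvd_of_mem_divisors he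
    refine Nat.mem_divisors.2 ⟨?_, (Nat.mem_divisors.1 he).2⟩
    split_ifs with h
    · exact (Nat.div_dvd_of_dvd h).trans hed
    · exact Nat.mul_dvd_mul_left p
        (((Nat.Prime.coprime_iff_not_dvd hp).2 h).symm.dvd_of_dvd_mul_left hed)
  · intro e he
    have hed := Nat.dvd_of_mem_divisors he
    by_cases h : p ∣ e
    · obtain ⟨c, rfl⟩ := h
      have hc : ¬p ∣ c := fun h => hpm' (h.trans (Nat.dvd_of_mul_dvd_mul_left hp0 hed))
      simp [Nat.mul_div_cancel_left _ hp0, hc]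
    · simp [h, Nat.mul_div_cancel_left _ hp0]

open Finset ArithmeticFunction in
lemma sum_divisors_sum_moebius {n : ℕ} (hn : 0 < n) (f : ℕ → ℝ) :
    f n = ∑ d ∈ n.divisors, ∑ e ∈ d.divisors, (moebius (d / e) : ℝ) * f e := by
  refine ((sum_eq_iff_sum_mul_moebius_eq
    (f := fun d => ∑ e ∈ d.divisors, (moebius (d / e) : ℝ) * f e)).2 (fun n _ => ?_) n hn).symm
  rw [Nat.sum_divisorsAntidiagonal' (fun i j => (moebius i : ℝ) * f j)]

open Finset ArithmeticFunction in
open Classical in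
/-- Expansion of the shifted sum over squarefull moduli. -/
lemma sum_d3_add_abelianCount_eq (N : ℕ) :
    ∑ n ∈ Icc 1 N, (d3 (n + abelianCount n) : ℝ) =
      ∑ d ∈ Icc 1 N with Squarefull d, ∑ e ∈ d.divisors, (moebius (d / e) : ℝ) *
        ∑ n ∈ Icc 1 N, (if d ∣ n then (d3 (n + abelianCount e) : ℝ) else 0) := by
  have h1 : ∀ n ∈ Icc 1 N, (d3 (n + abelianCount n) : ℝ) =
      ∑ d ∈ Icc 1 N with Squarefull d, ∑ e ∈ d.divisors, (moebius (d / e) : ℝ) *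
        (if d ∣ n then (d3 (n + abelianCount e) : ℝ) else 0) := by
    intro n hn
    obtain ⟨hn1, hnN⟩ := mem_Icc.1 hn
    rw [sum_divisors_sum_moebius hn1 fun e => (d3 (n + abelianCount e) : ℝ), Finset.sum_filter]
    have h2 : n.divisors ⊆ Icc 1 N := fun d hd =>
      mem_Icc.2 ⟨Nat.pos_of_mem_divisors hd, (Nat.divisor_le hd).trans hnN⟩
    rw [← Finset.sum_subset h2 fun d _ hd => ?_]
    · refine Finset.sum_congr rfl fun d hd => ?_
      simp only [Nat.dvd_of_mem_divisors hd, if_true]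
      split_ifs with hs
      · rfl
      · exact sum_moebius_mul_eq_zero_of_not_squarefull hs fun p e hp hpe => by
          rw [abelianCount_prime_mul hp hpe]
    · have : ¬d ∣ n := fun h => hd (Nat.mem_divisors.2 ⟨h, by omega⟩)
      simp [this]
  rw [Finset.sum_congr rfl h1, Finset.sum_comm]
  refine Finset.sum_congr rfl fun d _ => ?_
  rw [Finset.sum_comm]
  exact Finset.sum_congr rfl fun e _ => (Finset.mul_sum _ _ _).symm

open Classical in
/-- `d ^ (-1/2 - δ)` if `d` is squarefull, and `0` otherwise. -/
noncomputable def squarefullWeight (δ : ℝ) (d : ℕ) : ℝ :=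
  if Squarefull d then (d : ℝ) ^ (-(1 / 2) - δ) else 0

lemma squarefullWeight_nonneg (δ : ℝ) (d : ℕ) : 0 ≤ squarefullWeight δ d := by
  unfold squarefullWeight
  split_ifs <;> positivity

open Finset in
open Classical in
lemma summable_squarefullWeight {δ : ℝ} (hδ : 0 < δ) : Summable (squarefullWeight δ) := by
  have s1 : Summable fun u : ℕ => (u : ℝ) ^ (-1 - 2 * δ) :=
    Real.summable_nat_rpow.2 (by linarith)
  have s2 : Summable fun v : ℕ => (v : ℝ) ^ (-(3 / 2) - 3 * δ) :=
    Real.summable_nat_rpow.2 (by linarith)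
  have s3 : Summable fun x : ℕ × ℕ => (x.1 : ℝ) ^ (-1 - 2 * δ) * (x.2 : ℝ) ^ (-(3 / 2) - 3 * δ) :=
    s1.mul_of_nonneg s2 (fun _ => by positivity) (fun _ => by positivity)
  have h : ∀ d : ℕ, ∃ x : ℕ × ℕ, Squarefull d → d = x.1 ^ 2 * x.2 ^ 3 := by
    intro d
    by_cases hd : Squarefull d
    · obtain ⟨u, v, h⟩ := hd.exists_eq
      exact ⟨(u, v), fun _ => h⟩
    · exact ⟨(0, 0), fun h => absurd h hd⟩
  choose x hx using h
  refine summable_of_sum_le (c := ∑' x : ℕ × ℕ,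
    (x.1 : ℝ) ^ (-1 - 2 * δ) * (x.2 : ℝ) ^ (-(3 / 2) - 3 * δ)) (squarefullWeight_nonneg δ) fun S => ?_
  · simp only [squarefullWeight]
    rw [← Finset.sum_filter]
    have h1 : ∀ d ∈ S.filter Squarefull, (d : ℝ) ^ (-(1 / 2) - δ) =
        ((x d).1 : ℝ) ^ (-1 - 2 * δ) * ((x d).2 : ℝ) ^ (-(3 / 2) - 3 * δ) := by
      intro d hd
      have h2 : (d : ℝ) = ((x d).1 : ℝ) ^ 2 * ((x d).2 : ℝ) ^ 3 := by
        exact_mod_cast hx d (mem_filter.1 hd).2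
      rw [h2, Real.mul_rpow (by positivity) (by positivity), ← Real.rpow_natCast, ← Real.rpow_natCast,
        ← Real.rpow_mul (by positivity), ← Real.rpow_mul (by positivity)]
      push_cast
      congr 2 <;> ring
    have hinj : Set.InjOn x (S.filter Squarefull) := by
      intro d hd d' hd' h
      rw [hx d (mem_filter.1 hd).2, hx d' (mem_filter.1 hd').2, h]
    rw [Finset.sum_congr rfl h1, ← Finset.sum_image
      (f := fun x : ℕ × ℕ => (x.1 : ℝ) ^ (-1 - 2 * δ) * (x.2 : ℝ) ^ (-(3 / 2) - 3 * δ)) hinj]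
    exact s3.sum_le_tsum _ fun _ _ => by positivity

open Finset in
lemma abs_sum_shift_sub_sum_le {g : ℕ → ℝ} {M : ℝ} {N k : ℕ}
    (hg : ∀ m, 1 ≤ m → m ≤ N + k → |g m| ≤ M) :
    |∑ n ∈ Icc 1 N, g (n + k) - ∑ n ∈ Icc 1 N, g n| ≤ 2 * k * M := by
  have step : ∀ k N : ℕ, ∑ n ∈ Icc 1 N, g (n + (k + 1)) + g (k + 1) =
      ∑ n ∈ Icc 1 N, g (n + k) + g (N + k + 1) := by
    intro k N
    induction N with
    | zero => simp
    | succ N ih =>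
      rw [Finset.sum_Icc_succ_top (by omega), Finset.sum_Icc_succ_top (by omega)]
      have e : N + 1 + (k + 1) = N + 1 + k + 1 := by ring
      have e' : N + k + 1 = N + 1 + k := by ring
      rw [e]
      rw [e'] at ih
      linarith
  induction k with
  | zero => simp
  | succ k ih =>
    have h1 := ih fun m h1 h2 => hg m h1 (by omega)
    have h2 := hg (k + 1) (by omega) (by omega)
    have h3 := hg (N + k + 1) (by omega) (by omega)
    have h4 := step k N
    push_cast
    rw [abs_le] at *
    constructor <;> linarith

lemma rpow_add_nat_le {ε : ℝ} (hε : 0 < ε) (hε1 : ε ≤ 1) {N k m : ℕ} (hN : 1 ≤ N) (hk : 1 ≤ k)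
    (hm : m ≤ N + k) : (m : ℝ) ^ ε ≤ 2 * k * (N : ℝ) ^ ε := by
  have hk1 : (1 : ℝ) ≤ k := by exact_mod_cast hk
  have hN1 : (1 : ℝ) ≤ N := by exact_mod_cast hN
  have hm' : (m : ℝ) ≤ N + k := by exact_mod_cast hm
  calc (m : ℝ) ^ ε ≤ (2 * k * N) ^ ε :=
        Real.rpow_le_rpow (by positivity) (by nlinarith) hε.le
    _ = (2 * k : ℝ) ^ ε * (N : ℝ) ^ ε := Real.mul_rpow (by positivity) (by positivity)
    _ ≤ 2 * k * (N : ℝ) ^ ε := by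
        gcongr
        calc (2 * k : ℝ) ^ ε ≤ (2 * k : ℝ) ^ (1 : ℝ) :=
              Real.rpow_le_rpow_of_exponent_le (by linarith) hε1
          _ = _ := Real.rpow_one _

open Finset in
lemma exists_abs_sum_ite_dvd_shift_sub_le {ε : ℝ} (hε : 0 < ε) (hε1 : ε ≤ 1) : ∃ C : ℝ, 0 < C ∧
    ∀ N d k : ℕ, 1 ≤ N → 1 ≤ k →
      |∑ n ∈ Icc 1 N, (if d ∣ n then (d3 (n + k) : ℝ) else 0) - d3ClassSum d N k| ≤
        C * k ^ 2 * (N : ℝ) ^ ε := by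
  obtain ⟨C, hC, h⟩ := exists_d3_le hε
  refine ⟨4 * C, by positivity, fun N d k hN hk => ?_⟩
  have h1 := abs_sum_shift_sub_sum_le (N := N) (k := k) (M := C * (2 * k * (N : ℝ) ^ ε))
    (g := fun m => (d3 m : ℝ) * (if ((m : ℕ) : ZMod d) = k then 1 else 0)) (fun m h1 h2 => by
      have h3 : (d3 m : ℝ) ≤ C * (2 * k * (N : ℝ) ^ ε) :=
        (h m h1).trans (mul_le_mul_of_nonneg_left (rpow_add_nat_le hε hε1 hN hk h2) hC.le)
      rw [abs_of_nonneg (by split_ifs <;> positivity)]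
      split_ifs
      · rwa [mul_one]
      · rw [mul_zero]; positivity)
  have h2 : ∀ n ∈ Icc 1 N, (if d ∣ n then (d3 (n + k) : ℝ) else 0) =
      (d3 (n + k) : ℝ) * (if ((n + k : ℕ) : ZMod d) = k then 1 else 0) := by
    intro n _
    have : ((n + k : ℕ) : ZMod d) = k ↔ d ∣ n := by
      rw [Nat.cast_add, add_eq_right, ZMod.natCast_eq_zero_iff]
    simp only [this]
    split_ifs <;> simp
  rw [Finset.sum_congr rfl h2]
  refine h1.trans (le_of_eq ?_)
  ring

open Finset in
lemma exists_sum_ite_dvd_shift_le {ε : ℝ} (hε : 0 < ε) (hε1 : ε ≤ 1) : ∃ C : ℝ, 0 < C ∧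
    ∀ N d k : ℕ, 1 ≤ N → 1 ≤ d → 1 ≤ k →
      ∑ n ∈ Icc 1 N, (if d ∣ n then (d3 (n + k) : ℝ) else 0) ≤
        C * k * (N : ℝ) ^ (1 + ε) / d := by
  obtain ⟨C, hC, h⟩ := exists_d3_le hε
  refine ⟨2 * C, by positivity, fun N d k hN hd hk => ?_⟩
  have hN0 : (0 : ℝ) < N := by exact_mod_cast hN
  rw [sum_Icc_ite_dvd hd N fun n => (d3 (n + k) : ℝ)]
  refine (Finset.sum_le_card_nsmul _ _ (C * (2 * k * (N : ℝ) ^ ε)) fun n hn => ?_).trans ?_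
  · have h1 : d * n ≤ N := by
      have := (mem_Icc.1 hn).2
      rw [Nat.le_div_iff_mul_le hd] at this
      linarith
    exact (h _ (by omega)).trans
      (mul_le_mul_of_nonneg_left (rpow_add_nat_le hε hε1 hN hk (by omega)) hC.le)
  · rw [Nat.card_Icc, Nat.add_sub_cancel, nsmul_eq_mul]
    calc ((N / d : ℕ) : ℝ) * (C * (2 * k * (N : ℝ) ^ ε)) ≤
          (N : ℝ) / d * (C * (2 * k * (N : ℝ) ^ ε)) := by
          gcongr
          exact Nat.cast_div_le
      _ = _ := by rw [Real.rpow_add hN0, Real.rpow_one]; ring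

lemma rpow_tail_le {ε : ℝ} (hε1 : ε ≤ 1 / 8) {d N : ℕ} (hN : 1 ≤ N)
    (hd : N.sqrt < d) :
    (d : ℝ) ^ (3 * ε) / d ≤ (N : ℝ) ^ (-(1 / 4) + 2 * ε) * (d : ℝ) ^ (-(1 / 2) - ε) := by
  have hd0 : (0 : ℝ) < d := by exact_mod_cast (Nat.zero_le _).trans_lt hd
  have hN0 : (0 : ℝ) < N := by exact_mod_cast hN
  have h1 : (N : ℝ) ≤ (d : ℝ) ^ (2 : ℝ) := by
    rw [Real.rpow_two, sq]
    exact_mod_cast (Nat.sqrt_lt.1 hd).le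
  have e : (d : ℝ) ^ (3 * ε) / d =
      ((d : ℝ) ^ (2 : ℝ)) ^ (-(1 / 4) + 2 * ε) * (d : ℝ) ^ (-(1 / 2) - ε) := by
    rw [← Real.rpow_mul hd0.le, ← Real.rpow_add hd0, ← Real.rpow_sub_one hd0.ne']
    congr 1
    ring
  rw [e]
  refine mul_le_mul_of_nonneg_right ?_ (by positivity)
  exact Real.rpow_le_rpow_of_nonpos hN0 h1 (by linarith)

open Finset in
lemma abs_tsum_sub_sum_sqrt_le {ε : ℝ} (hε : 0 < ε) (hε1 : ε ≤ 1 / 8) {f : ℕ → ℝ} {C : ℝ}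
    (hC : 0 ≤ C) (hf : ∀ d, |f d| ≤ C * (d : ℝ) ^ (3 * ε) / d) (hf' : ∀ d, ¬Squarefull d → f d = 0)
    {N : ℕ} (hN : 1 ≤ N) :
    |∑' d, f d - ∑ d ∈ Icc 1 N.sqrt, f d| ≤
      C * (∑' d, squarefullWeight ε d) * (N : ℝ) ^ (-(1 / 4) + 2 * ε) := by
  classical
  have hs := summable_squarefullWeight hε
  set f₁ : ℕ → ℝ := fun d => if d ∈ Icc 1 N.sqrt then f d else 0 with hf₁
  have hsum₁ : HasSum f₁ (∑ d ∈ Icc 1 N.sqrt, f d) := by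
    have h1 : HasSum f₁ (∑ d ∈ Icc 1 N.sqrt, f₁ d) :=
      hasSum_sum_of_ne_finset_zero fun d hd => if_neg hd
    have e : ∑ d ∈ Icc 1 N.sqrt, f₁ d = ∑ d ∈ Icc 1 N.sqrt, f d :=
      Finset.sum_congr rfl fun d hd => if_pos hd
    rwa [e] at h1
  have hg : HasSum (fun d => C * (N : ℝ) ^ (-(1 / 4) + 2 * ε) * squarefullWeight ε d)
      (C * (N : ℝ) ^ (-(1 / 4) + 2 * ε) * ∑' d, squarefullWeight ε d) := hs.hasSum.mul_left _
  have hbd : ∀ d, ‖f d - f₁ d‖ ≤ C * (N : ℝ) ^ (-(1 / 4) + 2 * ε) * squarefullWeight ε d := by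
    intro d
    have hw := squarefullWeight_nonneg ε d
    rw [Real.norm_eq_abs]
    by_cases hd : d ∈ Icc 1 N.sqrt
    · simp only [hf₁, hd, if_true, sub_self, abs_zero]
      positivity
    · simp only [hf₁, hd, if_false, sub_zero]
      by_cases hsq : Squarefull d
      · rcases Nat.eq_zero_or_pos d with rfl | hd0
        · refine (hf 0).trans ?_
          simp only [Nat.cast_zero, div_zero]
          positivity
        · have hlt : N.sqrt < d := by
            by_contra h
            exact hd (mem_Icc.2 ⟨hd0, not_lt.1 h⟩)
          refine (hf d).trans ?_
          rw [squarefullWeight, if_pos hsq, mul_div_assoc, mul_assoc]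
          exact mul_le_mul_of_nonneg_left (rpow_tail_le hε1 hN hlt) hC
      · rw [hf' d hsq, abs_zero]
        positivity
  have hsf : Summable f := by
    have h1 : Summable fun d => f d - f₁ d := Summable.of_norm_bounded hg.summable hbd
    simpa using h1.add hsum₁.summable
  have h2 := tsum_of_norm_bounded hg hbd
  rw [hsf.tsum_sub hsum₁.summable, hsum₁.tsum_eq, Real.norm_eq_abs] at h2
  refine h2.trans (le_of_eq ?_)
  ring

open Finset in
lemma exists_sum_sq_abelianCount_le {ε : ℝ} (hε : 0 < ε) : ∃ C : ℝ, 0 < C ∧ ∀ d : ℕ, 1 ≤ d →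
    ∑ e ∈ d.divisors, (abelianCount e : ℝ) ^ 2 ≤ C * (d : ℝ) ^ ε := by
  obtain ⟨C₁, hC₁, h₁⟩ := exists_abelianCount_le (ε := ε / 3) (by positivity)
  obtain ⟨C₂, hC₂, h₂⟩ := exists_card_divisors_le (ε := ε / 3) (by positivity)
  refine ⟨C₂ * C₁ ^ 2, by positivity, fun d hd => ?_⟩
  have hd0 : (0 : ℝ) < d := by exact_mod_cast hd
  have h3 : ∀ e ∈ d.divisors, (abelianCount e : ℝ) ^ 2 ≤ (C₁ * (d : ℝ) ^ (ε / 3)) ^ 2 := by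
    intro e he
    have h4 : (e : ℝ) ≤ d := by exact_mod_cast Nat.divisor_le he
    refine pow_le_pow_left₀ (by positivity) ((h₁ e (Nat.pos_of_mem_divisors he).ne').trans ?_) 2
    gcongr
  refine (Finset.sum_le_card_nsmul _ _ _ h3).trans ?_
  rw [nsmul_eq_mul]
  have e1 : (d : ℝ) ^ ε = (d : ℝ) ^ (ε / 3) * ((d : ℝ) ^ (ε / 3)) ^ 2 := by
    rw [← Real.rpow_natCast, ← Real.rpow_mul hd0.le, ← Real.rpow_add hd0]
    congr 1
    push_cast
    ring
  calc (#d.divisors : ℝ) * (C₁ * (d : ℝ) ^ (ε / 3)) ^ 2 ≤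
        C₂ * (d : ℝ) ^ (ε / 3) * (C₁ * (d : ℝ) ^ (ε / 3)) ^ 2 := by
        gcongr
        exact h₂ d
    _ = _ := by rw [e1]; ring

open Finset ArithmeticFunction in
lemma abs_sum_moebius_mul_le {d : ℕ} {x : ℕ → ℝ} {K : ℝ}
    (hx : ∀ e ∈ d.divisors, |x e| ≤ K * (abelianCount e : ℝ) ^ 2) :
    |∑ e ∈ d.divisors, (moebius (d / e) : ℝ) * x e| ≤
      K * ∑ e ∈ d.divisors, (abelianCount e : ℝ) ^ 2 := by
  rw [Finset.mul_sum]
  refine (Finset.abs_sum_le_sum_abs _ _).trans (Finset.sum_le_sum fun e he => ?_)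
  have h1 : |(moebius (d / e) : ℝ)| ≤ 1 := by exact_mod_cast abs_moebius_le_one
  rw [abs_mul]
  exact (mul_le_of_le_one_left (abs_nonneg _) h1).trans (hx e he)

open Finset ArithmeticFunction in
open Classical in
/-- The Möbius-twisted average over divisors of `F d (abelianCount e)`, on squarefull `d`. -/
noncomputable def squarefullCoeff (F : ℕ → ℕ → ℝ) (d : ℕ) : ℝ :=
  if Squarefull d then ∑ e ∈ d.divisors, (moebius (d / e) : ℝ) * F d (abelianCount e) else 0

lemma natCast_le_sq (k : ℕ) : (k : ℝ) ≤ (k : ℝ) ^ 2 := by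
  exact_mod_cast Nat.le_self_pow two_ne_zero k

lemma exists_abs_squarefullCoeff_le {ε C : ℝ} (hε : 0 < ε) (hC : 0 < C) {F : ℕ → ℕ → ℝ}
    (hF : ∀ d k : ℕ, 1 ≤ d → 1 ≤ k → |F d k| ≤ C * k * (d : ℝ) ^ ε / d) :
    ∃ C' : ℝ, 0 < C' ∧ ∀ d, |squarefullCoeff F d| ≤ C' * (d : ℝ) ^ (3 * ε) / d := by
  obtain ⟨C₁, hC₁, h₁⟩ := exists_sum_sq_abelianCount_le (ε := 2 * ε) (by positivity)
  refine ⟨C * C₁, by positivity, fun d => ?_⟩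
  unfold squarefullCoeff
  split_ifs with h
  · rcases Nat.eq_zero_or_pos d with rfl | hd
    · simp
    have hd0 : (0 : ℝ) < d := by exact_mod_cast hd
    have h2 := abs_sum_moebius_mul_le (d := d) (x := fun e => F d (abelianCount e))
      (K := C * (d : ℝ) ^ ε / d) (fun e _ => by
        refine (hF d _ hd (one_le_abelianCount e)).trans ?_
        calc C * (abelianCount e : ℝ) * (d : ℝ) ^ ε / d =
            C * (d : ℝ) ^ ε / d * (abelianCount e : ℝ) := by ring
          _ ≤ _ := mul_le_mul_of_nonneg_left (natCast_le_sq _) (by positivity))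
    refine h2.trans ((mul_le_mul_of_nonneg_left (h₁ d hd) (by positivity)).trans (le_of_eq ?_))
    have e1 : (d : ℝ) ^ (3 * ε) = (d : ℝ) ^ ε * (d : ℝ) ^ (2 * ε) := by
      rw [← Real.rpow_add hd0]
      congr 1
      ring
    rw [e1]
    ring
  · rw [abs_zero]
    positivity

lemma squarefullCoeff_of_not {F : ℕ → ℕ → ℝ} {d : ℕ} (hd : ¬Squarefull d) :
    squarefullCoeff F d = 0 := if_neg hd

/-- The contribution of the modulus `d` to the shifted sum. -/
noncomputable def shiftedSum (N d k : ℕ) : ℝ :=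
  ∑ n ∈ Finset.Icc 1 N, if d ∣ n then (d3 (n + k) : ℝ) else 0

open Finset ArithmeticFunction in
lemma exists_abs_sum_shiftedSum_sub_le {A B G : ℕ → ℕ → ℝ} {ε C : ℝ} (hε : 0 < ε)
    (hε1 : ε ≤ 1 / 8) (hC : 0 < C)
    (hABG : ∀ d k : ℕ, 1 ≤ d → 1 ≤ k → ∀ N : ℕ, d ≤ N.sqrt →
      |d3ClassSum d N k - N * (A d k * Real.log N ^ 2 + B d k * Real.log N + G d k)| ≤
        C * k * (N : ℝ) ^ (3 / 4 + ε) / √d) :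
    ∃ C' : ℝ, 0 < C' ∧ ∀ N d : ℕ, 1 ≤ d → d ≤ N.sqrt → Squarefull d →
      |∑ e ∈ d.divisors, (moebius (d / e) : ℝ) * shiftedSum N d (abelianCount e) -
        N * (squarefullCoeff A d * Real.log N ^ 2 + squarefullCoeff B d * Real.log N +
          squarefullCoeff G d)| ≤ C' * (N : ℝ) ^ (3 / 4 + 3 * ε) * squarefullWeight ε d := by
  obtain ⟨C₁, hC₁, h₁⟩ := exists_sum_sq_abelianCount_le hε
  obtain ⟨C₂, hC₂, h₂⟩ := exists_abs_sum_ite_dvd_shift_sub_le hε (by linarith)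
  refine ⟨(C₂ + C) * C₁, by positivity, fun N d hd hdN hsq => ?_⟩
  have hN : 1 ≤ N := Nat.sqrt_pos.1 (hd.trans hdN)
  have hd0 : (0 : ℝ) < d := by exact_mod_cast hd
  have hd1 : (1 : ℝ) ≤ d := by exact_mod_cast hd
  have hN0 : (0 : ℝ) < N := by exact_mod_cast hN
  have hdd : (d : ℝ) * d ≤ N := by exact_mod_cast Nat.le_sqrt.1 hdN
  have hdle : (d : ℝ) ≤ N := by nlinarith
  have hsd : √(d : ℝ) ≤ (N : ℝ) ^ (3 / 4 : ℝ) := by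
    calc √(d : ℝ) ≤ d := Real.sqrt_le_iff.2 ⟨hd0.le, by nlinarith⟩
      _ ≤ √N := Real.le_sqrt_of_sq_le (by linarith [sq (d : ℝ)])
      _ = (N : ℝ) ^ (1 / 2 : ℝ) := Real.sqrt_eq_rpow _
      _ ≤ _ := Real.rpow_le_rpow_of_exponent_le (by exact_mod_cast hN) (by norm_num)
  have hNε : (N : ℝ) ^ ε ≤ (N : ℝ) ^ (3 / 4 + ε) / √d := by
    rw [le_div_iff₀ (Real.sqrt_pos.2 hd0), Real.rpow_add hN0, mul_comm]
    gcongr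
  have e1 : ∑ e ∈ d.divisors, (moebius (d / e) : ℝ) * shiftedSum N d (abelianCount e) -
        N * (squarefullCoeff A d * Real.log N ^ 2 + squarefullCoeff B d * Real.log N +
          squarefullCoeff G d) =
      ∑ e ∈ d.divisors, (moebius (d / e) : ℝ) * (shiftedSum N d (abelianCount e) -
        N * (A d (abelianCount e) * Real.log N ^ 2 + B d (abelianCount e) * Real.log N +
          G d (abelianCount e))) := by
    simp only [squarefullCoeff, if_pos hsq, Finset.sum_mul, ← Finset.sum_add_distrib,
      Finset.mul_sum, ← Finset.sum_sub_distrib]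
    exact Finset.sum_congr rfl fun e _ => by ring
  rw [e1]
  refine (abs_sum_moebius_mul_le (K := (C₂ + C) * ((N : ℝ) ^ (3 / 4 + ε) / √d))
    fun e _ => ?_).trans ?_
  · set k := abelianCount e with hk
    have hk1 : 1 ≤ k := one_le_abelianCount e
    have h3 := h₂ N d k hN hk1
    have h4 := hABG d k hd hk1 N hdN
    refine (abs_sub_le _ (d3ClassSum d N k) _).trans ?_
    have h5 : C₂ * (k : ℝ) ^ 2 * (N : ℝ) ^ ε ≤
        C₂ * (k : ℝ) ^ 2 * ((N : ℝ) ^ (3 / 4 + ε) / √d) :=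
      mul_le_mul_of_nonneg_left hNε (by positivity)
    have h6 : C * k * (N : ℝ) ^ (3 / 4 + ε) / √d ≤
        C * ((N : ℝ) ^ (3 / 4 + ε) / √d) * (k : ℝ) ^ 2 := by
      calc _ = C * ((N : ℝ) ^ (3 / 4 + ε) / √d) * (k : ℝ) := by ring
        _ ≤ _ := mul_le_mul_of_nonneg_left (natCast_le_sq _) (by positivity)
    unfold shiftedSum
    linarith
  · refine (mul_le_mul_of_nonneg_left (h₁ d hd) (by positivity)).trans ?_
    rw [squarefullWeight, if_pos hsq]
    have e2 : (d : ℝ) ^ ε / √d = (d : ℝ) ^ (2 * ε) * (d : ℝ) ^ (-(1 / 2) - ε) := by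
      rw [Real.sqrt_eq_rpow, ← Real.rpow_sub hd0, ← Real.rpow_add hd0]
      congr 1
      ring
    have e3 : (N : ℝ) ^ (3 / 4 + 3 * ε) = (N : ℝ) ^ (3 / 4 + ε) * (N : ℝ) ^ (2 * ε) := by
      rw [← Real.rpow_add hN0]
      congr 1
      ring
    calc (C₂ + C) * ((N : ℝ) ^ (3 / 4 + ε) / √d) * (C₁ * (d : ℝ) ^ ε) =
          (C₂ + C) * C₁ * (N : ℝ) ^ (3 / 4 + ε) * ((d : ℝ) ^ ε / √d) := by ring
      _ = (C₂ + C) * C₁ * (N : ℝ) ^ (3 / 4 + ε) * (d : ℝ) ^ (2 * ε) *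
          (d : ℝ) ^ (-(1 / 2) - ε) := by rw [e2]; ring
      _ ≤ (C₂ + C) * C₁ * (N : ℝ) ^ (3 / 4 + ε) * (N : ℝ) ^ (2 * ε) *
          (d : ℝ) ^ (-(1 / 2) - ε) := by gcongr
      _ = _ := by rw [e3]; ring

open Finset ArithmeticFunction in
lemma exists_abs_sum_shiftedSum_le {ε : ℝ} (hε : 0 < ε) (hε1 : ε ≤ 1 / 8) :
    ∃ C' : ℝ, 0 < C' ∧ ∀ N d : ℕ, 1 ≤ N → N.sqrt < d → Squarefull d →
      |∑ e ∈ d.divisors, (moebius (d / e) : ℝ) * shiftedSum N d (abelianCount e)| ≤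
        C' * (N : ℝ) ^ (3 / 4 + 3 * ε) * squarefullWeight ε d := by
  obtain ⟨C₁, hC₁, h₁⟩ := exists_sum_sq_abelianCount_le (ε := 3 * ε) (by positivity)
  obtain ⟨C₂, hC₂, h₂⟩ := exists_sum_ite_dvd_shift_le hε (by linarith)
  refine ⟨C₂ * C₁, by positivity, fun N d hN hdN hsq => ?_⟩
  have hd : 1 ≤ d := Nat.one_le_of_lt hdN
  have hN0 : (0 : ℝ) < N := by exact_mod_cast hN
  refine (abs_sum_moebius_mul_le (K := C₂ * (N : ℝ) ^ (1 + ε) / d) fun e _ => ?_).trans ?_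
  · have h3 := h₂ N d (abelianCount e) hN hd (one_le_abelianCount e)
    have h0 : 0 ≤ shiftedSum N d (abelianCount e) :=
      Finset.sum_nonneg fun n _ => by split_ifs <;> positivity
    rw [abs_of_nonneg h0]
    calc shiftedSum N d (abelianCount e) ≤ _ := h3
      _ = C₂ * (N : ℝ) ^ (1 + ε) / d * (abelianCount e : ℝ) := by ring
      _ ≤ _ := mul_le_mul_of_nonneg_left (natCast_le_sq _) (by positivity)
  · refine (mul_le_mul_of_nonneg_left (h₁ d hd) (by positivity)).trans ?_
    rw [squarefullWeight, if_pos hsq]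
    have e3 : (N : ℝ) ^ (3 / 4 + 3 * ε) = (N : ℝ) ^ (1 + ε) * (N : ℝ) ^ (-(1 / 4) + 2 * ε) := by
      rw [← Real.rpow_add hN0]
      congr 1
      ring
    calc C₂ * (N : ℝ) ^ (1 + ε) / d * (C₁ * (d : ℝ) ^ (3 * ε)) =
          C₂ * C₁ * (N : ℝ) ^ (1 + ε) * ((d : ℝ) ^ (3 * ε) / d) := by ring
      _ ≤ C₂ * C₁ * (N : ℝ) ^ (1 + ε) *
          ((N : ℝ) ^ (-(1 / 4) + 2 * ε) * (d : ℝ) ^ (-(1 / 2) - ε)) :=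
        mul_le_mul_of_nonneg_left (rpow_tail_le hε1 hN hdN) (by positivity)
      _ = _ := by rw [e3]; ring

open Finset ArithmeticFunction in
open Classical in
lemma abs_sum_squarefull_sub_le {N : ℕ} {I M : ℕ → ℝ} {ε K₁ K₂ : ℝ} (hε : 0 < ε)
    (hK₁ : 0 ≤ K₁) (hK₂ : 0 ≤ K₂) (hM : ∀ d, ¬Squarefull d → M d = 0)
    (h₁ : ∀ d, 1 ≤ d → d ≤ N.sqrt → Squarefull d → |I d - M d| ≤ K₁ * squarefullWeight ε d)
    (h₂ : ∀ d, N.sqrt < d → Squarefull d → |I d| ≤ K₂ * squarefullWeight ε d) :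
    |∑ d ∈ Icc 1 N with Squarefull d, I d - ∑ d ∈ Icc 1 N.sqrt, M d| ≤
      (K₁ + K₂) * ∑' d, squarefullWeight ε d := by
  have e1 : ∑ d ∈ Icc 1 N.sqrt, M d = ∑ d ∈ Icc 1 N, if d ≤ N.sqrt then M d else 0 := by
    rw [← Finset.sum_filter]
    refine Finset.sum_congr ?_ fun _ _ => rfl
    ext d
    have := Nat.sqrt_le_self N
    simp only [mem_Icc, mem_filter]
    omega
  rw [e1, Finset.sum_filter, ← Finset.sum_sub_distrib]
  refine (Finset.abs_sum_le_sum_abs _ _).trans ?_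
  refine (Finset.sum_le_sum (g := fun d => (K₁ + K₂) * squarefullWeight ε d)
    fun d hd => ?_).trans ?_
  · have hd1 := (mem_Icc.1 hd).1
    have hw := squarefullWeight_nonneg ε d
    by_cases hs : Squarefull d
    · rw [if_pos hs]
      split_ifs with hdN
      · refine (h₁ d hd1 hdN hs).trans ?_
        gcongr
        linarith
      · rw [sub_zero]
        refine (h₂ d (not_le.1 hdN) hs).trans ?_
        gcongr
        linarith
    · rw [if_neg hs, hM d hs, ite_self, sub_zero, abs_zero]
      positivity
  · rw [← Finset.mul_sum]
    exact mul_le_mul_of_nonneg_left ((summable_squarefullWeight hε).sum_le_tsum _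
      fun d _ => squarefullWeight_nonneg ε d) (by positivity)

open Finset ArithmeticFunction in
lemma exists_abs_sum_d3_add_abelianCount_natCast_sub_le : ∃ α β γ : ℝ, ∀ ε : ℝ, 0 < ε → ε ≤ 1 / 8 →
    ∃ C : ℝ, 0 < C ∧ ∀ N : ℕ, 1 ≤ N →
      |∑ n ∈ Icc 1 N, (d3 (n + abelianCount n) : ℝ) -
        N * (α * Real.log N ^ 2 + β * Real.log N + γ)| ≤ C * (N : ℝ) ^ (3 / 4 + 4 * ε) := by
  obtain ⟨A, B, G, hABG⟩ := exists_d3ClassSum_natCast_approx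
  refine ⟨∑' d, squarefullCoeff A d, ∑' d, squarefullCoeff B d, ∑' d, squarefullCoeff G d,
    fun ε hε hε1 => ?_⟩
  obtain ⟨C, hC, h⟩ := hABG ε hε
  obtain ⟨CA, hCA, hA⟩ := exists_abs_squarefullCoeff_le (F := A) hε hC
    fun d k hd hk => (h d k hd hk).1
  obtain ⟨CB, hCB, hB⟩ := exists_abs_squarefullCoeff_le (F := B) hε hC
    fun d k hd hk => (h d k hd hk).2.1
  obtain ⟨CG, hCG, hG⟩ := exists_abs_squarefullCoeff_le (F := G) hε hC
    fun d k hd hk => (h d k hd hk).2.2.1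
  obtain ⟨C₁, hC₁, h₁⟩ := exists_abs_sum_shiftedSum_sub_le hε hε1 hC
    fun d k hd hk => (h d k hd hk).2.2.2
  obtain ⟨C₂, hC₂, h₂⟩ := exists_abs_sum_shiftedSum_le hε hε1
  obtain ⟨C₃, hC₃, h₃⟩ := exists_one_add_log_le hε
  set W := ∑' d, squarefullWeight ε d with hW
  have hW0 : 0 ≤ W := tsum_nonneg (squarefullWeight_nonneg ε)
  set α := ∑' d, squarefullCoeff A d with hα
  set β := ∑' d, squarefullCoeff B d with hβ
  set γ := ∑' d, squarefullCoeff G d with hγ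
  refine ⟨(C₁ + C₂) * W + (CA + CB + CG) * W * C₃ ^ 2 + 1, by positivity, fun N hN => ?_⟩
  have hN0 : (0 : ℝ) < N := by exact_mod_cast hN
  have hN1 : (1 : ℝ) ≤ N := by exact_mod_cast hN
  have hL : 0 ≤ Real.log N := Real.log_nonneg hN1
  set L := Real.log N with hLdef
  have h4 := abs_sum_squarefull_sub_le (N := N)
    (I := fun d => ∑ e ∈ d.divisors, (moebius (d / e) : ℝ) * shiftedSum N d (abelianCount e))
    (M := fun d => N * (squarefullCoeff A d * L ^ 2 + squarefullCoeff B d * L +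
      squarefullCoeff G d)) hε (K₁ := C₁ * (N : ℝ) ^ (3 / 4 + 3 * ε))
    (K₂ := C₂ * (N : ℝ) ^ (3 / 4 + 3 * ε)) (by positivity) (by positivity)
    (fun d hd => by simp [squarefullCoeff_of_not hd])
    (fun d hd hdN hs => h₁ N d hd hdN hs) (fun d hdN hs => h₂ N d hN hdN hs)
  have e1 := sum_d3_add_abelianCount_eq N
  simp only [shiftedSum] at h4
  rw [← e1, ← hW] at h4
  have e2 : ∑ d ∈ Icc 1 N.sqrt, N * (squarefullCoeff A d * L ^ 2 + squarefullCoeff B d * L +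
      squarefullCoeff G d) = N * ((∑ d ∈ Icc 1 N.sqrt, squarefullCoeff A d) * L ^ 2 +
        (∑ d ∈ Icc 1 N.sqrt, squarefullCoeff B d) * L +
        ∑ d ∈ Icc 1 N.sqrt, squarefullCoeff G d) := by
    rw [← Finset.mul_sum, Finset.sum_add_distrib, Finset.sum_add_distrib, Finset.sum_mul,
      Finset.sum_mul]
  rw [e2] at h4
  have tA := abs_tsum_sub_sum_sqrt_le hε hε1 hCA.le hA (fun d => squarefullCoeff_of_not) hN
  have tB := abs_tsum_sub_sum_sqrt_le hε hε1 hCB.le hB (fun d => squarefullCoeff_of_not) hN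
  have tG := abs_tsum_sub_sum_sqrt_le hε hε1 hCG.le hG (fun d => squarefullCoeff_of_not) hN
  rw [← hα, ← hW] at tA
  rw [← hβ, ← hW] at tB
  rw [← hγ, ← hW] at tG
  set a := ∑ d ∈ Icc 1 N.sqrt, squarefullCoeff A d
  set b := ∑ d ∈ Icc 1 N.sqrt, squarefullCoeff B d
  set g := ∑ d ∈ Icc 1 N.sqrt, squarefullCoeff G d
  set T := (N : ℝ) ^ (-(1 / 4) + 2 * ε) with hT
  have hT0 : 0 ≤ T := by positivity
  have h5 : |(α - a) * L ^ 2 + (β - b) * L + (γ - g)| ≤ (CA + CB + CG) * W * T * (1 + L) ^ 2 := by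
    refine (abs_add_three _ _ _).trans ?_
    rw [abs_mul, abs_mul, abs_of_nonneg hL, abs_of_nonneg (sq_nonneg L)]
    have i1 : |α - a| * L ^ 2 ≤ CA * W * T * (1 + L) ^ 2 := by
      gcongr
      linarith
    have i2 : |β - b| * L ≤ CB * W * T * (1 + L) ^ 2 := by
      gcongr
      nlinarith
    have i3 : |γ - g| ≤ CG * W * T * (1 + L) ^ 2 :=
      tG.trans (le_mul_of_one_le_right (by positivity) (by nlinarith))
    linarith
  have h6 : (1 + L) ^ 2 ≤ C₃ ^ 2 * (N : ℝ) ^ (2 * ε) := by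
    calc (1 + L) ^ 2 ≤ (C₃ * (N : ℝ) ^ ε) ^ 2 :=
          pow_le_pow_left₀ (by linarith) (h₃ N hN1) 2
      _ = _ := by
          rw [mul_pow, ← Real.rpow_natCast ((N : ℝ) ^ ε), ← Real.rpow_mul hN0.le]
          congr 2
          push_cast
          ring
  have e3 : (N : ℝ) * T * (N : ℝ) ^ (2 * ε) = (N : ℝ) ^ (3 / 4 + 4 * ε) := by
    rw [hT, mul_comm (N : ℝ), ← Real.rpow_add_one hN0.ne', ← Real.rpow_add hN0]
    congr 1
    ring
  have h7 : |N * ((α - a) * L ^ 2 + (β - b) * L + (γ - g))| ≤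
      (CA + CB + CG) * W * C₃ ^ 2 * (N : ℝ) ^ (3 / 4 + 4 * ε) := by
    rw [abs_mul, abs_of_pos hN0, ← e3]
    calc (N : ℝ) * |(α - a) * L ^ 2 + (β - b) * L + (γ - g)| ≤
          N * ((CA + CB + CG) * W * T * (1 + L) ^ 2) := by gcongr
      _ ≤ N * ((CA + CB + CG) * W * T * (C₃ ^ 2 * (N : ℝ) ^ (2 * ε))) := by gcongr
      _ = _ := by ring
  have h8 : (N : ℝ) ^ (3 / 4 + 3 * ε) ≤ (N : ℝ) ^ (3 / 4 + 4 * ε) :=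
    Real.rpow_le_rpow_of_exponent_le hN1 (by linarith)
  have h9 : (C₁ * (N : ℝ) ^ (3 / 4 + 3 * ε) + C₂ * (N : ℝ) ^ (3 / 4 + 3 * ε)) * W ≤
      (C₁ + C₂) * W * (N : ℝ) ^ (3 / 4 + 4 * ε) := by
    calc _ = (C₁ + C₂) * W * (N : ℝ) ^ (3 / 4 + 3 * ε) := by ring
      _ ≤ _ := by gcongr
  have h10 : 0 ≤ (N : ℝ) ^ (3 / 4 + 4 * ε) := by positivity
  have e4 : ∀ S : ℝ, S - N * (α * L ^ 2 + β * L + γ) = (S - N * (a * L ^ 2 + b * L + g)) -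
      N * ((α - a) * L ^ 2 + (β - b) * L + (γ - g)) := fun S => by ring
  rw [e4]
  refine (abs_sub _ _).trans ?_
  linarith

open Finset in
lemma card_filter_modEq_le {r : ℕ} (hr : 0 < r) (N v : ℕ) :
    (#{x ∈ Ioc 0 N | x ≡ v [MOD r]} : ℝ) ≤ N / r + 1 := by
  have h := Nat.Ioc_filter_modEq_card 0 N hr v
  have h1 := Int.floor_le (((N : ℚ) - v) / r)
  have h2 := Int.lt_floor_add_one ((((0 : ℕ) : ℚ) - v) / r)
  have h3 : ((#{x ∈ Ioc 0 N | x ≡ v [MOD r]} : ℤ) : ℚ) ≤ N / r + 1 := by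
    rw [h]
    push_cast
    refine max_le ?_ (by positivity)
    have e : ((N : ℚ) - v) / r = N / r + (((0 : ℕ) : ℚ) - v) / r := by
      push_cast
      ring
    rw [e] at h1
    push_cast at h1 h2 ⊢
    rw [e]
    push_cast
    linarith
  have h4 := (Rat.cast_le (K := ℝ)).2 h3
  push_cast at h4
  exact h4

open Finset in
lemma card_filter_dvd_add_one_and_sq_dvd_le {q m : ℕ} (hq : 0 < q) (hm : 0 < m) (N : ℕ) :
    (#{n ∈ Icc 1 N | q ∣ n + 1 ∧ m * m ∣ n} : ℝ) ≤ N / q * ((m : ℝ) ^ 2)⁻¹ + 1 := by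
  rcases Finset.eq_empty_or_nonempty {n ∈ Icc 1 N | q ∣ n + 1 ∧ m * m ∣ n} with h | ⟨v, hv⟩
  · rw [h, Finset.card_empty, Nat.cast_zero]
    positivity
  obtain ⟨_, hvq, hvm⟩ := mem_filter.1 hv
  have hc : q.Coprime (m * m) := by
    have h1 : (v + 1).Coprime v := by simp
    exact (h1.coprime_dvd_left hvq).coprime_dvd_right hvm
  have hsub : {n ∈ Icc 1 N | q ∣ n + 1 ∧ m * m ∣ n} ⊆
      {x ∈ Ioc 0 N | x ≡ v [MOD q * (m * m)]} := by
    intro n hn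
    obtain ⟨hn1, hnq, hnm⟩ := mem_filter.1 hn
    refine mem_filter.2 ⟨by simpa [mem_Icc, mem_Ioc, Nat.succ_le_iff] using hn1, ?_⟩
    refine (Nat.modEq_and_modEq_iff_modEq_mul hc).1 ⟨?_, ?_⟩
    · have h2 : n + 1 ≡ v + 1 [MOD q] :=
        (Nat.modEq_zero_iff_dvd.2 hnq).trans (Nat.modEq_zero_iff_dvd.2 hvq).symm
      exact Nat.ModEq.add_right_cancel' 1 h2
    · exact (Nat.modEq_zero_iff_dvd.2 hnm).trans (Nat.modEq_zero_iff_dvd.2 hvm).symm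
  refine (Nat.cast_le.2 (Finset.card_le_card hsub)).trans
    ((card_filter_modEq_le (Nat.mul_pos hq (Nat.mul_pos hm hm)) N v).trans (le_of_eq ?_))
  push_cast
  rw [div_mul_eq_div_div, div_eq_mul_inv ((N : ℝ) / q), sq]

open Finset in
lemma sum_Icc_two_inv_sq_le (s : ℕ) : ∑ m ∈ Icc 2 s, ((m : ℝ) ^ 2)⁻¹ ≤ 3 / 4 := by
  rcases Nat.lt_or_ge s 2 with h | h
  · rw [Finset.Icc_eq_empty (by omega), Finset.sum_empty]
    norm_num
  suffices ∑ m ∈ Icc 2 s, ((m : ℝ) ^ 2)⁻¹ ≤ 3 / 4 - (s : ℝ)⁻¹ from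
    this.trans (sub_le_self _ (by positivity))
  induction s, h using Nat.le_induction with
  | base => norm_num
  | succ s hs ih =>
    have hs0 : (0 : ℝ) < s := by exact_mod_cast zero_lt_two.trans_le hs
    rw [Finset.sum_Icc_succ_top (by omega)]
    have h1 : (((s + 1 : ℕ) : ℝ) ^ 2)⁻¹ ≤ (s : ℝ)⁻¹ - ((s + 1 : ℕ) : ℝ)⁻¹ := by
      push_cast
      rw [inv_sub_inv hs0.ne' (by positivity), inv_eq_one_div, div_le_div_iff₀ (by positivity)
        (by positivity)]
      nlinarith
    linarith

open Finset in
open Classical in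
lemma card_squarefree_filter_ge {q : ℕ} (hq : 0 < q) (N : ℕ) :
    (N : ℝ) / q / 4 - 2 - √N ≤ #{n ∈ Icc 1 N | Squarefree n ∧ q ∣ n + 1} := by
  have hcover : {n ∈ range N | q ∣ n + 1} ⊆ ({n ∈ Icc 1 N | Squarefree n ∧ q ∣ n + 1} ∪ {0}) ∪
      (Icc 2 N.sqrt).biUnion fun m => {n ∈ Icc 1 N | q ∣ n + 1 ∧ m * m ∣ n} := by
    intro n hn
    obtain ⟨hn1, hnq⟩ := mem_filter.1 hn
    have hnN := mem_range.1 hn1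
    rcases Nat.eq_zero_or_pos n with rfl | hn0
    · simp
    have hnI : n ∈ Icc 1 N := mem_Icc.2 ⟨hn0, hnN.le⟩
    by_cases hs : Squarefree n
    · exact mem_union_left _ (mem_union_left _ (mem_filter.2 ⟨hnI, hs, hnq⟩))
    · rw [Nat.squarefree_iff_prime_squarefree] at hs
      push Not at hs
      obtain ⟨p, hp, hpn⟩ := hs
      refine mem_union_right _ (mem_biUnion.2 ⟨p, mem_Icc.2 ⟨hp.two_le, ?_⟩,
        mem_filter.2 ⟨hnI, hnq, hpn⟩⟩)
      exact Nat.le_sqrt.2 ((Nat.le_of_dvd hn0 hpn).trans hnN.le)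
  have h1 := (Finset.card_le_card hcover).trans ((Finset.card_union_le _ _).trans
    (add_le_add (Finset.card_union_le _ _) Finset.card_biUnion_le))
  rw [Nat.card_multiples, Finset.card_singleton] at h1
  have h2 : ((N / q : ℕ) : ℝ) ≤ #{n ∈ Icc 1 N | Squarefree n ∧ q ∣ n + 1} + 1 +
      ∑ m ∈ Icc 2 N.sqrt, (#{n ∈ Icc 1 N | q ∣ n + 1 ∧ m * m ∣ n} : ℝ) := by exact_mod_cast h1
  have h3 : ∑ m ∈ Icc 2 N.sqrt, (#{n ∈ Icc 1 N | q ∣ n + 1 ∧ m * m ∣ n} : ℝ) ≤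
      N / q * (3 / 4) + √N := by
    calc _ ≤ ∑ m ∈ Icc 2 N.sqrt, ((N : ℝ) / q * ((m : ℝ) ^ 2)⁻¹ + 1) :=
          Finset.sum_le_sum fun m hm => card_filter_dvd_add_one_and_sq_dvd_le hq
            (zero_lt_two.trans_le (mem_Icc.1 hm).1) N
      _ = (N : ℝ) / q * ∑ m ∈ Icc 2 N.sqrt, ((m : ℝ) ^ 2)⁻¹ + (N.sqrt + 1 - 2 : ℕ) := by
          rw [Finset.sum_add_distrib, Finset.mul_sum, Finset.sum_const, Nat.card_Icc, nsmul_eq_mul,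
            mul_one]
      _ ≤ _ := by
          gcongr
          · exact sum_Icc_two_inv_sq_le _
          · refine (Nat.cast_le.2 (by omega : N.sqrt + 1 - 2 ≤ N.sqrt)).trans ?_
            exact Real.nat_sqrt_le_real_sqrt
  have h4 : (N : ℝ) / q < (N / q : ℕ) + 1 := by
    rw [div_lt_iff₀ (by exact_mod_cast hq)]
    exact_mod_cast Nat.lt_div_mul_add hq |>.trans_eq (by ring)
  linarith

open Finset in
lemma sum_card_divisors_ite_le_d3 (Q : ℕ) {m : ℕ} (hm : m ≠ 0) :
    ∑ q ∈ Icc 1 Q, (if q ∣ m then (#q.divisors : ℝ) else 0) ≤ d3 m := by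
  rw [← Finset.sum_filter, d3_eq_sum hm, Nat.sum_div_divisors m fun q => #q.divisors, Nat.cast_sum]
  refine Finset.sum_le_sum_of_subset_of_nonneg (fun q hq => ?_) fun _ _ _ => by positivity
  exact Nat.mem_divisors.2 ⟨(mem_filter.1 hq).2, hm⟩

open Finset in
lemma sum_card_divisors_div_ge {R : ℕ} (hR : 1 ≤ R) :
    Real.log R ^ 2 ≤ ∑ q ∈ Icc 1 (R ^ 2), (#q.divisors : ℝ) * (q : ℝ)⁻¹ := by
  have h1 : Real.log R ≤ ∑ a ∈ Icc 1 R, (a : ℝ)⁻¹ := by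
    have h2 := log_add_one_le_harmonic R
    rw [harmonic_eq_sum_Icc] at h2
    push_cast at h2
    exact (Real.log_le_log (by exact_mod_cast hR) (by linarith)).trans h2
  have h0 : 0 ≤ Real.log R := Real.log_natCast_nonneg R
  rw [sum_card_divisors_mul (R ^ 2) fun q => (q : ℝ)⁻¹]
  calc Real.log R ^ 2 ≤ (∑ a ∈ Icc 1 R, (a : ℝ)⁻¹) * ∑ b ∈ Icc 1 R, (b : ℝ)⁻¹ := by
        rw [sq]
        exact mul_le_mul h1 h1 h0 (h0.trans h1)
    _ = ∑ a ∈ Icc 1 R, ∑ b ∈ Icc 1 R, ((a * b : ℕ) : ℝ)⁻¹ := by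
        rw [Finset.sum_mul_sum]
        refine Finset.sum_congr rfl fun a _ => Finset.sum_congr rfl fun b _ => ?_
        push_cast
        rw [mul_inv]
    _ ≤ ∑ a ∈ Icc 1 R, ∑ b ∈ Icc 1 (R ^ 2 / a), ((a * b : ℕ) : ℝ)⁻¹ := by
        refine Finset.sum_le_sum fun a ha => ?_
        refine Finset.sum_le_sum_of_subset_of_nonneg (Finset.Icc_subset_Icc_right ?_)
          fun _ _ _ => by positivity
        obtain ⟨ha1, haR⟩ := mem_Icc.1 ha
        rw [Nat.le_div_iff_mul_le ha1, sq]
        exact Nat.mul_le_mul_left R haR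
    _ ≤ _ := Finset.sum_le_sum_of_subset_of_nonneg
        (Finset.Icc_subset_Icc_right (Nat.le_self_pow two_ne_zero R))
        fun _ _ _ => Finset.sum_nonneg fun _ _ => by positivity

open Finset in
lemma sum_card_divisors_le (Q : ℕ) : ∑ q ∈ Icc 1 Q, (#q.divisors : ℝ) ≤ (Q : ℝ) ^ 2 := by
  refine (Finset.sum_le_card_nsmul _ _ (Q : ℝ) fun q hq => ?_).trans ?_
  · exact_mod_cast (Nat.card_divisors_le_self q).trans (mem_Icc.1 hq).2
  · rw [Nat.card_Icc, Nat.add_sub_cancel, nsmul_eq_mul, sq]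

open Finset in
lemma sum_d3_add_abelianCount_ge {R : ℕ} (hR : 1 ≤ R) :
    ((R ^ 16 : ℕ) : ℝ) * (Real.log R ^ 2 / 4 - 3) ≤
      ∑ n ∈ Icc 1 (R ^ 16), (d3 (n + abelianCount n) : ℝ) := by
  classical
  set N := R ^ 16 with hN
  have hR1 : (1 : ℝ) ≤ R := by exact_mod_cast hR
  have hsq : √(N : ℝ) = (R : ℝ) ^ 8 := by
    rw [hN, show ((R ^ 16 : ℕ) : ℝ) = ((R : ℝ) ^ 8) ^ 2 by push_cast; ring]
    exact Real.sqrt_sq (by positivity)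
  have h1 : ∑ q ∈ Icc 1 (R ^ 2), (#q.divisors : ℝ) *
      #{n ∈ Icc 1 N | Squarefree n ∧ q ∣ n + 1} ≤
      ∑ n ∈ Icc 1 N, (d3 (n + abelianCount n) : ℝ) := by
    calc _ = ∑ n ∈ Icc 1 N with Squarefree n, ∑ q ∈ Icc 1 (R ^ 2),
          (if q ∣ n + 1 then (#q.divisors : ℝ) else 0) := by
          rw [Finset.sum_comm]
          refine Finset.sum_congr rfl fun q _ => ?_
          rw [← Finset.sum_filter, Finset.sum_const, nsmul_eq_mul, Finset.filter_filter, mul_comm]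
      _ ≤ ∑ n ∈ Icc 1 N with Squarefree n, (d3 (n + abelianCount n) : ℝ) := by
          refine Finset.sum_le_sum fun n hn => ?_
          rw [abelianCount_of_squarefree (mem_filter.1 hn).2]
          exact sum_card_divisors_ite_le_d3 _ (Nat.succ_ne_zero n)
      _ ≤ _ := Finset.sum_le_sum_of_subset_of_nonneg (Finset.filter_subset _ _)
          fun _ _ _ => by positivity
  refine le_trans ?_ h1
  have h2 : ∀ q ∈ Icc 1 (R ^ 2), (N : ℝ) / 4 * ((#q.divisors : ℝ) * (q : ℝ)⁻¹) -
      3 * (R : ℝ) ^ 8 * (#q.divisors : ℝ) ≤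
      (#q.divisors : ℝ) * #{n ∈ Icc 1 N | Squarefree n ∧ q ∣ n + 1} := by
    intro q hq
    have h3 := card_squarefree_filter_ge (mem_Icc.1 hq).1 N
    have h4 : (1 : ℝ) ≤ (R : ℝ) ^ 8 := one_le_pow₀ hR1
    rw [hsq] at h3
    have h5 : (N : ℝ) / q / 4 - 3 * (R : ℝ) ^ 8 ≤
        #{n ∈ Icc 1 N | Squarefree n ∧ q ∣ n + 1} := by linarith
    calc _ = (#q.divisors : ℝ) * ((N : ℝ) / q / 4 - 3 * (R : ℝ) ^ 8) := by ring
      _ ≤ _ := mul_le_mul_of_nonneg_left h5 (by positivity)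
  refine le_trans ?_ (Finset.sum_le_sum h2)
  rw [Finset.sum_sub_distrib, ← Finset.mul_sum, ← Finset.mul_sum]
  have h6 : (N : ℝ) / 4 * Real.log R ^ 2 ≤
      (N : ℝ) / 4 * ∑ q ∈ Icc 1 (R ^ 2), (#q.divisors : ℝ) * (q : ℝ)⁻¹ :=
    mul_le_mul_of_nonneg_left (sum_card_divisors_div_ge hR) (by positivity)
  have h7 : 3 * (R : ℝ) ^ 8 * ∑ q ∈ Icc 1 (R ^ 2), (#q.divisors : ℝ) ≤ 3 * N := by
    calc _ ≤ 3 * (R : ℝ) ^ 8 * ((R ^ 2 : ℕ) : ℝ) ^ 2 :=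
          mul_le_mul_of_nonneg_left (sum_card_divisors_le _) (by positivity)
      _ = 3 * (R : ℝ) ^ 12 := by push_cast; ring
      _ ≤ 3 * (R : ℝ) ^ 16 := by
          gcongr
          norm_num
      _ = _ := by rw [hN]; push_cast; ring
  linarith

open Finset Filter in
lemma leadingCoeff_ne_zero {α β γ C : ℝ}
    (h : ∀ N : ℕ, 1 ≤ N → |∑ n ∈ Icc 1 N, (d3 (n + abelianCount n) : ℝ) -
      N * (α * Real.log N ^ 2 + β * Real.log N + γ)| ≤ C * N) : α ≠ 0 := by
  rintro rfl
  have hlim : Tendsto (fun R : ℕ => Real.log R) atTop atTop :=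
    Real.tendsto_log_atTop.comp tendsto_natCast_atTop_atTop
  obtain ⟨R, hR1, hR⟩ := ((eventually_ge_atTop 1).and
    (hlim.eventually_ge_atTop (64 * |β| + 4 * |γ| + 4 * |C| + 13))).exists
  have h1 := sum_d3_add_abelianCount_ge hR1
  have h2 := (abs_le.1 (h (R ^ 16) (Nat.one_le_pow _ _ hR1))).2
  have hN : (0 : ℝ) < ((R ^ 16 : ℕ) : ℝ) := by exact_mod_cast Nat.pow_pos hR1
  have hlog : Real.log ((R ^ 16 : ℕ) : ℝ) = 16 * Real.log R := by
    push_cast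
    rw [Real.log_pow]
    norm_num
  rw [hlog] at h2
  have h3 : Real.log R ^ 2 / 4 - 3 ≤ β * (16 * Real.log R) + γ + C := by
    refine le_of_mul_le_mul_left ?_ hN
    linarith
  have := le_abs_self β
  have := le_abs_self γ
  have := le_abs_self C
  have := abs_nonneg β
  have := abs_nonneg γ
  have := abs_nonneg C
  set L := Real.log R
  nlinarith

open Filter in
theorem sum_d3_shift :
    ∃ Q : Polynomial ℝ, Q.degree = 2 ∧ ∀ ε : ℝ, 0 < ε →
      (fun x : ℝ =>
          (∑ n ∈ Finset.Icc 1 ⌊x⌋₊, (d3 (n + abelianCount n) : ℝ)) -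
            x * Q.eval (Real.log x))
        =O[atTop] fun x : ℝ => x ^ ((3 : ℝ) / 4 + ε) := by
  obtain ⟨α, β, γ, h⟩ := exists_abs_sum_d3_add_abelianCount_natCast_sub_le
  have hα : α ≠ 0 := by
    obtain ⟨C, _, hC⟩ := h (1 / 16) (by norm_num) (by norm_num)
    refine leadingCoeff_ne_zero (β := β) (γ := γ) (C := C) fun N hN => ?_
    have h1 := hC N hN
    rwa [show (3 / 4 + 4 * (1 / 16) : ℝ) = 1 by norm_num, Real.rpow_one] at h1
  refine ⟨Polynomial.C α * Polynomial.X ^ 2 + Polynomial.C β * Polynomial.X + Polynomial.C γ,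
    Polynomial.degree_quadratic hα, fun ε hε => ?_⟩
  have hδ : 0 < min (ε / 4) (1 / 8) := by positivity
  obtain ⟨C, hC, hN⟩ := h _ hδ (min_le_right _ _)
  refine Asymptotics.IsBigO.of_bound (C + (20 * |α| + 2 * |β| + |γ|))
    ((eventually_ge_atTop 1).mono fun x hx => ?_)
  have hx0 : 0 < x := zero_lt_one.trans_le hx
  have h1 := hN ⌊x⌋₊ (Nat.floor_pos.2 hx)
  have h2 := abs_mul_log_poly_sub_floor_le α β γ hx
  have h3 : ((⌊x⌋₊ : ℕ) : ℝ) ^ (3 / 4 + 4 * min (ε / 4) (1 / 8)) ≤ x ^ (3 / 4 + ε) := by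
    calc _ ≤ x ^ (3 / 4 + 4 * min (ε / 4) (1 / 8)) :=
          Real.rpow_le_rpow (by positivity) (Nat.floor_le hx0.le) (by positivity)
      _ ≤ _ := Real.rpow_le_rpow_of_exponent_le hx (by linarith [min_le_left (ε / 4) (1 / 8)])
  have h4 : √x ≤ x ^ (3 / 4 + ε) := by
    rw [Real.sqrt_eq_rpow]
    exact Real.rpow_le_rpow_of_exponent_le hx (by linarith)
  simp only [Polynomial.eval_add, Polynomial.eval_mul, Polynomial.eval_pow, Polynomial.eval_C,
    Polynomial.eval_X]
  rw [Real.norm_eq_abs, Real.norm_of_nonneg (by positivity)]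
  rw [abs_sub_comm] at h2
  refine (abs_sub_le _ _ _).trans ((add_le_add h1 h2).trans ?_)
  rw [add_mul C]
  exact add_le_add (mul_le_mul_of_nonneg_left h3 hC.le)
    (mul_le_mul_of_nonneg_left h4 (by positivity))
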